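/- arXiv:2112.14421 — 4 statements merged into one kernel-verified Lean document; each statement's English description precedes it below -/
import Mathlib

section
/- Let $n \geq k \geq 2$, let $P$ be a $(k-1)$-dimensional polytope with $p \in P$, and for every nonempty proper face $\tau$ of $P$ let $y^1_\tau,\dots,y^n_\tau \in \tau$. Suppose $(A^i_\tau \mid i \in [n], \tau \in F(P))$ is a family of closed subsets of $P$ such that for every $I \subseteq [n]$ with $|I| = n-k+1$, the family $(\bigcup_{j\in I} A^j_\tau \mid \tau \in F(P))$ is a Komiya cover of $P$. Then there exists an injection $\pi : [k] \to [n]$ and faces $\tau_1,\dots,\tau_k$ such that $p \in \mathrm{conv}\{y^{\pi(1)}_{\tau_1},\dots,y^{\pi(k)}_{\tau_k}\}$ and $\bigcap_{i=1}^k A^{\pi(i)}_{\tau_i} \neq \emptyset$. -/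
open Set

/-- `σ` is a nonempty proper face of the polytope `P`. -/
def IsProperFace {m : ℕ} (P σ : Set (EuclideanSpace ℝ (Fin m))) : Prop :=
  σ.Nonempty ∧ σ ≠ P ∧ IsExtreme ℝ P σ

/-- `σ` is a nonempty face of the polytope `P` (possibly `P` itself). -/
def IsFace {m : ℕ} (P σ : Set (EuclideanSpace ℝ (Fin m))) : Prop :=
  IsProperFace P σ ∨ σ = P

theorem exists_proj {E : Type*} [NormedAddCommGroup E] [InnerProductSpace ℝ E]
    {K : Set E} (hne : K.Nonempty) (hK : IsCompact K) (hc : Convex ℝ K) :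
    ∃ r : E → E, (∀ x, r x ∈ K) ∧ (∀ x, ∀ z ∈ K, inner ℝ (x - r x) (z - r x) ≤ 0) ∧
      LipschitzWith 1 r := by
  have h : ∀ x, ∃ v ∈ K, ∀ z ∈ K, inner ℝ (x - v) (z - v) ≤ 0 := by
    intro x
    obtain ⟨v, hv, hv'⟩ := exists_norm_eq_iInf_of_complete_convex hne hK.isComplete hc x
    exact ⟨v, hv, (norm_eq_iInf_iff_real_inner_le_zero hc hv).1 hv'⟩
  choose r hr hr' using h
  refine ⟨r, hr, hr', LipschitzWith.of_dist_le_mul fun x y => ?_⟩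
  simp only [NNReal.coe_one, one_mul, dist_eq_norm]
  have h1 := hr' x (r y) (hr y)
  have h2 := hr' y (r x) (hr x)
  have h3 : inner ℝ (x - y) (r x - r y) =
      ‖r x - r y‖ ^ 2 - inner ℝ (x - r x) (r y - r x) - inner ℝ (y - r y) (r x - r y) := by
    rw [← real_inner_self_eq_norm_sq]
    simp only [inner_sub_left, inner_sub_right]
    ring
  have h4 := real_inner_le_norm (x - y) (r x - r y)
  by_contra hcon
  push Not at hcon
  nlinarith [norm_nonneg (x - y), norm_nonneg (r x - r y)]

theorem det_poly {E : Type*} [NormedAddCommGroup E] [InnerProductSpace ℝ E]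
    [FiniteDimensional ℝ E] [MeasurableSpace E] [BorelSpace E]
    {A : E → E →L[ℝ] E} (hA : Continuous A) {K : Set E} (hK : IsCompact K) :
    ∃ q : Polynomial ℝ, ∀ t : ℝ, ∫ x in K, ((1 : E →L[ℝ] E) + t • A x).det = q.eval t := by
  classical
  let b := Module.finBasis ℝ E
  let a : Fin (Module.finrank ℝ E) → Fin (Module.finrank ℝ E) → E → ℝ :=
    fun i j x => b.repr (A x (b j)) i
  have ha : ∀ i j, Continuous (a i j) := by
    intro i j
    have h1 : Continuous (b.coord i) := LinearMap.continuous_of_finiteDimensional _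
    exact h1.comp (hA.clm_apply continuous_const)
  let e : Fin (Module.finrank ℝ E) → Fin (Module.finrank ℝ E) → ℝ := fun i j => if i = j then 1 else 0
  have hdet : ∀ t x, ((1 : E →L[ℝ] E) + t • A x).det =
      ∑ σ : Equiv.Perm (Fin (Module.finrank ℝ E)), ∑ s ∈ Finset.univ.powerset,
        t ^ (Finset.univ \ s).card * (((Equiv.Perm.sign σ : ℤ) : ℝ) *
          ((∏ i ∈ s, e (σ i) i) * ∏ i ∈ Finset.univ \ s, a (σ i) i x)) := by
    intro t x
    rw [ContinuousLinearMap.det, ← LinearMap.det_toMatrix b, Matrix.det_apply']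
    refine Finset.sum_congr rfl fun σ _ => ?_
    have : ∀ i, (LinearMap.toMatrix b b) (((1 : E →L[ℝ] E) + t • A x : E →L[ℝ] E) : E →ₗ[ℝ] E) (σ i) i
        = e (σ i) i + t * a (σ i) i x := by
      intro i
      simp [LinearMap.toMatrix_apply, a, e, Finsupp.single_apply, eq_comm]
    simp_rw [this]
    rw [Finset.prod_add, Finset.mul_sum]
    refine Finset.sum_congr rfl fun s _ => ?_
    rw [Finset.prod_mul_distrib, Finset.prod_const]
    ring
  let c : Equiv.Perm (Fin (Module.finrank ℝ E)) → Finset (Fin (Module.finrank ℝ E)) → ℝ := fun σ s =>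
    ∫ x in K, (((Equiv.Perm.sign σ : ℤ) : ℝ) *
          ((∏ i ∈ s, e (σ i) i) * ∏ i ∈ Finset.univ \ s, a (σ i) i x))
  refine ⟨∑ σ, ∑ s ∈ Finset.univ.powerset, Polynomial.X ^ (Finset.univ \ s).card *
    Polynomial.C (c σ s), fun t => ?_⟩
  simp_rw [hdet]
  have hcont : ∀ σ : Equiv.Perm (Fin (Module.finrank ℝ E)), ∀ s : Finset (Fin (Module.finrank ℝ E)),
      MeasureTheory.IntegrableOn (fun x => t ^ (Finset.univ \ s).card *
        (((Equiv.Perm.sign σ : ℤ) : ℝ) *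
          ((∏ i ∈ s, e (σ i) i) * ∏ i ∈ Finset.univ \ s, a (σ i) i x))) K := by
    intro σ s
    refine ContinuousOn.integrableOn_compact hK (Continuous.continuousOn ?_)
    have := fun i => ha (σ i) i
    fun_prop
  rw [MeasureTheory.integral_finsetSum]
  · simp only [Polynomial.eval_finsetSum, Polynomial.eval_mul, Polynomial.eval_pow,
      Polynomial.eval_X, Polynomial.eval_C]
    refine Finset.sum_congr rfl fun σ _ => ?_
    rw [MeasureTheory.integral_finsetSum]
    · refine Finset.sum_congr rfl fun s _ => ?_
      rw [MeasureTheory.integral_const_mul]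
    · intro s _; exact hcont σ s
  · intro σ _
    exact MeasureTheory.integrable_finsetSum _ fun s _ => hcont σ s

theorem no_retraction {E : Type*} [NormedAddCommGroup E] [InnerProductSpace ℝ E]
    [FiniteDimensional ℝ E] [MeasurableSpace E] [BorelSpace E] {R : ℝ} (hR : 0 < R)
    {f : E → E} (hf : ContDiff ℝ 1 f) (hn : ∀ x, ‖f x‖ = R) (hb : ∀ x, ‖x‖ = R → f x = x) :
    False := by
  set K := Metric.closedBall (0 : E) R with hKdef
  have hKc : IsCompact K := isCompact_closedBall _ _
  have hKconv : Convex ℝ K := convex_closedBall _ _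
  obtain ⟨r, hr, hr', hrl⟩ := exists_proj ⟨0, by simp [K, hR.le]⟩ hKc hKconv
  have hrin : ∀ x ∈ K, r x = x := by
    intro x hx
    have := hr' x x hx
    have h0 : ‖x - r x‖ ^ 2 ≤ 0 := by rwa [← real_inner_self_eq_norm_sq]
    have : ‖x - r x‖ = 0 := by nlinarith [norm_nonneg (x - r x)]
    exact (sub_eq_zero.1 (norm_eq_zero.1 this)).symm
  have hrout : ∀ x, x ∉ K → ‖r x‖ = R := by
    intro x hx
    by_contra hne
    have hle : ‖r x‖ ≤ R := by simpa [K] using hr x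
    have hlt : ‖r x‖ < R := lt_of_le_of_ne hle hne
    have hpos : 0 < ‖x - r x‖ := by
      rw [norm_pos_iff, sub_ne_zero]
      intro h; exact hx (h ▸ hr x)
    set s := (R - ‖r x‖) / ‖x - r x‖
    have hs : 0 < s := div_pos (by linarith) hpos
    have hz : r x + s • (x - r x) ∈ K := by
      simp only [K, mem_closedBall_zero_iff]
      calc _ ≤ ‖r x‖ + ‖s • (x - r x)‖ := norm_add_le _ _
        _ = R := by
          rw [norm_smul, Real.norm_of_nonneg hs.le, div_mul_cancel₀ _ hpos.ne']; ring
    have := hr' x _ hz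
    rw [add_sub_cancel_left, inner_smul_right, real_inner_self_eq_norm_sq] at this
    nlinarith [mul_pos hs (pow_pos hpos 2)]
  let g : E → E := fun x => f x - x
  have hg : ContDiff ℝ 1 g := hf.sub contDiff_id
  have hgd : ∀ x, HasFDerivAt g (fderiv ℝ g x) x := fun x =>
    (hg.differentiable (by norm_num) x).hasFDerivAt
  have hgc : Continuous (fderiv ℝ g) := hg.continuous_fderiv (by norm_num)
  obtain ⟨C, hC⟩ := hKc.exists_bound_of_continuousOn hgc.continuousOn
  set L : NNReal := Real.toNNReal (max C 0) + 1
  have hCL : ∀ x ∈ K, ‖fderiv ℝ g x‖ ≤ L := by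
    intro x hx
    have := hC x hx
    have h2 : C ≤ max C 0 := le_max_left _ _
    simp only [L, NNReal.coe_add, NNReal.coe_one]
    rw [Real.coe_toNNReal _ (le_max_right _ _)]
    linarith
  have hL : (0 : ℝ) < L := by simp only [L]; positivity
  have hgl : LipschitzOnWith L g K :=
    hKconv.lipschitzOnWith_of_nnnorm_hasFDerivWithin_le
      (fun x _ => (hgd x).hasFDerivWithinAt) (fun x hx => by exact_mod_cast hCL x hx)
  have hGl : LipschitzWith L (g ∘ r) := by
    intro x y
    have h1 := hgl (hr x) (hr y)
    have h2 := hrl x y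
    simp only [ENNReal.coe_one, one_mul] at h2
    exact h1.trans (by gcongr)
  obtain ⟨q, hq⟩ := det_poly hgc hKc
  have hsmall : ∀ t : ℝ, 0 ≤ t → t * L < 1 → t ≤ 1 →
      ∫ x in K, ((1 : E →L[ℝ] E) + t • fderiv ℝ g x).det = (MeasureTheory.volume : MeasureTheory.Measure E).real K := by
    intro t ht0 ht htle
    have happ : ApproximatesLinearOn (fun x => x + t • g (r x))
        ((ContinuousLinearEquiv.refl ℝ E : E ≃L[ℝ] E) : E →L[ℝ] E) univ (Real.toNNReal t * L) := by
      rw [ApproximatesLinearOn.approximatesLinearOn_iff_lipschitzOnWith]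
      apply LipschitzWith.lipschitzOnWith
      refine LipschitzWith.of_dist_le_mul fun x y => ?_
      have h := hGl.dist_le_mul x y
      simp only [Function.comp, dist_eq_norm] at h
      simp only [dist_eq_norm, Pi.sub_apply, ContinuousLinearEquiv.coe_coe,
        ContinuousLinearEquiv.coe_refl', id, add_sub_cancel_left, NNReal.coe_mul,
        Real.coe_toNNReal _ ht0, ← smul_sub, norm_smul, Real.norm_of_nonneg ht0]
      rw [mul_assoc]
      gcongr
    have hlt : Subsingleton E ∨ Real.toNNReal t * L <
        ‖((ContinuousLinearEquiv.refl ℝ E).symm : E →L[ℝ] E)‖₊⁻¹ := by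
      rcases subsingleton_or_nontrivial E with h | h
      · exact Or.inl h
      · right
        have : ‖((ContinuousLinearEquiv.refl ℝ E).symm : E →L[ℝ] E)‖₊ = 1 := by
          have h1 : ((ContinuousLinearEquiv.refl ℝ E).symm : E →L[ℝ] E) = 1 := rfl
          rw [h1]; simp
        rw [this, inv_one, ← NNReal.coe_lt_coe]
        simpa [Real.coe_toNNReal _ ht0] using ht
    have hinj := happ.injOn hlt
    have hsurj := happ.surjective hlt
    have himg : (fun x => x + t • g x) '' K = K := by
      apply Subset.antisymm
      · rintro _ ⟨x, hx, rfl⟩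
        have h1 : x + t • g x = (1 - t) • x + t • f x := by
          simp only [g]; module
        simp only [h1]
        exact hKconv hx (by simp [K, hn]) (by linarith) ht0 (by ring)
      · intro z hz
        obtain ⟨x, hx⟩ := hsurj z
        by_cases hxK : x ∈ K
        · exact ⟨x, hxK, by simpa [hrin x hxK] using hx⟩
        · have : g (r x) = 0 := by simp [g, hb _ (hrout x hxK)]
          simp only [this, smul_zero, add_zero] at hx
          exact absurd (hx ▸ hz) hxK
    have hinjK : InjOn (fun x => x + t • g x) K := by
      intro x hx y hy hxy
      apply hinj (mem_univ _) (mem_univ _)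
      simpa [hrin x hx, hrin y hy] using hxy
    have hder : ∀ x ∈ K, HasFDerivWithinAt (fun x => x + t • g x)
        ((1 : E →L[ℝ] E) + t • fderiv ℝ g x) K x := fun x _ =>
      ((hasFDerivAt_id x).add ((hgd x).const_smul t)).hasFDerivWithinAt
    have hcv := MeasureTheory.integral_image_eq_integral_abs_det_fderiv_smul
      (MeasureTheory.volume : MeasureTheory.Measure E) hKc.measurableSet hder hinjK (fun _ => (1 : ℝ))
    rw [himg] at hcv
    simp only [smul_eq_mul, mul_one, MeasureTheory.integral_const,
      MeasureTheory.measureReal_restrict_apply_univ] at hcv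
    rw [hcv]
    refine MeasureTheory.setIntegral_congr_fun hKc.measurableSet fun x hx => ?_
    have hpos : 0 < ((1 : E →L[ℝ] E) + t • fderiv ℝ g x).det := by
      have hne : ∀ s ∈ Icc 0 t, ((1 : E →L[ℝ] E) + s • fderiv ℝ g x).det ≠ 0 := by
        intro s hs h0
        have hbot := LinearMap.bot_lt_ker_of_det_eq_zero h0
        obtain ⟨v, hv, hv0⟩ := (Submodule.ne_bot_iff _).1 hbot.ne'
        have hv1 : v + s • fderiv ℝ g x v = 0 := by simpa using hv
        have h2 : ‖v‖ ≤ t * L * ‖v‖ := by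
          have : v = -(s • fderiv ℝ g x v) := eq_neg_of_add_eq_zero_left hv1
          calc ‖v‖ = ‖s • fderiv ℝ g x v‖ := by conv_lhs => rw [this, norm_neg]
            _ = s * ‖fderiv ℝ g x v‖ := by rw [norm_smul, Real.norm_of_nonneg hs.1]
            _ ≤ t * (L * ‖v‖) := by
              have h5 := (fderiv ℝ g x).le_of_opNorm_le (hCL x hx) v
              have := hs.2
              have := hs.1
              gcongr
            _ = _ := by ring
        have : 0 < ‖v‖ := norm_pos_iff.2 hv0
        nlinarith
      have hcont : Continuous fun s : ℝ => ((1 : E →L[ℝ] E) + s • fderiv ℝ g x).det := by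
        apply ContinuousLinearMap.continuous_det.comp
        fun_prop
      by_contra hneg
      push Not at hneg
      have hmem : (0 : ℝ) ∈ Icc (((1 : E →L[ℝ] E) + t • fderiv ℝ g x).det)
          (((1 : E →L[ℝ] E) + (0:ℝ) • fderiv ℝ g x).det) := by
        refine ⟨hneg, ?_⟩
        simp [ContinuousLinearMap.det]
      obtain ⟨s, hs, hs0⟩ := intermediate_value_Icc' ht0 hcont.continuousOn hmem
      exact hne s hs hs0
    exact (abs_of_pos hpos).symm
  have hqc : q = Polynomial.C ((MeasureTheory.volume : MeasureTheory.Measure E).real K) := by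
    apply Polynomial.eq_of_infinite_eval_eq
    apply Set.Infinite.mono (s := Ioo 0 (min 1 (1 / (L:ℝ))))
    · intro t ht
      have h1 : t < 1 / L := ht.2.trans_le (min_le_right _ _)
      have h2 : t ≤ 1 := ht.2.le.trans (min_le_left _ _)
      have h3 := hsmall t ht.1.le ((lt_div_iff₀ hL).1 h1) h2
      simp only [mem_ofPred_eq, Polynomial.eval_C, ← hq, h3]
    · apply Ioo_infinite
      positivity
  have h1 := hq 1
  rw [hqc, Polynomial.eval_C] at h1
  have hvol : 0 < (MeasureTheory.volume : MeasureTheory.Measure E).real K := by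
    rw [MeasureTheory.measureReal_def]
    exact ENNReal.toReal_pos (Metric.measure_closedBall_pos _ _ hR).ne' hKc.measure_lt_top.ne
  rw [← h1] at hvol
  have hzero : ∀ x, ((1 : E →L[ℝ] E) + (1:ℝ) • fderiv ℝ g x).det = 0 := by
    intro x
    have hfd : HasFDerivAt f ((1 : E →L[ℝ] E) + (1:ℝ) • fderiv ℝ g x) x := by
      have := (hasFDerivAt_id (𝕜 := ℝ) x).add ((hgd x).const_smul (1:ℝ))
      refine this.congr_of_eventuallyEq (Filter.Eventually.of_forall fun z => ?_)
      simp [g]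
    set D := ((1 : E →L[ℝ] E) + (1:ℝ) • fderiv ℝ g x)
    have h2 : ∀ v, inner ℝ (f x) (D v) = 0 := by
      intro v
      have h3 := hfd.inner ℝ hfd
      have h4 : (fun t => inner ℝ (f t) (f t)) = fun _ => R ^ 2 := by
        funext t; rw [real_inner_self_eq_norm_sq, hn]
      rw [h4] at h3
      have h5 := h3.unique (hasFDerivAt_const (R ^ 2) x)
      have h6 := congrArg (fun l => l v) h5
      simp [fderivInnerCLM_apply] at h6
      have h7 := real_inner_comm (f x) (D v)
      linarith
    by_contra hne
    have hsurj : Function.Surjective D := by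
      have hu : IsUnit (LinearMap.det (D : E →ₗ[ℝ] E)) := isUnit_iff_ne_zero.2 hne
      have := (LinearEquiv.ofIsUnitDet (f := (D : E →ₗ[ℝ] E)) (v := Module.finBasis ℝ E)
        (v' := Module.finBasis ℝ E) (by rw [LinearMap.det_toMatrix]; exact hu)).surjective
      exact this
    obtain ⟨v, hv⟩ := hsurj (f x)
    have h8 := h2 v
    rw [hv, real_inner_self_eq_norm_sq, hn] at h8
    nlinarith
  simp only [hzero, MeasureTheory.integral_zero, lt_self_iff_false] at hvol

theorem exists_zero_id_add {E : Type*} [NormedAddCommGroup E] [InnerProductSpace ℝ E]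
    [FiniteDimensional ℝ E] [MeasurableSpace E] [BorelSpace E] {B : E → E} (hB : Continuous B)
    {M : ℝ} (hM : ∀ x, ‖B x‖ ≤ M) : ∃ x, x + B x = 0 := by
  by_contra! hcon
  have hM0 : 0 ≤ M := (norm_nonneg _).trans (hM 0)
  obtain ⟨x0, -, hx0⟩ := (isCompact_closedBall (0 : E) (M + 2)).exists_isMinOn
    ⟨0, by simp; linarith⟩ (f := fun x => ‖x + B x‖) (by fun_prop)
  set m := ‖x0 + B x0‖
  have hm : 0 < m := norm_pos_iff.2 (hcon x0)
  obtain ⟨B', hBone, hBtwo, -⟩ := hB.exists_contDiff_approx 1 (ε := fun _ => min m 1)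
    continuous_const (fun _ => by positivity)
  let χ : ContDiffBump (0 : E) := ⟨M + 1, M + 2, by linarith, by linarith⟩
  let h : E → E := fun x => x + χ x • B' x
  have hh : ContDiff ℝ 1 h := contDiff_id.add (χ.contDiff.smul hBone)
  have hne : ∀ x, h x ≠ 0 := by
    intro x hx
    have hd : ‖B' x - B x‖ < min m 1 := by simpa [dist_eq_norm] using hBtwo x
    have hd1 := hd.trans_le (min_le_left _ _)
    have hd2 := hd.trans_le (min_le_right _ _)
    rcases le_or_gt ‖x‖ (M + 1) with hle | hgt
    · have h1 : χ x = 1 := χ.one_of_mem_closedBall (by simpa [χ] using hle)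
      simp only [h, h1, one_smul] at hx
      have h2 : m ≤ ‖x + B x‖ := hx0 (by simp; linarith)
      have h3 : x + B x = -(B' x - B x) := by rw [← sub_eq_zero, ← hx]; abel
      rw [h3, norm_neg] at h2
      linarith
    · have h1 : ‖x‖ = ‖χ x • B' x‖ := by
        rw [← norm_neg (χ x • B' x)]
        exact congrArg norm (eq_neg_of_add_eq_zero_left hx)
      have h2 : ‖B' x‖ ≤ M + 1 := by
        have := norm_add_le (B' x - B x) (B x)
        rw [sub_add_cancel] at this
        linarith [hM x]
      rw [norm_smul, Real.norm_of_nonneg χ.nonneg] at h1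
      have := mul_le_mul χ.le_one h2 (norm_nonneg _) zero_le_one (a := χ x)
      linarith
  have hR : 0 < M + 2 := by linarith
  refine no_retraction (E := E) (R := M + 2) hR (f := fun x => ((M + 2) * ‖h x‖⁻¹) • h x) ?_ ?_ ?_
  · exact (contDiff_const.mul ((hh.norm ℝ hne).inv fun x => norm_ne_zero_iff.2 (hne x))).smul hh
  · intro x
    have := norm_pos_iff.2 (hne x)
    rw [norm_smul, Real.norm_of_nonneg (by positivity)]
    field_simp
  · intro x hx
    have h1 : χ x = 0 := χ.zero_of_le_dist (by simp [χ, hx])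
    have h2 : h x = x := by simp [h, h1]
    simp only [h2, hx]
    rw [mul_inv_cancel₀ hR.ne', one_smul]

theorem grid_cont {X G : Type*} [TopologicalSpace X] [NormedAddCommGroup G] [NormedSpace ℝ G]
    {d : ℕ} {u : Fin d → X → ℝ} (hu : ∀ j, Continuous (u j)) {g : (Fin d → ℤ) → G} {M : ℝ}
    (hg : ∀ q, ‖g q‖ ≤ M) :
    Continuous fun x => (∏ j, |Real.sin (u j x * Real.pi)|) • g (fun j => ⌊u j x⌋) := by
  have hc : Continuous fun x => ∏ j, |Real.sin (u j x * Real.pi)| := by fun_prop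
  rw [continuous_iff_continuousAt]
  intro x
  by_cases h : ∃ j, Real.sin (u j x * Real.pi) = 0
  · obtain ⟨j, hj⟩ := h
    have h0 : ∏ j, |Real.sin (u j x * Real.pi)| = 0 :=
      Finset.prod_eq_zero (Finset.mem_univ j) (by simp [hj])
    have ht : Filter.Tendsto (fun x => (∏ j, |Real.sin (u j x * Real.pi)|) * M) (nhds x) (nhds 0) := by
      have := (hc.tendsto x).mul_const M
      rwa [h0, zero_mul] at this
    rw [ContinuousAt, h0, zero_smul]
    refine squeeze_zero_norm (fun z => ?_) ht
    have hp : 0 ≤ ∏ j, |Real.sin (u j z * Real.pi)| := Finset.prod_nonneg fun _ _ => abs_nonneg _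
    rw [norm_smul, Real.norm_of_nonneg hp]
    exact mul_le_mul_of_nonneg_left (hg _) hp
  · push Not at h
    have hev : ∀ᶠ z in nhds x, ∀ j, ⌊u j z⌋ = ⌊u j x⌋ := by
      rw [Filter.eventually_all]
      intro j
      have hlt : (⌊u j x⌋ : ℝ) < u j x := by
        refine lt_of_le_of_ne (Int.floor_le _) fun heq => h j ?_
        rw [← heq, Real.sin_int_mul_pi]
      have := (hu j).continuousAt.eventually (Ioo_mem_nhds hlt (Int.lt_floor_add_one _))
      filter_upwards [this] with z hz
      rw [Int.floor_eq_iff]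
      exact ⟨hz.1.le, hz.2⟩
    have : ContinuousAt (fun z => (∏ j, |Real.sin (u j z * Real.pi)|) • g (fun j => ⌊u j x⌋)) x :=
      (hc.smul continuous_const).continuousAt
    refine this.congr ?_
    filter_upwards [hev] with z hz
    simp [hz]

theorem approx_step {d n : ℕ} {T : Type*} [Nonempty T] {P : Set (EuclideanSpace ℝ (Fin d))}
    (hPc : IsCompact P) (hPconv : Convex ℝ P)
    {r : EuclideanSpace ℝ (Fin d) → EuclideanSpace ℝ (Fin d)} (hr : ∀ x, r x ∈ P)
    (hr' : ∀ x, ∀ z ∈ P, inner ℝ (x - r x) (z - r x) ≤ 0) (hrl : LipschitzWith 1 r)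
    {p : EuclideanSpace ℝ (Fin d)} (hp : p ∈ P)
    (y : Fin n → T → EuclideanSpace ℝ (Fin d))
    (avail : Fin n → EuclideanSpace ℝ (Fin d) → T → Prop)
    (hav : ∀ i x τ, avail i x τ → y i τ ∈ P ∧ inner ℝ (x - r x) (y i τ - r x) = 0)
    (hcard : ∀ x, ∃ S : Finset (Fin n), d + 1 ≤ S.card ∧ ∀ i ∈ S, ∃ τ, avail i x τ)
    {η₀ : ℝ} (hη₀ : 0 < η₀) :
    ∃ x0, ∃ S : Finset (Fin n), ∃ τ : Fin n → T, d + 1 ≤ S.card ∧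
      (∀ i ∈ S, ∃ x', avail i x' (τ i) ∧ ‖r x' - r x0‖ ≤ η₀) ∧
      ∃ F ∈ convexHull ℝ ((fun i => y i (τ i)) '' (S : Set (Fin n))), ‖p - F‖ ≤ η₀ := by
  classical
  obtain ⟨D₀, hD₀⟩ := hPc.isBounded.exists_norm_le
  set D := 2 * D₀ with hD
  have hD0 : 0 ≤ D₀ := (norm_nonneg _).trans (hD₀ p hp)
  have hdiam : ∀ a ∈ P, ∀ b ∈ P, ‖a - b‖ ≤ D := fun a ha b hb =>
    (norm_sub_le a b).trans (by linarith [hD₀ a ha, hD₀ b hb])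
  obtain ⟨η, hη, hη1, hη2, hη3⟩ : ∃ η : ℝ, 0 < η ∧ η ≤ η₀ ∧ η ≤ 1 ∧ (3 * D + 2) * η ≤ η₀ ^ 2 := by
    have h3 : 0 < 3 * D + 2 := by positivity
    refine ⟨min η₀ (min 1 (η₀ ^ 2 / (3 * D + 2))), by positivity, min_le_left _ _,
      (min_le_right _ _).trans (min_le_left _ _), ?_⟩
    have : min η₀ (min 1 (η₀ ^ 2 / (3 * D + 2))) ≤ η₀ ^ 2 / (3 * D + 2) :=
      (min_le_right _ _).trans (min_le_right _ _)
    rw [le_div_iff₀ h3] at this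
    linarith
  set ε := η / (d + 1) with hε
  have hεpos : 0 < ε := by positivity
  let u : Fin n → Fin d → EuclideanSpace ℝ (Fin d) → ℝ := fun i j x => x j / ε - (i : ℝ) / n
  have hu : ∀ i j, Continuous (u i j) := by intro i j; fun_prop
  let Q : Fin n → EuclideanSpace ℝ (Fin d) → Fin d → ℤ := fun i x j => ⌊u i j x⌋
  have hQ : ∀ i x x', Q i x = Q i x' → ‖x - x'‖ ≤ η := by
    intro i x x' h
    have h1 : ∀ j, |x j - x' j| ≤ ε := by
      intro j
      have h2 : ⌊u i j x⌋ = ⌊u i j x'⌋ := congrFun h j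
      have h3 := Int.abs_sub_lt_one_of_floor_eq_floor h2
      have h4 : u i j x - u i j x' = (x j - x' j) / ε := by simp only [u]; ring
      rw [h4, abs_div, abs_of_pos hεpos, div_lt_one hεpos] at h3
      exact h3.le
    have h5 : ‖x - x'‖ ≤ ∑ j : Fin d, |x j - x' j| := by
      rw [EuclideanSpace.norm_eq]
      apply Real.sqrt_le_iff.2
      refine ⟨Finset.sum_nonneg fun _ _ => abs_nonneg _, ?_⟩
      have := Finset.sum_sq_le_sq_sum_of_nonneg (s := Finset.univ) (f := fun j => |x j - x' j|)
        (fun _ _ => abs_nonneg _)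
      simpa using this
    have h6 : ∑ j : Fin d, |x j - x' j| ≤ d * ε := by
      have := Finset.sum_le_sum fun j (_ : j ∈ Finset.univ) => h1 j
      simpa using this
    have h7 : d * ε ≤ η := by
      rw [hε]
      have : (d + 1 : ℝ) * (η / (d + 1)) = η := by field_simp
      nlinarith
    linarith
  let good : Fin n → (Fin d → ℤ) → Prop := fun i q => ∃ x' τ, Q i x' = q ∧ avail i x' τ
  have hlab : ∀ i q, ∃ τ, good i q → ∃ x', Q i x' = q ∧ avail i x' τ := by
    intro i q
    by_cases h : good i q
    · obtain ⟨x', τ, h1, h2⟩ := h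
      exact ⟨τ, fun _ => ⟨x', h1, h2⟩⟩
    · exact ⟨Classical.arbitrary T, fun h' => absurd h' h⟩
  choose lab hlab using hlab
  let w : Fin n → EuclideanSpace ℝ (Fin d) → ℝ := fun i x =>
    (∏ j, |Real.sin (u i j x * Real.pi)|) • (if good i (Q i x) then (1:ℝ) else 0)
  let z : Fin n → EuclideanSpace ℝ (Fin d) → EuclideanSpace ℝ (Fin d) := fun i x =>
    y i (lab i (Q i x))
  have hw0 : ∀ i x, 0 ≤ w i x := by
    intro i x
    have hp : 0 ≤ ∏ j, |Real.sin (u i j x * Real.pi)| := Finset.prod_nonneg fun _ _ => abs_nonneg _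
    simp only [w, smul_eq_mul]
    split_ifs <;> simp [hp]
  have hwc : ∀ i, Continuous (w i) := fun i =>
    grid_cont (hu i) (g := fun q => if good i q then (1:ℝ) else 0) (M := 1)
      (fun q => by split_ifs <;> simp)
  have hwzc : ∀ i, Continuous fun x => w i x • z i x := by
    intro i
    have := grid_cont (hu i) (g := fun q => if good i q then y i (lab i q) else 0) (M := D₀)
      (fun q => by
        split_ifs with h
        · obtain ⟨x', -, h2⟩ := hlab i q h
          exact hD₀ _ (hav _ _ _ h2).1
        · simpa using hD0)
    refine this.congr fun x => ?_
    by_cases h : good i (Q i x)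
    · have h' : good i (fun j => ⌊u i j x⌋) := h
      simp only [w, z, if_pos h, if_pos h', smul_eq_mul, mul_one]
      rfl
    · have h' : ¬ good i (fun j => ⌊u i j x⌋) := h
      simp only [w, if_neg h, if_neg h', smul_zero, zero_smul]
  have hgood : ∀ i x, w i x ≠ 0 → good i (Q i x) := by
    intro i x h
    by_contra h'
    exact h (by simp [w, h'])
  have hWpos : ∀ x, 0 < ∑ i, w i x := by
    intro x
    obtain ⟨S, hS, hS'⟩ := hcard x
    by_contra hneg
    have hzero : ∀ i, w i x = 0 := by
      have h1 : ∑ i, w i x = 0 := le_antisymm (not_lt.1 hneg) (Finset.sum_nonneg fun i _ => hw0 i x)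
      exact fun i => (Finset.sum_eq_zero_iff_of_nonneg fun i _ => hw0 i x).1 h1 i (Finset.mem_univ i)
    have hbad : ∀ i ∈ S, ∃ j, Real.sin (u i j x * Real.pi) = 0 := by
      intro i hi
      obtain ⟨τ, hτ⟩ := hS' i hi
      have hg : good i (Q i x) := ⟨x, τ, rfl, hτ⟩
      have h1 := hzero i
      simp only [w, hg, if_true, smul_eq_mul, mul_one, Finset.prod_eq_zero_iff, abs_eq_zero] at h1
      obtain ⟨j, -, hj⟩ := h1
      exact ⟨j, hj⟩
    have hbad' : ∀ i : S, ∃ j, Real.sin (u i j x * Real.pi) = 0 := fun i => hbad i i.2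
    choose φ hφ using hbad'
    have hcard' : Fintype.card (Fin d) < Fintype.card S := by simp; omega
    obtain ⟨a, b, hab, hφab⟩ := Fintype.exists_ne_map_eq_of_card_lt φ hcard'
    obtain ⟨m1, hm1⟩ := Real.sin_eq_zero_iff.1 (hφ a)
    obtain ⟨m2, hm2⟩ := Real.sin_eq_zero_iff.1 (hφ b)
    rw [← hφab] at hm2
    have e1 : (m1 : ℝ) = u a (φ a) x := mul_right_cancel₀ Real.pi_ne_zero hm1
    have e2 : (m2 : ℝ) = u b (φ a) x := mul_right_cancel₀ Real.pi_ne_zero hm2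
    have hn0 : (0 : ℝ) < n := by exact_mod_cast (a : Fin n).pos
    have e3 : ((m2 - m1 : ℤ) : ℝ) * n = ((a : Fin n) : ℕ) - ((b : Fin n) : ℕ) := by
      push_cast
      rw [e1, e2]
      simp only [u]
      field_simp
      ring
    have e4 : (m2 - m1) * (n : ℤ) = ((a : Fin n) : ℕ) - ((b : Fin n) : ℕ) := by exact_mod_cast e3
    have ha := (a : Fin n).2
    have hb := (b : Fin n).2
    have hne : ((a : Fin n) : ℕ) ≠ ((b : Fin n) : ℕ) := fun h => hab (Subtype.ext (Fin.ext h))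
    have hdvd : (n : ℤ) ∣ ((a : Fin n) : ℕ) - ((b : Fin n) : ℕ) := ⟨m2 - m1, by rw [← e4]; ring⟩
    have := Int.eq_zero_of_abs_lt_dvd hdvd (by rw [abs_lt]; omega)
    omega
  let F : EuclideanSpace ℝ (Fin d) → EuclideanSpace ℝ (Fin d) := fun x =>
    (Finset.univ : Finset (Fin n)).centerMass (fun i => w i x) (fun i => z i x)
  have hFc : Continuous F := by
    simp only [F, Finset.centerMass]
    refine Continuous.smul (Continuous.inv₀ (by fun_prop) fun x => (hWpos x).ne') ?_
    exact continuous_finsetSum _ fun i _ => hwzc i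
  have hFhull : ∀ x, F x ∈ convexHull ℝ ((fun i => z i x) '' {i | w i x ≠ 0}) := by
    intro x
    simp only [F]
    rw [← Finset.centerMass_filter_ne_zero]
    apply Finset.centerMass_mem_convexHull
    · exact fun i _ => hw0 i x
    · rw [Finset.sum_filter_ne_zero]; exact hWpos x
    · intro i hi
      exact ⟨i, by simpa using hi, rfl⟩
  have hFP : ∀ x, F x ∈ P := by
    intro x
    refine convexHull_min ?_ hPconv (hFhull x)
    rintro _ ⟨i, hi, rfl⟩
    obtain ⟨x', -, h2⟩ := hlab i _ (hgood i x hi)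
    exact (hav _ _ _ h2).1
  obtain ⟨x, hx⟩ := exists_zero_id_add (B := fun x => F x - r x - p)
    ((hFc.sub hrl.continuous).sub continuous_const) (M := D + D₀) (fun x =>
      (norm_sub_le _ _).trans (add_le_add (hdiam _ (hFP x) _ (hr x)) (hD₀ p hp)))
  have hx' : x - r x = p - F x := by rw [← sub_eq_zero, ← hx]; abel
  have hin : F x ∈ {v | -((3 * D + 2) * η) ≤ inner ℝ (x - r x) (v - r x)} := by
    have hconv : Convex ℝ {v | -((3 * D + 2) * η) ≤ inner ℝ (x - r x) (v - r x)} := by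
      intro a ha b hb s t hs ht hst
      simp only [mem_ofPred_eq] at *
      have : s • a + t • b - r x = s • (a - r x) + t • (b - r x) := by
        rw [eq_sub_of_add_eq' hst]; module
      rw [this, inner_add_right, inner_smul_right, inner_smul_right]
      nlinarith
    refine convexHull_min ?_ hconv (hFhull x)
    rintro _ ⟨i, hi, rfl⟩
    obtain ⟨x', h1, h2⟩ := hlab i _ (hgood i x hi)
    obtain ⟨h3, h4⟩ := hav _ _ _ h2
    have h5 : ‖x - x'‖ ≤ η := hQ i x x' h1.symm
    have h6 : ‖r x - r x'‖ ≤ ‖x - x'‖ := by simpa [dist_eq_norm] using hrl.dist_le_mul x x'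
    have ea : ‖(x - r x) - (x' - r x')‖ ≤ 2 * η := by
      have : (x - r x) - (x' - r x') = (x - x') - (r x - r x') := by abel
      rw [this]
      exact (norm_sub_le _ _).trans (by linarith)
    have eb : ‖z i x - r x‖ ≤ D := hdiam _ h3 _ (hr x)
    have ec : ‖x' - r x'‖ ≤ D + 2 * η := by
      have h7 : x' - r x' = (x - r x) - ((x - r x) - (x' - r x')) := by abel
      rw [h7]
      refine (norm_sub_le _ _).trans (add_le_add ?_ ea)
      rw [hx']; exact hdiam _ hp _ (hFP x)
    have e1 : inner ℝ (x - r x) (z i x - r x) =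
        inner ℝ ((x - r x) - (x' - r x')) (z i x - r x) + inner ℝ (x' - r x') (r x' - r x) := by
      have h8 : inner ℝ (x' - r x') (z i x - r x') = 0 := h4
      have h9 : r x' - r x = (z i x - r x) - (z i x - r x') := by abel
      rw [h9, inner_sub_right (x' - r x'), h8, inner_sub_left (x - r x)]
      ring
    have e2 := (abs_le.1 (abs_real_inner_le_norm ((x - r x) - (x' - r x')) (z i x - r x))).1
    have e3 := (abs_le.1 (abs_real_inner_le_norm (x' - r x') (r x' - r x))).1
    have e4 : ‖(x - r x) - (x' - r x')‖ * ‖z i x - r x‖ ≤ 2 * η * D := by gcongr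
    have e5 : ‖x' - r x'‖ * ‖r x' - r x‖ ≤ (D + 2 * η) * η := by
      rw [norm_sub_rev (r x')]
      gcongr
      linarith
    change _ ≤ inner ℝ (x - r x) (z i x - r x)
    rw [e1]
    nlinarith
  have hpin := hr' x p hp
  have hnorm : ‖p - F x‖ ≤ η₀ := by
    have h1 : inner ℝ (x - r x) (p - r x) - inner ℝ (x - r x) (F x - r x) = ‖p - F x‖ ^ 2 := by
      rw [← inner_sub_right, sub_sub_sub_cancel_right, hx', real_inner_self_eq_norm_sq]
    have h2 : ‖p - F x‖ ^ 2 ≤ η₀ ^ 2 := by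
      have : -((3 * D + 2) * η) ≤ inner ℝ (x - r x) (F x - r x) := hin
      linarith
    exact abs_le_of_sq_le_sq' h2 hη₀.le |>.2
  refine ⟨x, Finset.univ.filter fun i => good i (Q i x), fun i => lab i (Q i x), ?_, ?_,
    F x, ?_, hnorm⟩
  · obtain ⟨S, hS, hS'⟩ := hcard x
    refine hS.trans (Finset.card_le_card fun i hi => ?_)
    obtain ⟨τ, hτ⟩ := hS' i hi
    simp only [Finset.mem_filter, Finset.mem_univ, true_and]
    exact ⟨x, τ, rfl, hτ⟩
  · intro i hi
    obtain ⟨x', h1, h2⟩ := hlab i _ (by simpa using hi : good i (Q i x))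
    refine ⟨x', h2, ?_⟩
    have h6 : ‖r x' - r x‖ ≤ ‖x' - x‖ := by simpa [dist_eq_norm] using hrl.dist_le_mul x' x
    exact h6.trans ((hQ i x' x h1).trans hη1)
  · refine convexHull_mono (image_mono ?_) (hFhull x)
    intro i hi
    simpa using hgood i x hi

theorem finite_extreme {E : Type*} [AddCommGroup E] [Module ℝ E] (V : Finset E) :
    {σ : Set E | IsExtreme ℝ (convexHull ℝ (V : Set E)) σ}.Finite := by
  classical
  refine ((V.powerset.powerset : Finset (Finset (Finset E))).finite_toSet.image
    (fun 𝒮 : Finset (Finset E) => ⋃ S ∈ 𝒮, convexHull ℝ (S : Set E))).subset ?_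
  intro σ hσ
  have hσ : IsExtreme ℝ (convexHull ℝ (V : Set E)) σ := hσ
  refine ⟨V.powerset.filter fun S => convexHull ℝ (S : Set E) ⊆ σ,
    Finset.mem_coe.2 (Finset.mem_powerset.2 (Finset.filter_subset _ _)), ?_⟩
  apply Subset.antisymm
  · intro x hx
    simp only [mem_iUnion, Finset.mem_filter] at hx
    obtain ⟨S, ⟨-, hS⟩, hx⟩ := hx
    exact hS hx
  · intro x hx
    obtain ⟨w, hw0, hw1, hwx⟩ := Finset.mem_convexHull'.1 (hσ.subset hx)
    set S := V.filter fun v => w v ≠ 0 with hSdef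
    have hSV : S ⊆ V := Finset.filter_subset _ _
    have hS1 : ∑ v ∈ S, w v = 1 := by rw [hSdef, Finset.sum_filter_ne_zero, hw1]
    have hSx : ∑ v ∈ S, w v • v = x := by
      rw [← hwx, hSdef]
      apply Finset.sum_filter_of_ne
      intro v _ hv h0
      exact hv (by rw [h0, zero_smul])
    have hSpos : ∀ v ∈ S, 0 < w v := by
      intro v hv
      have := Finset.mem_filter.1 hv
      exact lt_of_le_of_ne (hw0 v this.1) this.2.symm
    have hxS : x ∈ convexHull ℝ (S : Set E) :=
      Finset.mem_convexHull'.2 ⟨w, fun v hv => (hSpos v hv).le, hS1, hSx⟩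
    simp only [mem_iUnion, Finset.mem_filter, Finset.mem_powerset]
    refine ⟨S, ⟨hSV, ?_⟩, hxS⟩
    intro z hz
    have hmono : convexHull ℝ (S : Set E) ⊆ convexHull ℝ (V : Set E) :=
      convexHull_mono (by exact_mod_cast hSV)
    have hSne : S.Nonempty := by
      rw [Finset.nonempty_iff_ne_empty]
      intro h
      rw [h] at hS1
      simp at hS1
    obtain ⟨v0, hv0, hmin⟩ := S.exists_min_image w hSne
    set δ := w v0
    have hδ : 0 < δ := hSpos v0 hv0
    obtain ⟨c, hc0, hc1, hcz⟩ := Finset.mem_convexHull'.1 hz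
    have hz' : (1 + δ) • x - δ • z ∈ convexHull ℝ (S : Set E) := by
      refine Finset.mem_convexHull'.2 ⟨fun v => (1 + δ) * w v - δ * c v, ?_, ?_, ?_⟩
      · intro v hv
        have h1 : c v ≤ 1 := hc1 ▸ Finset.single_le_sum hc0 hv
        have h2 := hmin v hv
        have h3 := hSpos v hv
        nlinarith [mul_pos hδ h3]
      · rw [Finset.sum_sub_distrib, ← Finset.mul_sum, ← Finset.mul_sum, hS1, hc1]; ring
      · simp_rw [sub_smul, mul_smul]
        rw [Finset.sum_sub_distrib, ← Finset.smul_sum, ← Finset.smul_sum, hSx, hcz]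
    refine hσ.left_mem_of_mem_openSegment (hmono hz) (hmono hz') hx ?_
    refine ⟨δ / (1 + δ), 1 / (1 + δ), by positivity, by positivity, by field_simp; ring, ?_⟩
    rw [smul_sub, smul_smul, smul_smul, one_div_mul_cancel (by positivity), one_smul,
      div_mul_eq_mul_div, one_mul]
    abel

theorem isExtreme_exposed {E : Type*} [NormedAddCommGroup E] [InnerProductSpace ℝ E]
    {P : Set E} {u v : E} (h : ∀ z ∈ P, inner ℝ u (z - v) ≤ 0) :
    IsExtreme ℝ P {z | z ∈ P ∧ inner ℝ u (z - v) = 0} := by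
  refine ⟨fun z hz => hz.1, ?_⟩
  rintro a ha b hb c ⟨-, hc⟩ ⟨s, t, hs, ht, hst, rfl⟩
  refine ⟨ha, le_antisymm (h a ha) ?_⟩
  have h1 : s • a + t • b - v = s • (a - v) + t • (b - v) := by
    rw [eq_sub_of_add_eq' hst]; module
  rw [h1, inner_add_right, inner_smul_right, inner_smul_right] at hc
  have h2 := h b hb
  by_contra hneg
  push Not at hneg
  nlinarith [mul_pos hs (neg_pos.2 hneg), mul_nonneg ht.le (neg_nonneg.2 h2)]

theorem rainbow_caratheodory {d n : ℕ} {S : Finset (Fin n)} (hS : d + 1 ≤ S.card)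
    {f : Fin n → EuclideanSpace ℝ (Fin d)} {F : EuclideanSpace ℝ (Fin d)}
    (hF : F ∈ convexHull ℝ (f '' (S : Set (Fin n)))) :
    ∃ U ⊆ S, U.card = d + 1 ∧ F ∈ convexHull ℝ (f '' (U : Set (Fin n))) := by
  classical
  rw [convexHull_eq_union] at hF
  simp only [mem_iUnion] at hF
  obtain ⟨t, ht, hind, hFt⟩ := hF
  have hcard : t.card ≤ d + 1 := by
    have := hind.card_le_finrank_succ
    have h2 := Submodule.finrank_le (vectorSpan ℝ (range ((↑) : t → EuclideanSpace ℝ (Fin d))))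
    simp at this h2
    omega
  have hch : ∀ e : t, ∃ i ∈ S, f i = e := fun e => ht e.2
  choose φ hφ hφ' using hch
  have h1 : Finset.univ.image φ ⊆ S := by
    intro i hi
    obtain ⟨e, -, rfl⟩ := Finset.mem_image.1 hi
    exact hφ e
  have h2 : (Finset.univ.image φ).card ≤ d + 1 :=
    Finset.card_image_le.trans (by simpa using hcard)
  obtain ⟨U, hU1, hU2, hU3⟩ := Finset.exists_subsuperset_card_eq h1 h2 hS
  refine ⟨U, hU2, hU3, convexHull_mono ?_ hFt⟩
  intro e he
  exact ⟨φ ⟨e, he⟩, hU1 (Finset.mem_image_of_mem _ (Finset.mem_univ _)), hφ' ⟨e, he⟩⟩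

theorem limit_step {E ι : Type*} [NormedAddCommGroup E] [InnerProductSpace ℝ E] [Fintype ι]
    {P : Set E} (hPc : IsCompact P) (hPne : P.Nonempty) {A : ι → Set E} (hA : ∀ i, IsClosed (A i))
    (h : ∀ η > 0, ∃ x0 ∈ P, ∀ i, ∃ a ∈ A i, ‖a - x0‖ ≤ η) : (⋂ i, A i).Nonempty := by
  obtain ⟨x0, hx0, hmin⟩ := hPc.exists_isMinOn hPne
    (f := fun x => ∑ i, Metric.infDist x (A i))
    (continuous_finsetSum _ fun i _ => Metric.continuous_infDist_pt _).continuousOn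
  have hle : ∑ i, Metric.infDist x0 (A i) ≤ 0 := by
    refine le_of_forall_pos_le_add fun ε hε => ?_
    obtain ⟨x, hx, hxa⟩ := h (ε / (Fintype.card ι + 1)) (by positivity)
    have h1 : ∑ i, Metric.infDist x0 (A i) ≤ ∑ i, Metric.infDist x (A i) := hmin hx
    have h2 : ∑ i, Metric.infDist x (A i) ≤ ∑ _i : ι, ε / (Fintype.card ι + 1) := by
      refine Finset.sum_le_sum fun i _ => ?_
      obtain ⟨a, ha, hle⟩ := hxa i
      refine (Metric.infDist_le_dist_of_mem ha).trans ?_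
      rwa [dist_comm, dist_eq_norm]
    have h3 : ∑ _i : ι, ε / ((Fintype.card ι : ℝ) + 1) ≤ ε := by
      rw [Finset.sum_const, Finset.card_univ, nsmul_eq_mul, mul_div_assoc', div_le_iff₀ (by positivity)]
      nlinarith
    linarith
  have hz : ∀ i, Metric.infDist x0 (A i) = 0 := by
    have h0 := le_antisymm hle (Finset.sum_nonneg fun i _ => Metric.infDist_nonneg)
    exact fun i => (Finset.sum_eq_zero_iff_of_nonneg fun i _ => Metric.infDist_nonneg).1 h0 i
      (Finset.mem_univ i)
  refine ⟨x0, mem_iInter.2 fun i => ?_⟩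
  obtain ⟨_, _, hxa⟩ := h 1 one_pos
  obtain ⟨a, ha, -⟩ := hxa i
  exact ((hA i).mem_iff_infDist_zero ⟨a, ha⟩).2 (hz i)

/-- The sparse colorful Komiya theorem (main theorem). -/
theorem sparse_colorful_komiya (n k : ℕ) (hk : 2 ≤ k) (hn : k ≤ n)
    (V : Finset (EuclideanSpace ℝ (Fin (k - 1))))
    (P : Set (EuclideanSpace ℝ (Fin (k - 1)))) (hP : P = convexHull ℝ ↑V)
    (hdim : affineSpan ℝ (V : Set (EuclideanSpace ℝ (Fin (k - 1)))) = ⊤)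
    (p : EuclideanSpace ℝ (Fin (k - 1))) (hp : p ∈ P)
    (A : Fin n → Set (EuclideanSpace ℝ (Fin (k - 1))) → Set (EuclideanSpace ℝ (Fin (k - 1))))
    (y : Fin n → Set (EuclideanSpace ℝ (Fin (k - 1))) → EuclideanSpace ℝ (Fin (k - 1)))
    (hA : ∀ i τ, IsProperFace P τ → IsClosed (A i τ) ∧ A i τ ⊆ P)
    (hy : ∀ i τ, IsProperFace P τ → y i τ ∈ τ)
    (hweak : ∀ I : Finset (Fin n), I.card = n - k + 1 →
      ∀ σ, IsFace P σ →
        σ ⊆ ⋃ τ ∈ {τ | IsProperFace P τ ∧ τ ⊆ σ}, ⋃ i ∈ I, A i τ) :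
    ∃ π : Fin k → Fin n, Function.Injective π ∧
      ∃ τ : Fin k → Set (EuclideanSpace ℝ (Fin (k - 1))),
        (∀ i, IsProperFace P (τ i)) ∧
        p ∈ convexHull ℝ (Set.range fun i => y (π i) (τ i)) ∧
        (⋂ i, A (π i) (τ i)).Nonempty := by
  classical
  have hPc : IsCompact P := hP ▸ V.finite_toSet.isCompact_convexHull ℝ
  have hPconv : Convex ℝ P := hP ▸ convex_convexHull _ _
  obtain ⟨r, hr, hr', hrl⟩ := exists_proj ⟨p, hp⟩ hPc hPconv
  let T := {τ : Set (EuclideanSpace ℝ (Fin (k - 1))) // IsProperFace P τ}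
  have hTfin : Finite T := by
    refine ((finite_extreme V).subset ?_).to_subtype (s := {τ | IsProperFace P τ})
    intro τ hτ
    have := hτ.2.2
    rwa [hP] at this
  let face : EuclideanSpace ℝ (Fin (k - 1)) → Set (EuclideanSpace ℝ (Fin (k - 1))) := fun x =>
    {z | z ∈ P ∧ inner ℝ (x - r x) (z - r x) = 0}
  have hface : ∀ x, IsFace P (face x) := by
    intro x
    by_cases h : face x = P
    · exact Or.inr h
    · exact Or.inl ⟨⟨r x, hr x, by simp⟩, h, isExtreme_exposed (hr' x)⟩
  let avail : Fin n → EuclideanSpace ℝ (Fin (k - 1)) → T → Prop := fun i x τ =>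
    τ.1 ⊆ face x ∧ r x ∈ A i τ.1
  have hcover : ∀ x, ∀ I : Finset (Fin n), I.card = n - k + 1 → ∃ i ∈ I, ∃ τ, avail i x τ := by
    intro x I hI
    have h1 := hweak I hI (face x) (hface x) (⟨hr x, by simp⟩ : r x ∈ face x)
    simp only [mem_iUnion, mem_ofPred_eq] at h1
    obtain ⟨τ, ⟨hτ, hτ'⟩, i, hi, hx⟩ := h1
    exact ⟨i, hi, ⟨τ, hτ⟩, hτ', hx⟩
  have hcard : ∀ x, ∃ S : Finset (Fin n), k - 1 + 1 ≤ S.card ∧ ∀ i ∈ S, ∃ τ, avail i x τ := by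
    intro x
    refine ⟨Finset.univ.filter fun i => ∃ τ, avail i x τ, ?_, fun i hi => (Finset.mem_filter.1 hi).2⟩
    by_contra hlt
    set S := Finset.univ.filter fun i => ∃ τ, avail i x τ with hS
    have hc : n - k + 1 ≤ Sᶜ.card := by
      rw [Finset.card_compl, Fintype.card_fin]; omega
    obtain ⟨I, hI, hIc⟩ := Finset.exists_subset_card_eq hc
    obtain ⟨i, hi, hτ⟩ := hcover x I hIc
    have := Finset.mem_compl.1 (hI hi)
    exact this (Finset.mem_filter.2 ⟨Finset.mem_univ _, hτ⟩)
  have hTne : Nonempty T := by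
    obtain ⟨S, hS, hS'⟩ := hcard p
    have : S.Nonempty := by rw [← Finset.card_pos]; omega
    obtain ⟨i, hi⟩ := this
    obtain ⟨τ, -⟩ := hS' i hi
    exact ⟨τ⟩
  let R : ((Fin k → Fin n) × (Fin k → T)) → ℝ → Prop := fun c η =>
    Function.Injective c.1 ∧
      (∃ x0 ∈ P, ∀ i, ∃ a ∈ A (c.1 i) (c.2 i).1, ‖a - x0‖ ≤ η) ∧
      ∃ F ∈ convexHull ℝ (Set.range fun i => y (c.1 i) (c.2 i).1), ‖p - F‖ ≤ η
  have hR : ∀ η > 0, ∃ c, R c η := by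
    intro η hη
    obtain ⟨x0, S, τ, hS, hSA, F, hF, hpF⟩ := approx_step hPc hPconv hr hr' hrl hp
      (fun i (τ : T) => y i τ.1) avail
      (fun i x τ h => h.1 (hy i τ.1 τ.2)) hcard hη
    obtain ⟨U, hUS, hUc, hFU⟩ := rainbow_caratheodory hS hF
    have hUk : U.card = k := by omega
    let π := U.orderEmbOfFin hUk
    have hπ : ∀ i, π i ∈ U := fun i => Finset.orderEmbOfFin_mem U hUk i
    refine ⟨(π, fun i => τ (π i)), π.injective, ⟨r x0, hr x0, fun i => ?_⟩, F, ?_, hpF⟩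
    · obtain ⟨x', h1, h2⟩ := hSA (π i) (hUS (hπ i))
      exact ⟨r x', h1.2, h2⟩
    · refine convexHull_mono ?_ hFU
      rintro _ ⟨i, hi, rfl⟩
      have : i ∈ Set.range π := by rw [Finset.range_orderEmbOfFin]; exact hi
      obtain ⟨j, rfl⟩ := this
      exact ⟨j, rfl⟩
  have hmono : ∀ c η η', η ≤ η' → R c η → R c η' := by
    rintro c η η' hle ⟨h1, ⟨x0, hx0, h2⟩, F, hF, h3⟩
    refine ⟨h1, ⟨x0, hx0, fun i => ?_⟩, F, hF, h3.trans hle⟩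
    obtain ⟨a, ha, h4⟩ := h2 i
    exact ⟨a, ha, h4.trans hle⟩
  obtain ⟨c, hc⟩ : ∃ c, ∀ η > 0, R c η := by
    by_contra! hcon
    choose η hη hRη using hcon
    obtain ⟨c1, -⟩ := hR 1 one_pos
    have : Nonempty ((Fin k → Fin n) × (Fin k → T)) := ⟨c1⟩
    obtain ⟨c0, hc0⟩ := Finite.exists_min η
    obtain ⟨c, hc⟩ := hR (η c0) (hη c0)
    exact hRη c (hmono c _ _ (hc0 c) hc)
  refine ⟨c.1, (hc 1 one_pos).1, fun i => (c.2 i).1, fun i => (c.2 i).2, ?_, ?_⟩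
  · have hcl : IsClosed (convexHull ℝ (Set.range fun i => y (c.1 i) (c.2 i).1)) :=
      ((Set.finite_range _).isCompact_convexHull ℝ).isClosed
    rw [← hcl.closure_eq, Metric.mem_closure_iff]
    intro ε hε
    obtain ⟨-, -, F, hF, h⟩ := hc (ε / 2) (by positivity)
    exact ⟨F, hF, by rw [dist_eq_norm]; linarith⟩
  · exact limit_step hPc ⟨p, hp⟩ (fun i => (hA _ _ (c.2 i).2).1) fun η hη => (hc η hη).2.1
end

section
/- Let $k \geq 1$, let $T$ be a finite convex triangulation of the standard simplex $\Delta^{k-1} \subseteq \mathbb{R}^k$, and let $\lambda : V(T) \to [k]$ be a Sperner labelling, i.e., for every vertex $v$ of $T$, $e_{\lambda(v)}$ is a vertex of $\mathrm{supp}(v)$, the minimal face of $\Delta^{k-1}$ containing $v$. Then there exists a $(k-1)$-dimensional face of $T$ whose $k$ vertices receive $k$ distinct labels under $\lambda$. -/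
open Set Geometry

open Filter Topology in
theorem sp_lip {E : Type*} [NormedAddCommGroup E] [NormedSpace ℝ E] {σ : Type*} [Finite σ]
    (O : Set E) (hO : Convex ℝ O) (Q : σ → Set E) (hQ : ∀ s, IsClosed (Q s))
    (Φ : σ → E →L[ℝ] E) (F : E → E) (hF : ∀ s, ∀ x ∈ Q s, F x = Φ s x)
    (hcov : ∀ x ∈ O, ∃ s, x ∈ Q s) : ∃ K : NNReal, LipschitzOnWith K F O := by
  classical
  cases nonempty_fintype σ
  have hK : ∃ K : NNReal, ∀ s, ‖Φ s‖ ≤ K := by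
    refine ⟨∑ s, ‖Φ s‖₊, fun s => ?_⟩
    have := Finset.single_le_sum (f := fun s => ‖Φ s‖₊) (fun _ _ => zero_le) (Finset.mem_univ s)
    exact_mod_cast this
  obtain ⟨K, hK⟩ := hK
  have hc : ContinuousOn F (⋃ s, Q s) := by
    refine (locallyFinite_of_finite Q).continuousOn_iUnion hQ fun s => ?_
    exact ((Φ s).continuous.continuousOn).congr (hF s)
  refine ⟨K, LipschitzOnWith.of_dist_le_mul fun y hy x hx => ?_⟩
  let g : ℝ → E := fun τ => x + τ • (y - x)
  have hg : Continuous g := by fun_prop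
  have hgO : ∀ τ ∈ Icc (0:ℝ) 1, g τ ∈ O := fun τ hτ => hO.add_smul_sub_mem hx hy hτ
  have key : ∀ ⦃τ⦄, τ ∈ Icc (0:ℝ) 1 → ‖F (g τ) - F x‖ ≤ K * ‖y - x‖ * τ := by
    refine image_le_of_liminf_slope_right_le_deriv_boundary (B' := fun _ => K * ‖y - x‖) ?_ ?_ ?_ ?_ ?_
    · refine ContinuousOn.norm (ContinuousOn.sub ?_ continuousOn_const)
      exact hc.comp hg.continuousOn fun τ hτ => by simpa using hcov _ (hgO τ hτ)
    · simp [g]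
    · fun_prop
    · intro τ hτ
      simpa using ((hasDerivAt_id τ).const_mul (K * ‖y - x‖)).hasDerivWithinAt
    · intro τ hτ r hr
      have h1 : ∀ᶠ z in 𝓝[>] τ, z ∈ Icc (0:ℝ) 1 := by
        filter_upwards [Ioo_mem_nhdsGT hτ.2] with z hz
        exact ⟨hτ.1.trans hz.1.le, hz.2.le⟩
      have h2 : ∃ s, ∃ᶠ z in 𝓝[>] τ, g z ∈ Q s := by
        by_contra! hn
        have : ∀ᶠ z in 𝓝[>] τ, ∀ s, g z ∉ Q s := by
          rw [eventually_all]
          exact hn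
        obtain ⟨z, hz1, hz2⟩ := (h1.and this).exists
        obtain ⟨s, hs⟩ := hcov _ (hgO z hz1)
        exact hz2 s hs
      obtain ⟨s, hs⟩ := h2
      have h3 : g τ ∈ Q s := by
        refine (hQ s).mem_of_frequently_of_tendsto hs ?_
        exact (hg.tendsto τ).mono_left nhdsWithin_le_nhds
      refine (hs.and_eventually self_mem_nhdsWithin).mono fun z hz => ?_
      have hz2 : τ < z := hz.2
      refine lt_of_le_of_lt ?_ hr
      rw [slope_def_field, div_le_iff₀ (sub_pos.2 hz2)]
      calc _ ≤ ‖(F (g z) - F x) - (F (g τ) - F x)‖ := norm_sub_norm_le _ _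
        _ = ‖Φ s ((z - τ) • (y - x))‖ := by
          rw [hF s _ hz.1, hF s _ h3, sub_sub_sub_cancel_right, ← map_sub]
          congr 2; simp only [g]; module
        _ ≤ ‖Φ s‖ * ‖(z - τ) • (y - x)‖ := (Φ s).le_opNorm _
        _ ≤ K * ‖(z - τ) • (y - x)‖ := by gcongr; exact hK s
        _ = _ := by rw [norm_smul, Real.norm_of_nonneg (sub_pos.2 hz2).le]; ring
  have := key (right_mem_Icc.2 zero_le_one)
  simpa [g, dist_eq_norm] using this

theorem sp_surj {n : ℕ} (F : (Fin n → ℝ) → (Fin n → ℝ)) (K : NNReal)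
    (hK : LipschitzOnWith K F {x | ∀ i, 0 ≤ x i})
    (hnn : ∀ x, (∀ i, 0 ≤ x i) → ∀ i, 0 ≤ F x i)
    (hz : ∀ x, (∀ i, 0 ≤ x i) → ∀ i, x i = 0 → F x i = 0) :
    ∃ δ : ℝ, 0 < δ ∧ ∀ t : ℝ, 0 < t → t < δ →
      InjOn (fun x => (1 - t) • x + t • F x) {x | ∀ i, 0 ≤ x i} ∧
      ∀ y : Fin n → ℝ, (∀ i, 0 < y i) →
        ∃ x : Fin n → ℝ, (∀ i, 0 ≤ x i) ∧ (1 - t) • x + t • F x = y := by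
  set O : Set (Fin n → ℝ) := {x | ∀ i, 0 ≤ x i} with hO
  obtain ⟨G, hG, hFG⟩ := (hK.sub (LipschitzWith.id.lipschitzOnWith (s := O))).extend_pi
  refine ⟨((K + 1 : NNReal) : ℝ)⁻¹, by positivity, fun t ht0 ht => ?_⟩
  have hK1 : (1:ℝ) ≤ ((K + 1 : NNReal) : ℝ) := by simp
  have ht1 : t < 1 := ht.trans_le (inv_le_one_of_one_le₀ hK1)
  lift t to NNReal using ht0.le
  have htK : t * (K + 1) < 1 := by
    have h2 := (lt_inv_mul_iff₀ (b := (1:ℝ)) (c := ((K + 1 : NNReal) : ℝ)) (a := (t:ℝ)) (by positivity)).1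
      (by simpa using ht)
    rw [mul_comm]
    exact_mod_cast h2
  let Ht : (Fin n → ℝ) → (Fin n → ℝ) := fun x => x + (t : ℝ) • G x
  have happ : ApproximatesLinearOn Ht
      ((ContinuousLinearEquiv.refl ℝ (Fin n → ℝ) : (Fin n → ℝ) ≃L[ℝ] (Fin n → ℝ)) :
        (Fin n → ℝ) →L[ℝ] (Fin n → ℝ)) univ (t * (K + 1)) := by
    intro x _ y _
    have h1 : Ht x - Ht y - (x - y) = (t : ℝ) • (G x - G y) := by
      simp only [Ht, smul_sub]; abel
    have h2 := hG.dist_le_mul x y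
    rw [dist_eq_norm, dist_eq_norm] at h2
    simp only [ContinuousLinearEquiv.coe_refl, ContinuousLinearMap.coe_id', id]
    rw [h1, norm_smul, Real.norm_of_nonneg ht0.le]
    push_cast at h2 ⊢
    rw [mul_assoc]
    gcongr
  have hsub : Subsingleton (Fin n → ℝ) ∨ t * (K + 1) <
      ‖((ContinuousLinearEquiv.refl ℝ (Fin n → ℝ)).symm : (Fin n → ℝ) →L[ℝ] (Fin n → ℝ))‖₊⁻¹ := by
    rcases subsingleton_or_nontrivial (Fin n → ℝ) with h | h
    · exact Or.inl h
    · right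
      simpa using htK
  let H := happ.toHomeomorph _ hsub
  have hH : ∀ x, H x = Ht x := fun x => rfl
  have hHO : ∀ x ∈ O, H x = (1 - (t:ℝ)) • x + (t:ℝ) • F x := by
    intro x hx
    rw [hH]; simp only [Ht]; rw [← hFG hx]
    simp only [id]
    module
  let U : Set (Fin n → ℝ) := {x | ∀ i, 0 < x i}
  have hUO : U ⊆ O := fun x hx i => (hx i).le
  have hUpi : U = univ.pi fun _ => Ioi 0 := by ext; simp [U]
  have hUopen : IsOpen U := by
    rw [hUpi]; exact isOpen_set_pi finite_univ fun _ _ => isOpen_Ioi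
  have hUconv : Convex ℝ U := by
    rw [hUpi]; exact convex_pi fun _ _ => convex_Ioi _
  have hOclosed : IsClosed O := by
    have : O = univ.pi fun _ => Ici 0 := by
      ext x; simp only [O, mem_ofPred_eq, mem_univ_pi, mem_Ici]
    rw [this]; exact isClosed_set_pi fun _ _ => isClosed_Ici
  have hmap : ∀ x ∈ O, ∀ i, H x i = (1 - (t:ℝ)) * x i + t * F x i := by
    intro x hx i
    rw [hHO x hx]; simp
  have hmapU : ∀ x ∈ U, H x ∈ U := by
    intro x hx i
    rw [hmap x (hUO hx)]
    have := hnn x (hUO hx) i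
    have := mul_pos (sub_pos.2 ht1) (hx i)
    positivity
  have hmapU' : ∀ x ∈ O, H x ∈ U → x ∈ U := by
    intro x hx hxU i
    refine lt_of_le_of_ne (hx i) fun h0 => ?_
    have h1 := hxU i
    rw [hmap x hx, ← h0, hz x hx i h0.symm] at h1
    simp at h1
  refine ⟨fun x hx y hy hxy => H.injective ?_, fun y hy => ?_⟩
  · rw [hHO x hx, hHO y hy]; exact hxy
  · have hsubset : U ⊆ H '' U := by
      refine hUconv.isPreconnected.subset_of_closure_inter_subset (H.isOpenMap _ hUopen) ?_ ?_
      · have h1 : (fun _ => 1 : Fin n → ℝ) ∈ U := fun _ => one_pos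
        exact ⟨_, hmapU _ h1, mem_image_of_mem _ h1⟩
      · rintro z ⟨hz1, hz2⟩
        have : closure (H '' U) ⊆ H '' O :=
          closure_minimal (image_mono hUO) (H.isClosedMap _ hOclosed)
        obtain ⟨x, hx, rfl⟩ := this hz1
        exact mem_image_of_mem _ (hmapU' x hx hz2)
    obtain ⟨x, hx, rfl⟩ := hsubset hy
    exact ⟨x, hUO hx, (hHO x (hUO hx)).symm⟩

open Matrix in
theorem sp_apply {n : ℕ} (M : Matrix (Fin n) (Fin n) ℝ) (a : Fin n → ℝ) (j : Fin n) :
    (a ᵥ* M) j = ∑ i, a i * M i j := by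
  simp only [Matrix.vecMul, dotProduct]

open Matrix in
theorem sp_sum {n : ℕ} (M : Matrix (Fin n) (Fin n) ℝ) (hM : ∀ i, M i ∈ stdSimplex ℝ (Fin n))
    (a : Fin n → ℝ) : ∑ j, (a ᵥ* M) j = ∑ i, a i := by
  simp only [Matrix.vecMul, dotProduct]
  rw [Finset.sum_comm]
  refine Finset.sum_congr rfl fun i _ => ?_
  rw [← Finset.mul_sum, (hM i).2, mul_one]

open Matrix in
theorem sp_nonneg {n : ℕ} (M : Matrix (Fin n) (Fin n) ℝ) (hM : ∀ i, M i ∈ stdSimplex ℝ (Fin n))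
    (a : Fin n → ℝ) (ha : ∀ i, 0 ≤ a i) (j : Fin n) : 0 ≤ (a ᵥ* M) j := by
  rw [sp_apply]
  exact Finset.sum_nonneg fun i _ => mul_nonneg (ha i) ((hM i).1 j)

open Matrix MeasureTheory in
theorem sp_measure {n : ℕ} {σ : Type*} [Fintype σ] (M : σ → Matrix (Fin n) (Fin n) ℝ)
    (hM : ∀ s, (M s).det ≠ 0) (hM1 : ∀ s i, M s i ∈ stdSimplex ℝ (Fin n))
    (hcov : ∀ y : Fin n → ℝ, (∀ i, 0 < y i) → ∃ s a, (∀ i, 0 ≤ a i) ∧ a ᵥ* M s = y)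
    (hdisj : ∀ s s' (a b : Fin n → ℝ), (∀ i, 0 < a i) → (∀ i, 0 < b i) →
      a ᵥ* M s = b ᵥ* M s' → s = s') : ∑ s, |(M s).det| = 1 := by
  classical
  let C : Set (Fin n → ℝ) := {x | (∀ i, 0 ≤ x i) ∧ ∑ i, x i < 1}
  let C' : Set (Fin n → ℝ) := {x | (∀ i, 0 < x i) ∧ ∑ i, x i < 1}
  have hC'C : C' ⊆ C := fun x hx => ⟨fun i => (hx.1 i).le, hx.2⟩
  have hopen : IsOpen C' := by
    have : C' = (univ.pi fun _ => Ioi 0) ∩ {x | ∑ i, x i < 1} := by ext; simp [C']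
    rw [this]
    refine (isOpen_set_pi finite_univ fun _ _ => isOpen_Ioi).inter ?_
    exact isOpen_lt (by fun_prop) (by fun_prop)
  have hpos : volume C' ≠ 0 := by
    refine (hopen.measure_pos volume ⟨fun _ => ((n:ℝ) + 1)⁻¹, fun _ => by positivity, ?_⟩).ne'
    simp only [Finset.sum_const, Finset.card_univ, Fintype.card_fin, nsmul_eq_mul]
    rw [← div_eq_mul_inv, div_lt_one (by positivity)]; linarith
  have hfin : volume C' ≠ ⊤ := by
    have : C' ⊆ Icc (fun _ => 0) (fun _ => 1) := by
      intro x hx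
      refine ⟨fun i => (hx.1 i).le, fun i => ?_⟩
      exact (Finset.single_le_sum (f := x) (fun i _ => (hx.1 i).le) (Finset.mem_univ i)).trans hx.2.le
    exact ((measure_mono this).trans_lt (isCompact_Icc.measure_lt_top)).ne
  have hnull : ∀ i : Fin n, volume {x : Fin n → ℝ | x i = 0} = 0 := by
    intro i
    have h := Measure.addHaar_submodule (volume : Measure (Fin n → ℝ))
      (LinearMap.ker (LinearMap.proj i : (Fin n → ℝ) →ₗ[ℝ] ℝ)) ?_
    · convert h using 2
      ext x; simp
    · intro h
      have : (fun _ => 1 : Fin n → ℝ) ∈ LinearMap.ker (LinearMap.proj i : (Fin n → ℝ) →ₗ[ℝ] ℝ) := by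
        rw [h]; trivial
      simp at this
  have hCC' : volume C = volume C' := by
    refine le_antisymm ?_ (measure_mono hC'C)
    have hs : C ⊆ C' ∪ ⋃ i, {x : Fin n → ℝ | x i = 0} := by
      intro x hx
      by_cases h : ∀ i, x i ≠ 0
      · exact Or.inl ⟨fun i => lt_of_le_of_ne (hx.1 i) (h i).symm, hx.2⟩
      · push Not at h
        exact Or.inr (by simpa using h)
    calc volume C ≤ _ := measure_mono hs
      _ ≤ volume C' + volume (⋃ i, {x : Fin n → ℝ | x i = 0}) := measure_union_le _ _
      _ = volume C' := by rw [measure_iUnion_null hnull, add_zero]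
  let f : σ → (Fin n → ℝ) →ₗ[ℝ] (Fin n → ℝ) := fun s => Matrix.toLin' (M s)ᵀ
  have hf : ∀ s a, f s a = a ᵥ* M s := fun s a => by
    simp [f, Matrix.toLin'_apply, Matrix.mulVec_transpose]
  have himg : ∀ s (X : Set (Fin n → ℝ)), volume (f s '' X) = ENNReal.ofReal |(M s).det| * volume X := by
    intro s X
    rw [Measure.addHaar_image_linearMap]
    simp [f, LinearMap.det_toLin', Matrix.det_transpose]
  have hinj : ∀ s, Function.Injective (f s) := by
    intro s a b hab
    rw [hf, hf] at hab
    exact Matrix.vecMul_injective_of_isUnit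
      ((Matrix.isUnit_iff_isUnit_det _).2 (isUnit_iff_ne_zero.2 (hM s))) hab
  have hle : (∑ s, ENNReal.ofReal |(M s).det|) * volume C' ≤ 1 * volume C' := by
    rw [Finset.sum_mul, one_mul]
    simp_rw [← himg]
    rw [← tsum_fintype (L := .unconditional σ), ← measure_iUnion]
    · refine measure_mono ?_
      simp only [iUnion_subset_iff]
      rintro s _ ⟨a, ha, rfl⟩
      rw [hf]
      refine ⟨fun j => ?_, by rw [sp_sum _ (hM1 s)]; exact ha.2⟩
      refine lt_of_le_of_ne (sp_nonneg _ (hM1 s) a (fun i => (ha.1 i).le) j) fun h0 => ?_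
      rw [sp_apply] at h0
      have h1 := (Finset.sum_eq_zero_iff_of_nonneg
        (fun i _ => mul_nonneg (ha.1 i).le ((hM1 s i).1 j))).1 h0.symm
      refine hM s (Matrix.det_eq_zero_of_column_eq_zero j fun i => ?_)
      exact (mul_eq_zero.1 (h1 i (Finset.mem_univ i))).resolve_left (ha.1 i).ne'
    · intro s s' hss
      refine disjoint_left.2 ?_
      rintro _ ⟨a, ha, rfl⟩ ⟨b, hb, hab⟩
      rw [hf, hf] at hab
      exact hss (hdisj s s' a b ha.1 hb.1 hab.symm)
    · intro s
      exact hopen.measurableSet.image_of_continuousOn_injOn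
        (LinearMap.continuous_of_finiteDimensional _).continuousOn (hinj s).injOn
  have hge : 1 * volume C' ≤ (∑ s, ENNReal.ofReal |(M s).det|) * volume C' := by
    rw [Finset.sum_mul, one_mul]
    rw [← hCC']
    simp_rw [← himg]
    rw [hCC']
    have : C' ⊆ ⋃ s, f s '' C := by
      intro y hy
      obtain ⟨s, a, ha, rfl⟩ := hcov y hy.1
      refine mem_iUnion.2 ⟨s, a, ⟨ha, ?_⟩, hf s a⟩
      rw [← sp_sum _ (hM1 s)]; exact hy.2
    refine (measure_mono this).trans ((measure_iUnion_le _).trans ?_)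
    rw [tsum_fintype]
  have h := (ENNReal.mul_left_inj hpos hfin).1 (le_antisymm hle hge)
  rw [← ENNReal.ofReal_sum_of_nonneg fun _ _ => abs_nonneg _] at h
  exact ENNReal.ofReal_eq_one.1 h

open Matrix Filter Topology in
theorem sp_core {n : ℕ} {σ : Type*} [Fintype σ] (A B : σ → Matrix (Fin n) (Fin n) ℝ)
    (hA : ∀ s, (A s).det ≠ 0) (hA1 : ∀ s i, A s i ∈ stdSimplex ℝ (Fin n))
    (hB1 : ∀ s i, B s i ∈ stdSimplex ℝ (Fin n))
    (hAB : ∀ s i j, A s i j = 0 → B s i j = 0)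
    (hcov : ∀ x : Fin n → ℝ, (∀ i, 0 ≤ x i) → ∃ s a, (∀ i, 0 ≤ a i) ∧ a ᵥ* A s = x)
    (huniq : ∀ s s' (a b : Fin n → ℝ), (∀ i, 0 ≤ a i) → (∀ i, 0 ≤ b i) →
      a ᵥ* A s = b ᵥ* A s' → a ᵥ* B s = b ᵥ* B s')
    (hdisj : ∀ s s' (a b : Fin n → ℝ), (∀ i, 0 < a i) → (∀ i, 0 < b i) →
      a ᵥ* A s = b ᵥ* A s' → s = s') : ∃ s, (B s).det ≠ 0 := by
  classical
  have hF : ∃ F : (Fin n → ℝ) → (Fin n → ℝ), ∀ s a, (∀ i, 0 ≤ a i) →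
      F (a ᵥ* A s) = a ᵥ* B s := by
    obtain ⟨s₀, -⟩ := hcov 0 (fun _ => le_rfl)
    have : Nonempty σ := ⟨s₀⟩
    choose! sx ax h1 h2 using hcov
    refine ⟨fun x => ax x ᵥ* B (sx x), fun s a ha => ?_⟩
    have hx := sp_nonneg _ (hA1 s) a ha
    exact huniq _ _ _ _ (h1 _ hx) ha (h2 _ hx)
  obtain ⟨F, hF⟩ := hF
  have hunit : ∀ s, IsUnit (A s).det := fun s => isUnit_iff_ne_zero.2 (hA s)
  -- Lipschitz
  have hlip : ∃ K : NNReal, LipschitzOnWith K F {x | ∀ i, 0 ≤ x i} := by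
    refine sp_lip _ ?_ (fun s => {x | ∀ i, 0 ≤ (x ᵥ* (A s)⁻¹) i}) ?_
      (fun s => LinearMap.toContinuousLinearMap (Matrix.toLin' ((A s)⁻¹ * B s)ᵀ)) F ?_ ?_
    · intro x hx y hy p q hp hq _ i
      have := hx i
      have := hy i
      simp only [Pi.add_apply, Pi.smul_apply, smul_eq_mul]
      positivity
    · intro s
      simp only [ofPred_forall]
      refine isClosed_iInter fun i => isClosed_le continuous_const ?_
      simp only [Matrix.vecMul, dotProduct]
      fun_prop
    · intro s x hx
      have := hF s _ hx
      rw [Matrix.vecMul_vecMul, Matrix.nonsing_inv_mul _ (hunit s), Matrix.vecMul_one] at this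
      rw [this]
      simp [Matrix.toLin'_apply, Matrix.mulVec_transpose, Matrix.vecMul_vecMul]
    · intro x hx
      obtain ⟨s, a, ha, rfl⟩ := hcov x hx
      refine ⟨s, fun i => ?_⟩
      rw [Matrix.vecMul_vecMul, Matrix.mul_nonsing_inv _ (hunit s), Matrix.vecMul_one]
      exact ha i
  obtain ⟨K, hK⟩ := hlip
  obtain ⟨δ, hδ, hδt⟩ := sp_surj F K hK
    (by
      intro x hx j
      obtain ⟨s, a, ha, rfl⟩ := hcov x hx
      rw [hF s a ha]
      exact sp_nonneg _ (hB1 s) a ha j)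
    (by
      intro x hx j hj
      obtain ⟨s, a, ha, rfl⟩ := hcov x hx
      rw [hF s a ha, sp_apply]
      rw [sp_apply] at hj
      have h1 := (Finset.sum_eq_zero_iff_of_nonneg
        (fun i _ => mul_nonneg (ha i) ((hA1 s i).1 j))).1 hj
      refine Finset.sum_eq_zero fun i hi => ?_
      rcases mul_eq_zero.1 (h1 i hi) with h | h
      · rw [h, zero_mul]
      · rw [hAB s i j h, mul_zero])
  let M : ℝ → σ → Matrix (Fin n) (Fin n) ℝ := fun t s => (1 - t) • A s + t • B s
  have hMF : ∀ t s a, (∀ i, 0 ≤ a i) →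
      a ᵥ* M t s = (1 - t) • (a ᵥ* A s) + t • F (a ᵥ* A s) := by
    intro t s a ha
    rw [hF s a ha]
    simp only [M, Matrix.vecMul_add, Matrix.vecMul_smul]
  let p : σ → Polynomial ℝ := fun s =>
    Matrix.det (Matrix.of fun i j => (1 - Polynomial.X) * Polynomial.C (A s i j)
      + Polynomial.X * Polynomial.C (B s i j))
  have hp : ∀ s t, (p s).eval t = (M t s).det := by
    intro s t
    simp only [p]
    rw [← Polynomial.coe_evalRingHom, RingHom.map_det]
    congr 1
    ext i j
    simp [M]
    ring
  let P : Polynomial ℝ := ∑ s, Polynomial.C (SignType.sign (A s).det : ℝ) * p s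
  have hsign : ∀ᶠ t in 𝓝 (0:ℝ), ∀ s, 0 < (SignType.sign (A s).det : ℝ) * (M t s).det := by
    rw [eventually_all]
    intro s
    have hc : ContinuousAt (fun t => (SignType.sign (A s).det : ℝ) * (p s).eval t) 0 :=
      (continuous_const.mul (p s).continuous).continuousAt
    have h0 : 0 < (SignType.sign (A s).det : ℝ) * (p s).eval 0 := by
      rw [hp]
      have : M 0 s = A s := by simp [M]
      rw [this, sign_mul_self]
      exact abs_pos.2 (hA s)
    have := hc.eventually (lt_mem_nhds h0)
    simpa only [hp] using this
  have hP : ∀ᶠ t in 𝓝[>] (0:ℝ), P.eval t = 1 := by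
    filter_upwards [hsign.filter_mono nhdsWithin_le_nhds, Ioo_mem_nhdsGT hδ,
      Ioo_mem_nhdsGT (zero_lt_one' ℝ)] with t hts htδ ht1
    obtain ⟨hinj, hsurj⟩ := hδt t htδ.1 htδ.2
    have key : ∑ s, |(M t s).det| = 1 := by
      refine sp_measure (M t) ?_ ?_ ?_ ?_
      · intro s h0
        have := hts s
        rw [h0, mul_zero] at this
        exact lt_irrefl _ this
      · intro s i
        exact convex_stdSimplex ℝ (Fin n) (hA1 s i) (hB1 s i) (sub_nonneg.2 ht1.2.le) ht1.1.le
          (by ring)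
      · intro y hy
        obtain ⟨x, hx, hxy⟩ := hsurj y hy
        obtain ⟨s, a, ha, rfl⟩ := hcov x hx
        exact ⟨s, a, ha, by rw [hMF t s a ha, hxy]⟩
      · intro s s' a b ha hb hab
        have ha' := fun i => (ha i).le
        have hb' := fun i => (hb i).le
        rw [hMF t s a ha', hMF t s' b hb'] at hab
        exact hdisj s s' a b ha hb
          (hinj (sp_nonneg _ (hA1 s) a ha') (sp_nonneg _ (hA1 s') b hb') hab)
    rw [← key]
    simp only [P, Polynomial.eval_finsetSum, Polynomial.eval_mul, Polynomial.eval_C, hp]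
    refine Finset.sum_congr rfl fun s _ => ?_
    have h1 := hts s
    rw [← abs_of_pos h1, abs_mul]
    have : |(SignType.sign (A s).det : ℝ)| = 1 := by
      rcases lt_or_gt_of_ne (hA s) with h | h
      · simp [h]
      · simp [h]
    rw [this, one_mul]
  have hP1 : P = 1 := by
    refine Polynomial.eq_of_infinite_eval_eq _ _ ?_
    obtain ⟨u, hu, hu2⟩ := mem_nhdsGT_iff_exists_Ioo_subset.1 hP
    refine (Ioo_infinite hu).mono fun t ht => ?_
    simpa using hu2 ht
  by_contra! hcon
  have : P.eval 1 = 0 := by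
    simp only [P, Polynomial.eval_finsetSum, Polynomial.eval_mul, Polynomial.eval_C, hp]
    refine Finset.sum_eq_zero fun s _ => ?_
    have : M 1 s = B s := by simp [M]
    rw [this, hcon s, mul_zero]
  rw [hP1] at this
  simp at this

theorem sp_lin {k : ℕ} (s : Finset (Fin k → ℝ)) (hs : AffineIndependent ℝ ((↑) : s → Fin k → ℝ))
    (hst : ∀ v ∈ s, v ∈ stdSimplex ℝ (Fin k)) (w : (Fin k → ℝ) → ℝ)
    (hw : ∑ v ∈ s, w v • v = 0) : ∀ v ∈ s, w v = 0 := by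
  have h0 : ∑ v ∈ s, w v = 0 := by
    have h1 : ∑ j, (∑ v ∈ s, w v • v) j = ∑ v ∈ s, w v := by
      simp only [Finset.sum_apply, Pi.smul_apply, smul_eq_mul]
      rw [Finset.sum_comm]
      refine Finset.sum_congr rfl fun v hv => ?_
      rw [← Finset.mul_sum, (hst v hv).2, mul_one]
    rw [← h1, hw]; simp
  intro v hv
  have := affineIndependent_iff.1 hs Finset.univ (fun v => w v)
    (by rw [← h0]; exact Finset.sum_coe_sort s w)
    (by rw [← hw]; exact Finset.sum_coe_sort s (fun v => w v • v))
  exact this ⟨v, hv⟩ (Finset.mem_univ _)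

theorem sp_total {k : ℕ} (s : Finset (Fin k → ℝ)) 
    (hst : ∀ v ∈ s, v ∈ stdSimplex ℝ (Fin k)) (w : (Fin k → ℝ) → ℝ) :
    ∑ j, (∑ v ∈ s, w v • v) j = ∑ v ∈ s, w v := by
  simp only [Finset.sum_apply, Pi.smul_apply, smul_eq_mul]
  rw [Finset.sum_comm]
  refine Finset.sum_congr rfl fun v hv => ?_
  rw [← Finset.mul_sum, (hst v hv).2, mul_one]

theorem sp_weights {k : ℕ} (T : SimplicialComplex ℝ (Fin k → ℝ))
    (hst : ∀ s ∈ T.faces, ∀ v ∈ s, v ∈ stdSimplex ℝ (Fin k))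
    (s s' : Finset (Fin k → ℝ)) (hs : s ∈ T.faces) (hs' : s' ∈ T.faces)
    (a b : (Fin k → ℝ) → ℝ) (ha : ∀ v, 0 ≤ a v) (hb : ∀ v, 0 ≤ b v)
    (ha0 : ∀ v, v ∉ s → a v = 0) (hb0 : ∀ v, v ∉ s' → b v = 0)
    (hab : ∑ v ∈ s, a v • v = ∑ v ∈ s', b v • v) : a = b := by
  classical
  have hsum : ∑ v ∈ s, a v = ∑ v ∈ s', b v := by
    rw [← sp_total s (hst s hs) a, hab, sp_total s' (hst s' hs') b]
  have hm : 0 ≤ ∑ v ∈ s, a v := Finset.sum_nonneg fun v _ => ha v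
  rcases hm.eq_or_lt with h0 | hpos
  · have h1 := (Finset.sum_eq_zero_iff_of_nonneg fun v _ => ha v).1 h0.symm
    have h2 := (Finset.sum_eq_zero_iff_of_nonneg fun v _ => hb v).1 (hsum.symm.trans h0.symm)
    ext v
    by_cases hv : v ∈ s <;> by_cases hv' : v ∈ s' <;> simp [*]
  · set m := ∑ v ∈ s, a v with hmdef
    set x := ∑ v ∈ s, a v • v with hx
    have hx1 : m⁻¹ • x ∈ convexHull ℝ (s : Set (Fin k → ℝ)) := by
      refine Finset.mem_convexHull'.2 ⟨fun v => m⁻¹ * a v, fun v _ => by have := ha v; positivity, ?_, ?_⟩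
      · rw [← Finset.mul_sum, ← hmdef, inv_mul_cancel₀ hpos.ne']
      · rw [hx, Finset.smul_sum]; simp only [mul_smul]
    have hx2 : m⁻¹ • x ∈ convexHull ℝ (s' : Set (Fin k → ℝ)) := by
      refine Finset.mem_convexHull'.2 ⟨fun v => m⁻¹ * b v, fun v _ => by have := hb v; positivity, ?_, ?_⟩
      · rw [← Finset.mul_sum, ← hsum, inv_mul_cancel₀ hpos.ne']
      · rw [hab, Finset.smul_sum]; simp only [mul_smul]
    have hx3 := T.inter_subset_convexHull hs hs' ⟨hx1, hx2⟩
    rw [← Finset.coe_inter, Finset.mem_convexHull'] at hx3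
    obtain ⟨c, -, -, hc⟩ := hx3
    let d : (Fin k → ℝ) → ℝ := fun v => if v ∈ s ∩ s' then m * c v else 0
    have hxd : ∀ u, s ∩ s' ⊆ u → ∑ v ∈ u, d v • v = x := by
      intro u hu
      rw [← Finset.sum_subset hu]
      · have : x = m • (m⁻¹ • x) := by rw [smul_smul, mul_inv_cancel₀ hpos.ne', one_smul]
        rw [this, ← hc, Finset.smul_sum]
        refine Finset.sum_congr rfl fun v hv => ?_
        simp only [d, if_pos hv, mul_smul]
      · intro v _ hv
        simp only [d, if_neg hv, zero_smul]
    have had := sp_lin s (T.indep hs) (hst s hs) (fun v => a v - d v) (by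
      simp only [sub_smul, Finset.sum_sub_distrib]
      rw [hxd s Finset.inter_subset_left, ← hx, sub_self])
    have hbd := sp_lin s' (T.indep hs') (hst s' hs') (fun v => b v - d v) (by
      simp only [sub_smul, Finset.sum_sub_distrib]
      rw [hxd s' Finset.inter_subset_right, ← hab, sub_self])
    ext v
    have h1 : a v = d v := by
      by_cases hv : v ∈ s
      · exact sub_eq_zero.1 (had v hv)
      · rw [ha0 v hv]; simp [d, hv]
    have h2 : b v = d v := by
      by_cases hv : v ∈ s'
      · exact sub_eq_zero.1 (hbd v hv)
      · rw [hb0 v hv]; simp [d, hv]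
    rw [h1, h2]

open Matrix MeasureTheory Filter Topology in
/-- Sperner's lemma for the standard simplex `Δ^{k-1} ⊆ ℝ^k`: a Sperner labelling of a
finite triangulation admits a fully-labelled `(k-1)`-dimensional face.  The Sperner
condition `v (L v) ≠ 0` says that `e_{L v}` is a vertex of the minimal face of the
simplex containing `v`. -/
theorem sperner (k : ℕ) (hk : 1 ≤ k)
    (T : SimplicialComplex ℝ (Fin k → ℝ)) (hfin : T.faces.Finite)
    (hspace : T.space = stdSimplex ℝ (Fin k))
    (L : (Fin k → ℝ) → Fin k)
    (hL : ∀ v ∈ T.vertices, v (L v) ≠ 0) :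
    ∃ s ∈ T.faces, s.card = k ∧ Set.InjOn L ↑s := by
  classical
  have hst : ∀ s ∈ T.faces, ∀ v ∈ s, v ∈ stdSimplex ℝ (Fin k) := fun s hs v hv =>
    hspace ▸ T.subset_space hs hv
  let σ := {s : Finset (Fin k → ℝ) // s ∈ T.faces ∧ s.card = k}
  have hσ : Finite σ := (hfin.subset fun s (hs : s ∈ T.faces ∧ s.card = k) => hs.1).to_subtype
  cases nonempty_fintype σ
  let e : (s : σ) → Fin k ≃ s.1 := fun s => (Finset.equivFinOfCardEq s.2.2).symm
  let A : σ → Matrix (Fin k) (Fin k) ℝ := fun s i => (e s i : Fin k → ℝ)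
  let B : σ → Matrix (Fin k) (Fin k) ℝ := fun s i => Pi.single (L (e s i)) 1
  let hat : (s : σ) → (Fin k → ℝ) → (Fin k → ℝ) → ℝ := fun s a v =>
    if h : v ∈ s.1 then a ((e s).symm ⟨v, h⟩) else 0
  have hhat : ∀ s a i, hat s a (e s i) = a i := by
    intro s a i
    simp [hat]
  have hat0 : ∀ s a v, v ∉ s.1 → hat s a v = 0 := by
    intro s a v hv
    simp [hat, hv]
  have hatnn : ∀ s a, (∀ i, 0 ≤ a i) → ∀ v, 0 ≤ hat s a v := by
    intro s a ha v
    simp only [hat]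
    split_ifs
    · exact ha _
    · exact le_rfl
  have hatsum : ∀ s a (g : (Fin k → ℝ) → (Fin k → ℝ)),
      ∑ v ∈ s.1, hat s a v • g v = ∑ i, a i • g (e s i) := by
    intro s a g
    rw [← Finset.sum_coe_sort, ← (e s).sum_comp]
    exact Finset.sum_congr rfl fun i _ => by rw [hhat]
  have hvA : ∀ s a, a ᵥ* A s = ∑ v ∈ s.1, hat s a v • v := by
    intro s a
    rw [hatsum s a (fun v => v)]
    ext j
    rw [sp_apply]
    simp [A]
  have hvB : ∀ s a, a ᵥ* B s = ∑ v ∈ s.1, hat s a v • (Pi.single (L v) 1 : Fin k → ℝ) := by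
    intro s a
    rw [hatsum s a (fun v => Pi.single (L v) 1)]
    ext j
    rw [sp_apply]
    simp [B]
  have hhateq : ∀ s s' (a b : Fin k → ℝ), (∀ i, 0 ≤ a i) → (∀ i, 0 ≤ b i) →
      a ᵥ* A s = b ᵥ* A s' → hat s a = hat s' b := by
    intro s s' a b ha hb hab
    rw [hvA, hvA] at hab
    exact sp_weights T hst s.1 s'.1 s.2.1 s'.2.1 _ _ (hatnn s a ha) (hatnn s' b hb)
      (hat0 s a) (hat0 s' b) hab
  have hA : ∀ s, (A s).det ≠ 0 := by
    intro s
    have hinj : LinearIndependent ℝ (A s).row := by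
      rw [Fintype.linearIndependent_iff]
      intro a ha i
      have h1 := sp_lin s.1 (T.indep s.2.1) (hst s.1 s.2.1) (hat s a)
        (by rw [hatsum s a (fun v => v)]; exact ha) (e s i) (e s i).2
      rwa [hhat] at h1
    exact ((Matrix.isUnit_iff_isUnit_det _).1
      (Matrix.linearIndependent_rows_iff_isUnit.1 hinj)).ne_zero
  have hunit : ∀ s, IsUnit (A s).det := fun s => isUnit_iff_ne_zero.2 (hA s)
  have hA1 : ∀ s i, A s i ∈ stdSimplex ℝ (Fin k) := fun s i => hst s.1 s.2.1 _ (e s i).2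
  -- covering
  let Q : σ → Set (Fin k → ℝ) := fun s => {x | ∀ i, 0 ≤ (x ᵥ* (A s)⁻¹) i}
  have hQ : ∀ s, IsClosed (Q s) := by
    intro s
    simp only [Q, ofPred_forall]
    refine isClosed_iInter fun i => isClosed_le continuous_const ?_
    simp only [Matrix.vecMul, dotProduct]
    fun_prop
  have hQU : IsClosed (⋃ s, Q s) := isClosed_iUnion_of_finite hQ
  let U : Set (Fin k → ℝ) := {x | ∀ i, 0 < x i}
  have hUopen : IsOpen U := by
    have : U = univ.pi fun _ => Ioi 0 := by ext; simp [U]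
    rw [this]; exact isOpen_set_pi finite_univ fun _ _ => isOpen_Ioi
  have hcovU : U ⊆ ⋃ s, Q s := by
    have hN : IsOpen (U ∩ (⋃ s, Q s)ᶜ) := hUopen.inter hQU.isOpen_compl
    have hsub : U ∩ (⋃ s, Q s)ᶜ ⊆ ⋃ s ∈ {s ∈ T.faces | s.card ≠ k},
        (Submodule.span ℝ (s : Set (Fin k → ℝ)) : Set (Fin k → ℝ)) := by
      rintro x ⟨hxU, hxQ⟩
      have hm : 0 < ∑ i, x i :=
        Finset.sum_pos (fun i _ => hxU i) ⟨⟨0, hk⟩, Finset.mem_univ _⟩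
      have hx1 : (∑ i, x i)⁻¹ • x ∈ T.space := by
        rw [hspace]
        refine ⟨fun i => ?_, ?_⟩
        · have := hxU i
          simp only [Pi.smul_apply, smul_eq_mul]
          positivity
        · simp only [Pi.smul_apply, smul_eq_mul]
          rw [← Finset.mul_sum, inv_mul_cancel₀ hm.ne']
      obtain ⟨s, hs, hxs⟩ := SimplicialComplex.mem_space_iff.1 hx1
      have hxx : x = (∑ i, x i) • ((∑ i, x i)⁻¹ • x) := by
        rw [smul_smul, mul_inv_cancel₀ hm.ne', one_smul]
      by_cases hcard : s.card = k
      · exfalso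
        apply hxQ
        obtain ⟨w, hw0, -, hw⟩ := Finset.mem_convexHull'.1 hxs
        let s' : σ := ⟨s, hs, hcard⟩
        refine mem_iUnion.2 ⟨s', ?_⟩
        have hxA : x = (fun i => (∑ i, x i) * w (e s' i)) ᵥ* A s' := by
          rw [hvA, hatsum s' (fun i => (∑ i, x i) * w (e s' i)) (fun v => v)]
          conv_lhs => rw [hxx, ← hw, Finset.smul_sum]
          rw [← Finset.sum_coe_sort, ← (e s').sum_comp]
          exact Finset.sum_congr rfl fun i _ => by rw [mul_smul]
        intro i
        have h2 : x ᵥ* (A s')⁻¹ = (fun i => (∑ i, x i) * w (e s' i)) := by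
          conv_lhs => rw [hxA]
          rw [Matrix.vecMul_vecMul, Matrix.mul_nonsing_inv _ (hunit s'), Matrix.vecMul_one]
        rw [h2]
        exact mul_nonneg hm.le (hw0 _ (e s' i).2)
      · refine mem_biUnion (x := s) ⟨hs, hcard⟩ ?_
        rw [hxx]
        exact Submodule.smul_mem _ _ 
          (convexHull_min Submodule.subset_span (Submodule.convex _) hxs)
    have hnull : volume (U ∩ (⋃ s, Q s)ᶜ) = 0 := by
      refine measure_mono_null hsub ?_
      refine (measure_biUnion_null_iff (hfin.subset (sep_subset _ _)).countable).2 ?_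
      rintro s ⟨hs, hcard⟩
      refine Measure.addHaar_submodule _ _ fun htop => hcard ?_
      have hli : LinearIndependent ℝ ((↑) : s → Fin k → ℝ) := by
        rw [Fintype.linearIndependent_iff]
        intro a ha v
        have h1 := sp_lin s (T.indep hs) (hst s hs) (fun v => if h : v ∈ s then a ⟨v, h⟩ else 0)
          (by rw [← Finset.sum_coe_sort, ← ha]; simp) v v.2
        simpa using h1
      have h2 := finrank_span_finset_eq_card hli
      rw [htop, finrank_top] at h2
      simpa using h2.symm
    have hempty := (hN.measure_eq_zero_iff volume).1 hnull
    intro x hx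
    by_contra hxQ
    have : x ∈ U ∩ (⋃ s, Q s)ᶜ := ⟨hx, hxQ⟩
    rw [hempty] at this
    exact this
  have hcov : ∀ x : Fin k → ℝ, (∀ i, 0 ≤ x i) → ∃ s a, (∀ i, 0 ≤ a i) ∧ a ᵥ* A s = x := by
    intro x hx
    have hxQ : x ∈ ⋃ s, Q s := by
      have hlim : Tendsto (fun ε : ℝ => x + fun _ => ε) (𝓝[>] 0) (𝓝 x) := by
        have hc : Continuous (fun ε : ℝ => x + fun _ => ε) := by fun_prop
        have := hc.tendsto 0
        have h0 : (x + fun _ => (0:ℝ)) = x := by ext; simp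
        rw [h0] at this
        exact this.mono_left nhdsWithin_le_nhds
      refine hQU.mem_of_tendsto hlim ?_
      filter_upwards [self_mem_nhdsWithin] with ε hε
      exact hcovU fun i => add_pos_of_nonneg_of_pos (hx i) hε
    obtain ⟨s, hs⟩ := mem_iUnion.1 hxQ
    refine ⟨s, _, hs, ?_⟩
    rw [Matrix.vecMul_vecMul, Matrix.nonsing_inv_mul _ (hunit s), Matrix.vecMul_one]
  obtain ⟨s, hs⟩ := sp_core A B hA hA1
    (fun s i => single_mem_stdSimplex ℝ _)
    (by
      intro s i j hj
      have hv : (e s i : Fin k → ℝ) ∈ T.vertices :=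
        T.down_closed s.2.1 (Finset.singleton_subset_iff.2 (e s i).2) (Finset.singleton_nonempty _)
      have h1 := hL _ hv
      refine Pi.single_eq_of_ne ?_ _
      rintro rfl
      exact h1 hj)
    hcov
    (by
      intro s s' a b ha hb hab
      have h := hhateq s s' a b ha hb hab
      rw [hvB, hvB, Finset.sum_subset (Finset.subset_union_left (s₂ := s'.1)),
        Finset.sum_subset (Finset.subset_union_right (s₁ := s.1) (s₂ := s'.1)), h]
      · intro v _ hv; rw [hat0 _ _ _ hv, zero_smul]
      · intro v _ hv; rw [hat0 _ _ _ hv, zero_smul])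
    (by
      intro s s' a b ha hb hab
      have h := hhateq s s' a b (fun i => (ha i).le) (fun i => (hb i).le) hab
      have hsupp : ∀ (s : σ) (a : Fin k → ℝ), (∀ i, 0 < a i) → ∀ v, v ∈ s.1 ↔ hat s a v ≠ 0 := by
        intro s a ha v
        by_cases hv : v ∈ s.1
        · simp [hat, hv, (ha _).ne']
        · simp [hat, hv]
      apply Subtype.ext
      ext v
      rw [hsupp s a ha, hsupp s' b hb, h])
  refine ⟨s.1, s.2.1, s.2.2, ?_⟩
  intro v hv v' hv' hvv
  by_contra hne
  apply hs
  refine Matrix.det_zero_of_row_eq (i := (e s).symm ⟨v, hv⟩) (j := (e s).symm ⟨v', hv'⟩) ?_ ?_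
  · intro h
    exact hne (by simpa using h)
  · simp [B, hvv]
end

section
/- Let $P$ be a polytope, $p \in P$, and let $Y : P \to P$ be a continuous map such that $Y(\sigma) \subseteq \sigma$ for every face $\sigma$ of $P$ (including $P$ itself). Then $Y$ is surjective; in particular there exists $x \in P$ with $Y(x) = p$. -/
open Set

open MeasureTheory Polynomial in
theorem FPS_det_interp (n : ℕ) (δ : ℝ) (hδ : 0 < δ) :
    ∃ (t c : Fin (n+1) → ℝ), (∀ k, 0 ≤ t k ∧ t k < δ) ∧
      ∀ A : (Fin n → ℝ) →L[ℝ] (Fin n → ℝ),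
        (ContinuousLinearMap.id ℝ _ + A).det =
          ∑ k, c k * (ContinuousLinearMap.id ℝ _ + t k • A).det := by
  let t : Fin (n+1) → ℝ := fun k => δ * ((k : ℕ) / (n + 1 : ℝ))
  have ht : Function.Injective t := by
    intro a b hab
    have hn : (n + 1 : ℝ) ≠ 0 := by positivity
    simp only [t] at hab
    have := mul_left_cancel₀ hδ.ne' hab
    rw [div_left_inj' hn] at this
    exact Fin.ext (by exact_mod_cast this)
  refine ⟨t, fun k => (Lagrange.basis Finset.univ t k).eval 1, ?_, ?_⟩
  · intro k
    refine ⟨by positivity, ?_⟩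
    have : ((k : ℕ) / (n + 1 : ℝ)) < 1 := by
      rw [div_lt_one (by positivity)]
      exact_mod_cast k.2
    simp only [t]
    nlinarith
  · intro A
    let M := LinearMap.toMatrix' (A : (Fin n → ℝ) →ₗ[ℝ] (Fin n → ℝ))
    let q : ℝ[X] := Matrix.det ((X : ℝ[X]) • M.map C + (1 : Matrix (Fin n) (Fin n) ℝ).map C)
    have hq : ∀ s : ℝ, q.eval s = (ContinuousLinearMap.id ℝ _ + s • A).det := by
      intro s
      have h1 : q.eval s = (s • M + 1).det := by
        simp only [q]
        rw [← coe_evalRingHom, RingHom.map_det]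
        congr 1
        ext i j
        by_cases hij : i = j
        · subst hij; simp; exact mul_comm _ _
        · simp [hij]; exact mul_comm _ _
      rw [h1, ContinuousLinearMap.det, ← LinearMap.det_toMatrix']
      congr 1
      ext i j
      simp [M, LinearMap.toMatrix'_apply, Matrix.one_apply, add_comm, Pi.single_apply]
    have hdeg : q.degree < (Finset.univ : Finset (Fin (n+1))).card := by
      have h2 : q.natDegree ≤ n := by
        have h2' := Polynomial.natDegree_det_X_add_C_le M (1 : Matrix (Fin n) (Fin n) ℝ)
        rwa [Fintype.card_fin] at h2'
      refine lt_of_le_of_lt (degree_le_of_natDegree_le h2) ?_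
      simp
      exact_mod_cast Nat.lt_succ_self n
    have := Lagrange.eq_interpolate (s := Finset.univ) ht.injOn hdeg
    have h3 := congrArg (eval 1) this
    rw [hq, one_smul] at h3
    rw [h3, Lagrange.interpolate_apply, eval_finsetSum]
    refine Finset.sum_congr rfl fun k _ => ?_
    rw [eval_mul, eval_C, hq, mul_comm]

theorem FPS_bij {n : ℕ} (u : (Fin n → ℝ) → (Fin n → ℝ)) (K : NNReal)
    (hu : LipschitzWith K u) (t : ℝ) (ht0 : 0 ≤ t) (ht : t * K < 1) :
    Function.Bijective (fun x => x + t • u x) := by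
  have hL : ∀ x y, ‖t • u x - t • u y‖ ≤ (t * K) * ‖x - y‖ := by
    intro x y
    rw [← smul_sub, norm_smul, Real.norm_of_nonneg ht0, mul_assoc]
    have := hu.dist_le_mul x y
    rw [dist_eq_norm, dist_eq_norm] at this
    gcongr
  constructor
  · intro x y hxy
    simp only at hxy
    have h1 : x - y = -(t • u x - t • u y) := by
      rw [neg_sub, sub_eq_sub_iff_add_eq_add, add_comm _ y]; exact hxy
    have h2 := hL x y
    rw [← norm_neg, ← h1] at h2
    have h3 : ‖x - y‖ ≤ 0 := by nlinarith [norm_nonneg (x - y)]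
    exact sub_eq_zero.1 (norm_le_zero_iff.1 h3)
  · intro y
    have hc : ContractingWith (Real.toNNReal (t * K)) (fun x => y - t • u x) := by
      refine ⟨by simpa [Real.toNNReal_lt_one] using ht, LipschitzWith.of_dist_le_mul ?_⟩
      intro a b
      rw [dist_eq_norm, dist_eq_norm, Real.coe_toNNReal _ (by positivity)]
      simp only [sub_sub_sub_cancel_left]
      rw [← norm_neg, neg_sub]
      exact hL a b
    refine ⟨ContractingWith.fixedPoint _ hc, ?_⟩
    have := hc.fixedPoint_isFixedPt
    rw [Function.IsFixedPt] at this
    simp only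
    nth_rewrite 1 [← this]
    abel

open MeasureTheory in
theorem FPS_integral {n : ℕ} (u v : (Fin n → ℝ) → (Fin n → ℝ)) (K : NNReal)
    (hu : LipschitzWith K u) (hv : LipschitzWith K v)
    (hu1 : ContDiff ℝ 1 u) (hv1 : ContDiff ℝ 1 v) (R : ℝ)
    (huv : ∀ x, R < ‖x‖ → u x = v x) :
    ∫ x in Metric.closedBall (0 : Fin n → ℝ) R, (ContinuousLinearMap.id ℝ _ + fderiv ℝ u x).det
    = ∫ x in Metric.closedBall (0 : Fin n → ℝ) R,
        (ContinuousLinearMap.id ℝ _ + fderiv ℝ v x).det := by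
  -- determinant near the identity
  obtain ⟨ε, hε, hdet⟩ : ∃ ε > 0, ∀ A : (Fin n → ℝ) →L[ℝ] (Fin n → ℝ), ‖A‖ < ε →
      0 < (ContinuousLinearMap.id ℝ _ + A).det := by
    have hc : ContinuousAt (fun A : (Fin n → ℝ) →L[ℝ] (Fin n → ℝ) =>
        (ContinuousLinearMap.id ℝ (Fin n → ℝ) + A).det) 0 :=
      (ContinuousLinearMap.continuous_det.comp (continuous_const.add continuous_id)).continuousAt
    have h0 : (0:ℝ) < (ContinuousLinearMap.id ℝ (Fin n → ℝ) + 0).det := by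
      simp [ContinuousLinearMap.det]
    obtain ⟨ε, hε, h⟩ := Metric.eventually_nhds_iff.1 (hc.eventually (lt_mem_nhds h0))
    exact ⟨ε, hε, fun A hA => h (by simpa using hA)⟩
  obtain ⟨t, c, ht, hc⟩ := FPS_det_interp n (min ε 1 / (K + 1)) (by positivity)
  have key : ∀ w : (Fin n → ℝ) → (Fin n → ℝ), LipschitzWith K w → ContDiff ℝ 1 w → ∀ k,
      ∫ x in Metric.closedBall (0 : Fin n → ℝ) R,
        (ContinuousLinearMap.id ℝ _ + t k • fderiv ℝ w x).det
      = ∫ x in (fun x => x + t k • w x) '' Metric.closedBall (0 : Fin n → ℝ) R, (1:ℝ) := by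
    intro w hw hw1 k
    have htk : t k * (K + 1) < min ε 1 := by
      have := (ht k).2
      rwa [lt_div_iff₀ (by positivity)] at this
    have htk0 := (ht k).1
    have hbij := FPS_bij w K hw (t k) htk0 (by linarith [min_le_right ε 1])
    rw [integral_image_eq_integral_abs_det_fderiv_smul volume (f := fun x => x + t k • w x)
      (f' := fun x => ContinuousLinearMap.id ℝ _ + t k • fderiv ℝ w x)
      Metric.isClosed_closedBall.measurableSet ?_ hbij.1.injOn]
    · refine setIntegral_congr_fun Metric.isClosed_closedBall.measurableSet ?_
      intro x _
      simp only [smul_eq_mul, mul_one]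
      refine (abs_of_pos (hdet _ ?_)).symm
      rw [norm_smul, Real.norm_of_nonneg htk0]
      have h1 : ‖fderiv ℝ w x‖ ≤ K := norm_fderiv_le_of_lipschitz ℝ hw
      have h2 : t k * ‖fderiv ℝ w x‖ ≤ t k * K := by gcongr
      linarith [min_le_left ε 1]
    · intro x _
      exact ((hasFDerivAt_id x).add
        (((hw1.differentiable (by norm_num) x).hasFDerivAt).const_smul (t k))).hasFDerivWithinAt
  have hint : ∀ w : (Fin n → ℝ) → (Fin n → ℝ), ContDiff ℝ 1 w → ∀ k : Fin (n+1),
      Integrable (fun x => c k * (ContinuousLinearMap.id ℝ _ + t k • fderiv ℝ w x).det)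
        (volume.restrict (Metric.closedBall (0 : Fin n → ℝ) R)) := by
    intro w hw1 k
    have hcf := hw1.continuous_fderiv (by norm_num)
    have hsm : Continuous fun x => t k • fderiv ℝ w x := by fun_prop
    have : Continuous (fun x => c k * (ContinuousLinearMap.id ℝ (Fin n → ℝ)
        + t k • fderiv ℝ w x).det) :=
      continuous_const.mul (ContinuousLinearMap.continuous_det.comp
        (continuous_const.add hsm))
    exact this.continuousOn.integrableOn_compact (isCompact_closedBall _ _)
  rw [funext fun x => hc (fderiv ℝ u x), funext fun x => hc (fderiv ℝ v x)]
  rw [integral_finsetSum _ (fun k _ => hint u hu1 k), integral_finsetSum _ (fun k _ => hint v hv1 k)]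
  refine Finset.sum_congr rfl fun k _ => ?_
  rw [integral_const_mul, integral_const_mul, key u hu hu1, key v hv hv1]
  have htk : t k * (K + 1) < min ε 1 := by
    have := (ht k).2
    rwa [lt_div_iff₀ (by positivity)] at this
  have htk0 := (ht k).1
  have hbu := FPS_bij u K hu (t k) htk0 (by linarith [min_le_right ε 1])
  have hbv := FPS_bij v K hv (t k) htk0 (by linarith [min_le_right ε 1])
  have himg : (fun x => x + t k • u x) '' Metric.closedBall (0 : Fin n → ℝ) R
      = (fun x => x + t k • v x) '' Metric.closedBall (0 : Fin n → ℝ) R := by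
    rw [← compl_inj_iff, ← image_compl_eq hbu, ← image_compl_eq hbv]
    refine image_congr ?_
    intro x hx
    have hx' : R < ‖x‖ := by simpa using hx
    simp only [huv x hx']
  rw [himg]

theorem FPS_step (δ : ℝ) (hδ : 0 < δ) : ∃ b : ℝ → ℝ, ContDiff ℝ 1 b ∧ (∃ K, LipschitzWith K b) ∧
    (∀ s, 0 ≤ deriv b s) ∧ (∀ s, δ < |s| → deriv b s = 0) ∧ ∃ c, |c| ≤ δ ∧ 0 < deriv b c := by
  let b : ℝ → ℝ := fun s => Real.smoothTransition (s / δ)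
  have hb : ContDiff ℝ 1 b := by
    have h : ContDiff ℝ 1 Real.smoothTransition := Real.smoothTransition.contDiff (n := 1)
    exact h.comp (contDiff_id.div_const δ)
  have hz : ∀ s, δ < |s| → deriv b s = 0 := by
    intro s hs
    rcases lt_abs.1 hs with h | h
    · have : b =ᶠ[nhds s] fun _ => 1 := by
        filter_upwards [lt_mem_nhds h] with y hy
        exact Real.smoothTransition.one_of_one_le ((one_le_div hδ).2 hy.le)
      rw [this.deriv_eq]; simp
    · have h' : s < 0 := by linarith
      have : b =ᶠ[nhds s] fun _ => 0 := by
        filter_upwards [gt_mem_nhds h'] with y hy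
        exact Real.smoothTransition.zero_of_nonpos (div_nonpos_of_nonpos_of_nonneg hy.le hδ.le)
      rw [this.deriv_eq]; simp
  have hmono : Monotone b := fun x y hxy => Real.smoothTransition.monotone (by gcongr)
  refine ⟨b, hb, ?_, fun s => hmono.deriv_nonneg, hz, ?_⟩
  · have hcs : HasCompactSupport (deriv b) := by
      refine HasCompactSupport.intro (isCompact_Icc (a := -δ) (b := δ)) ?_
      intro x hx
      refine hz x ?_
      by_contra h
      exact hx (abs_le.1 (not_lt.1 h))
    obtain ⟨C, hC⟩ := hcs.exists_bound_of_continuous (hb.continuous_deriv (by norm_num))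
    refine ⟨Real.toNNReal C, lipschitzWith_of_nnnorm_deriv_le (hb.differentiable (by norm_num)) ?_⟩
    intro x
    rw [← NNReal.coe_le_coe]
    exact (hC x).trans (Real.le_coe_toNNReal C)
  · obtain ⟨c, hc, hc'⟩ := exists_deriv_eq_slope b hδ hb.continuous.continuousOn
      (hb.differentiable (by norm_num)).differentiableOn
    refine ⟨c, by rw [abs_of_pos hc.1]; exact hc.2.le, ?_⟩
    rw [hc']
    simp [b, hδ.ne', hδ]

theorem FPS_det_diag {n : ℕ} (w : Fin n → ℝ) :
    (ContinuousLinearMap.pi fun i => w i • (ContinuousLinearMap.proj i : (Fin n → ℝ) →L[ℝ] ℝ)).det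
      = ∏ i, w i := by
  rw [ContinuousLinearMap.det, ← LinearMap.det_toMatrix', ← Matrix.det_diagonal]
  congr 1
  ext i j
  simp [LinearMap.toMatrix'_apply, Matrix.diagonal_apply, Pi.single_apply]

open MeasureTheory in
theorem FPS_zero {n : ℕ} (H : (Fin n → ℝ) → (Fin n → ℝ)) (hH : ContDiff ℝ 1 H) (R : ℝ) (hR : 0 < R)
    (hs : ∀ x, R < ‖x‖ → H x = 0) : ∃ x, x = H x := by
  by_contra hne
  push Not at hne
  have hcs : HasCompactSupport H := by
    refine HasCompactSupport.intro (isCompact_closedBall (0 : Fin n → ℝ) R) ?_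
    intro x hx
    exact hs x (by simpa using hx)
  obtain ⟨KH, hKH⟩ := hH.lipschitzWith_of_hasCompactSupport hcs (by norm_num)
  -- uniform lower bound
  obtain ⟨δ, hδ, hδR, hlow⟩ : ∃ δ > 0, δ ≤ R / 2 ∧ ∀ x, δ < ‖x - H x‖ := by
    obtain ⟨x0, _, hx0⟩ := (isCompact_closedBall (0 : Fin n → ℝ) R).exists_isMinOn
      ⟨0, by simp [hR.le]⟩ (f := fun x => ‖x - H x‖)
      (continuous_id.sub hH.continuous).norm.continuousOn
    have hp : 0 < ‖x0 - H x0‖ := norm_pos_iff.2 (sub_ne_zero.2 (hne x0))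
    refine ⟨min (‖x0 - H x0‖ / 2) (R / 2), by positivity, min_le_right _ _, fun x => ?_⟩
    by_cases hx : ‖x‖ ≤ R
    · have h1 : ‖x0 - H x0‖ ≤ ‖x - H x‖ := hx0 (by simpa using hx)
      linarith [min_le_left (‖x0 - H x0‖ / 2) (R / 2)]
    · rw [hs x (not_le.1 hx), sub_zero]
      linarith [min_le_right (‖x0 - H x0‖ / 2) (R / 2)]
  obtain ⟨b, hb, ⟨Kb, hKb⟩, hb0, hbz, c, hc, hcpos⟩ := FPS_step δ hδ
  let Ψ : (Fin n → ℝ) → (Fin n → ℝ) := fun y i => b (y i)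
  have hΨ : ContDiff ℝ 1 Ψ := contDiff_pi.2 fun i => hb.comp (contDiff_apply ℝ ℝ i)
  have hΨL : LipschitzWith Kb Ψ := by
    refine LipschitzWith.of_dist_le_mul fun x y => ?_
    rw [dist_pi_le_iff (by positivity)]
    intro i
    refine (hKb.dist_le_mul _ _).trans ?_
    gcongr
    exact dist_le_pi_dist x y i
  let D : (Fin n → ℝ) → (Fin n → ℝ) →L[ℝ] (Fin n → ℝ) := fun y =>
    ContinuousLinearMap.pi fun i => deriv b (y i) • (ContinuousLinearMap.proj i : (Fin n → ℝ) →L[ℝ] ℝ)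
  have hD : ∀ y, HasFDerivAt Ψ (D y) y := by
    intro y
    refine hasFDerivAt_pi.2 fun i => ?_
    exact ((hb.differentiable (by norm_num) (y i)).hasDerivAt.comp_hasFDerivAt y
      (hasFDerivAt_apply i y))
  let f : (Fin n → ℝ) → (Fin n → ℝ) := fun x => x - H x
  have hf : ContDiff ℝ 1 f := contDiff_id.sub hH
  have hfL : LipschitzWith (1 + KH) f := LipschitzWith.id.sub hKH
  let K := max (Kb * (1 + KH) + 1) (Kb + 1)
  have hI := FPS_integral (fun x => Ψ (f x) - x) (fun x => Ψ x - x) K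
    (((hΨL.comp hfL).sub LipschitzWith.id).weaken (le_max_left _ _))
    ((hΨL.sub LipschitzWith.id).weaken (le_max_right _ _))
    ((hΨ.comp hf).sub contDiff_id) (hΨ.sub contDiff_id) R
    (by intro x hx; simp [f, hs x hx])
  have h1 : ∀ x, (ContinuousLinearMap.id ℝ _ + fderiv ℝ (fun x => Ψ (f x) - x) x).det = 0 := by
    intro x
    have hd : HasFDerivAt (fun x => Ψ (f x) - x)
        ((D (f x)).comp (fderiv ℝ f x) - ContinuousLinearMap.id ℝ _) x :=
      ((hD (f x)).comp x (hf.differentiable (by norm_num) x).hasFDerivAt).sub (hasFDerivAt_id x)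
    rw [hd.fderiv, add_sub_cancel]
    have : ((D (f x)).comp (fderiv ℝ f x)).det = (D (f x)).det * (fderiv ℝ f x).det := by
      simp only [ContinuousLinearMap.det, ContinuousLinearMap.toLinearMap_comp, LinearMap.det_comp]
    rw [this, FPS_det_diag]
    obtain ⟨i, hi⟩ : ∃ i, δ < |f x i| := by
      by_contra hcon
      push Not at hcon
      exact absurd ((pi_norm_le_iff_of_nonneg hδ.le).2 hcon) (not_le.2 (hlow x))
    rw [Finset.prod_eq_zero (Finset.mem_univ i) (hbz _ hi), zero_mul]
  have h2 : ∀ x, (ContinuousLinearMap.id ℝ _ + fderiv ℝ (fun x => Ψ x - x) x).det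
      = ∏ i, deriv b (x i) := by
    intro x
    have hd : HasFDerivAt (fun x => Ψ x - x) (D x - ContinuousLinearMap.id ℝ _) x :=
      (hD x).sub (hasFDerivAt_id x)
    rw [hd.fderiv, add_sub_cancel, FPS_det_diag]
  rw [funext h1, funext h2] at hI
  have hcont : Continuous fun x : Fin n → ℝ => ∏ i, deriv b (x i) :=
    continuous_finsetProd _ fun i _ => (hb.continuous_deriv (by norm_num)).comp (continuous_apply i)
  have hpos : 0 < ∫ x in Metric.closedBall (0 : Fin n → ℝ) R, ∏ i, deriv b (x i) := by
    rw [setIntegral_pos_iff_support_of_nonneg_ae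
      (Filter.Eventually.of_forall fun x => Finset.prod_nonneg fun i _ => hb0 _)
      (hcont.continuousOn.integrableOn_compact (isCompact_closedBall _ _))]
    have hopen : IsOpen ((Function.support fun x : Fin n → ℝ => ∏ i, deriv b (x i))
        ∩ Metric.ball 0 R) := hcont.isOpen_support.inter Metric.isOpen_ball
    refine lt_of_lt_of_le (hopen.measure_pos volume ⟨fun _ => c, ?_, ?_⟩)
      (measure_mono (inter_subset_inter_right _ Metric.ball_subset_closedBall))
    · simp only [Function.mem_support]
      exact (Finset.prod_pos fun i _ => hcpos).ne'
    · rw [mem_ball_zero_iff]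
      refine lt_of_le_of_lt ((pi_norm_le_iff_of_nonneg hδ.le).2 fun i => hc) (by linarith)
  simp at hI
  linarith

theorem FPS_brouwer {n : ℕ} (G : (Fin n → ℝ) → (Fin n → ℝ)) (hG : Continuous G) (M : ℝ)
    (hM : ∀ x, ‖G x‖ ≤ M) : ∃ x, G x = x := by
  by_contra hne
  push Not at hne
  have hM0 : 0 ≤ M := (norm_nonneg _).trans (hM 0)
  obtain ⟨g, hg, hgG, -⟩ := hG.exists_contDiff_approx 1 (ε := fun x => min 1 (‖G x - x‖))
    (continuous_const.min (hG.sub continuous_id).norm)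
    (fun x => lt_min one_pos (norm_pos_iff.2 (sub_ne_zero.2 (hne x))))
  let χ : ContDiffBump (0 : Fin n → ℝ) := ⟨M + 1, M + 2, by linarith, by linarith⟩
  obtain ⟨x, hx⟩ := FPS_zero (fun x => χ x • g x) (χ.contDiff.smul hg) (M + 2) (by linarith) (by
    intro x hx
    have : χ x = 0 := χ.zero_of_le_dist (by simpa using hx.le)
    simp [this])
  have h1 := hgG x
  rw [lt_min_iff, dist_eq_norm] at h1
  have h2 : ‖g x‖ ≤ M + 1 := by
    have := norm_add_le (g x - G x) (G x)
    rw [sub_add_cancel] at this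
    linarith [hM x]
  have h3 : ‖x‖ ≤ M + 1 := by
    rw [hx, norm_smul, Real.norm_of_nonneg χ.nonneg]
    nlinarith [χ.le_one (x := x), χ.nonneg (x := x), norm_nonneg (g x)]
  have h4 : χ x = 1 := χ.one_of_mem_closedBall (by simpa using h3)
  simp only [h4, one_smul] at hx
  rw [← hx, norm_sub_rev] at h1
  exact lt_irrefl _ h1.2

theorem FPS_brouwer_euclidean {n : ℕ} (G : EuclideanSpace ℝ (Fin n) → EuclideanSpace ℝ (Fin n))
    (hG : Continuous G) (P : Set (EuclideanSpace ℝ (Fin n))) (hP : IsCompact P)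
    (hM : ∀ x, G x ∈ P) : ∃ x, G x = x := by
  let e := EuclideanSpace.equiv (Fin n) ℝ
  obtain ⟨M, hM'⟩ := (hP.image e.continuous).isBounded.exists_norm_le
  obtain ⟨x, hx⟩ := FPS_brouwer (fun x => e (G (e.symm x)))
    (e.continuous.comp (hG.comp e.symm.continuous)) M
    (fun x => hM' _ (mem_image_of_mem _ (hM _)))
  exact ⟨e.symm x, by rw [← e.symm_apply_apply (G (e.symm x)), hx]⟩

/-- A continuous self-map of a polytope mapping every face into itself is surjective. -/
theorem face_preserving_map_surjective (d : ℕ)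
    (V : Finset (EuclideanSpace ℝ (Fin d)))
    (P : Set (EuclideanSpace ℝ (Fin d))) (hP : P = convexHull ℝ ↑V)
    (Y : EuclideanSpace ℝ (Fin d) → EuclideanSpace ℝ (Fin d))
    (hYcont : ContinuousOn Y P)
    (hYface : ∀ σ, IsFace P σ → Set.MapsTo Y σ σ)
    (p : EuclideanSpace ℝ (Fin d)) (hp : p ∈ P) :
    ∃ x ∈ P, Y x = p := by
  have hcompact : IsCompact P := by
    rw [hP]; exact V.finite_toSet.isCompact_convexHull ℝ
  have hconv : Convex ℝ P := by rw [hP]; exact convex_convexHull ℝ _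
  have hproj : ∀ u : EuclideanSpace ℝ (Fin d), ∃ v ∈ P, ∀ w ∈ P, inner ℝ (u - v) (w - v) ≤ 0 := by
    intro u
    obtain ⟨v, hv, h⟩ := exists_norm_eq_iInf_of_complete_convex ⟨p, hp⟩ hcompact.isComplete hconv u
    exact ⟨v, hv, (norm_eq_iInf_iff_real_inner_le_zero hconv hv).1 h⟩
  choose π hπP hπ using hproj
  have hπc : Continuous π := by
    refine LipschitzWith.continuous (K := 1) (LipschitzWith.of_dist_le_mul fun a b => ?_)
    rw [dist_eq_norm, dist_eq_norm, NNReal.coe_one, one_mul]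
    have h1 := hπ a (π b) (hπP b)
    have h2 := hπ b (π a) (hπP a)
    have h3 : inner ℝ (π a - π b) (π a - π b) ≤ inner ℝ (a - b) (π a - π b) := by
      have e1 : inner ℝ (a - π a) (π b - π a) = - inner ℝ (a - π a) (π a - π b) := by
        rw [← inner_neg_right, neg_sub]
      have e2 : inner ℝ (a - b) (π a - π b) - inner ℝ (π a - π b) (π a - π b)
          = inner ℝ (a - π a) (π a - π b) - inner ℝ (b - π b) (π a - π b) := by
        rw [← inner_sub_left, ← inner_sub_left]
        congr 1
        abel
      linarith
    rw [real_inner_self_eq_norm_sq] at h3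
    have h4 := real_inner_le_norm (a - b) (π a - π b)
    by_contra hlt
    push Not at hlt
    nlinarith [norm_nonneg (a - b), norm_nonneg (π a - π b)]
  have hYπ : Continuous fun x => Y (π x) := hYcont.comp_continuous hπc hπP
  obtain ⟨x, hx⟩ := FPS_brouwer_euclidean (fun x => π (π x + p - Y (π x)))
    (hπc.comp ((hπc.add continuous_const).sub hYπ)) P hcompact (fun x => hπP _)
  have hxP : x ∈ P := hx ▸ hπP _
  have hπx : π x = x := by
    have := hπ x x hxP
    rw [real_inner_self_eq_norm_sq] at this
    have h0 : ‖x - π x‖ = 0 := by nlinarith [norm_nonneg (x - π x)]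
    exact (sub_eq_zero.1 (norm_eq_zero.1 h0)).symm
  rw [hπx] at hx
  have hvi : ∀ w ∈ P, inner ℝ (p - Y x) (w - x) ≤ 0 := by
    intro w hw
    have := hπ (x + p - Y x) w hw
    rw [hx] at this
    have e : x + p - Y x - x = p - Y x := by abel
    rwa [e] at this
  let l := innerSL ℝ (p - Y x)
  have hl : ∀ w ∈ P, l w ≤ l x := by
    intro w hw
    have := hvi w hw
    rw [inner_sub_right] at this
    simp only [l, innerSL_apply_apply]
    linarith
  have hface : IsFace P (l.toExposed P) := by
    by_cases h : l.toExposed P = P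
    · exact Or.inr h
    · exact Or.inl ⟨⟨x, hxP, hl⟩, h, (ContinuousLinearMap.toExposed.isExposed).isExtreme⟩
  have hYx := (hYface _ hface ⟨hxP, hl⟩).2 p hp
  simp only [l, innerSL_apply_apply] at hYx
  have h5 : inner ℝ (p - Y x) (p - Y x) ≤ (0:ℝ) := by
    rw [inner_sub_right]; linarith
  refine ⟨x, hxP, ?_⟩
  rw [real_inner_self_eq_norm_sq] at h5
  have h0 : ‖p - Y x‖ = 0 := by nlinarith [norm_nonneg (p - Y x)]
  exact (sub_eq_zero.1 (norm_eq_zero.1 h0)).symm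
end

section
/- Let $H$ be a finite hypergraph whose edges are $d$-intervals in $\mathbb{R}$ (each edge is a union of $d$ closed intervals). Then $\tau(H) \leq (d^2-d+1)\,\nu(H)$, where $\tau(H)$ is the minimum number of points of $\mathbb{R}$ meeting every edge and $\nu(H)$ is the maximum number of pairwise disjoint edges. -/
open Set

/-- `h` is a `d`-interval: a union of `d` closed intervals in `ℝ`. -/
def IsDInterval (d : ℕ) (h : Set ℝ) : Prop :=
  ∃ a b : Fin d → ℝ, (∀ i, a i ≤ b i) ∧ h = ⋃ i, Set.Icc (a i) (b i)


/-- Scarf domination: no `y` beats the minimum of `S` in every order. -/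
def TKDom {I X L : Type*} [LinearOrder L] (r : I → X → L) (S : Finset X) : Prop :=
  ∀ y, ∃ i, ∀ x ∈ S, r i y ≤ r i x

lemma TKDom.mono {I X L : Type*} [LinearOrder L] {r : I → X → L} {S T : Finset X}
    (h : TKDom r S) (hTS : T ⊆ S) : TKDom r T := by
  intro y
  obtain ⟨i, hi⟩ := h y
  exact ⟨i, fun x hx => hi x (hTS hx)⟩

open Classical in
lemma tk_door {I X L : Type*} [Fintype I] [Fintype X] [DecidableEq X] [LinearOrder L]
    (r : I → X → L) (hr : ∀ i, Function.Injective (r i)) (T : Finset X) (hT : TKDom r T)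
    (hTn : T.Nonempty) (hcard : T.card + 1 = Fintype.card I)
    (hne : ∀ i, ∃ y, ∀ l, l ≠ i → ∃ t ∈ T, r l t < r l y) :
    (Finset.univ.filter (fun x => x ∉ T ∧ TKDom r (insert x T))).card = 2 := by
  have hm : ∀ i, ∃ t ∈ T, ∀ x ∈ T, r i t ≤ r i x := fun i =>
    Finset.exists_min_image T (r i) hTn
  choose m hmT hmin using hm
  have hsurj : ∀ t ∈ T, ∃ i, m i = t := by
    intro t ht
    obtain ⟨i, hi⟩ := hT t
    exact ⟨i, hr i (le_antisymm (hmin i t ht) (hi _ (hmT i)))⟩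
  obtain ⟨i, -, j, -, hij, hmij⟩ :=
    Finset.exists_ne_map_eq_of_card_lt_of_maps_to (s := (Finset.univ : Finset I)) (t := T)
      (f := m) (by rw [Finset.card_univ]; omega) (fun a _ => hmT a)
  -- injectivity off an index from surjectivity
  have hinj : ∀ k, (∀ t ∈ T, ∃ l, l ≠ k ∧ m l = t) →
      ∀ l l', l ≠ k → l' ≠ k → m l = m l' → l = l' := by
    intro k hk l l' hl hl' hll
    have h1 : Set.InjOn m (Finset.univ.erase k : Finset I) := by
      apply Finset.injOn_of_surjOn_of_card_le (t := T)
      · intro a _; exact hmT a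
      · intro t ht
        obtain ⟨l, hl, h⟩ := hk t ht
        exact ⟨l, by simp [hl], h⟩
      · rw [Finset.card_erase_of_mem (Finset.mem_univ _), Finset.card_univ]; omega
    exact h1 (by simp [hl]) (by simp [hl']) hll
  have hsi : ∀ t ∈ T, ∃ l, l ≠ i ∧ m l = t := by
    intro t ht
    obtain ⟨l, hl⟩ := hsurj t ht
    by_cases h : l = i
    · exact ⟨j, hij.symm, by rw [← hmij, ← h, hl]⟩
    · exact ⟨l, h, hl⟩
  have hsj : ∀ t ∈ T, ∃ l, l ≠ j ∧ m l = t := by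
    intro t ht
    obtain ⟨l, hl⟩ := hsurj t ht
    by_cases h : l = j
    · exact ⟨i, hij, by rw [hmij, ← h, hl]⟩
    · exact ⟨l, h, hl⟩
  let A : I → X → Prop := fun k y => ∀ l, l ≠ k → ∃ t ∈ T, r l t < r l y
  have hAlow : ∀ k y, A k y → ∀ t ∈ T, r k y ≤ r k t := by
    intro k y hy
    obtain ⟨l, hl⟩ := hT y
    by_cases h : l = k
    · subst h; exact hl
    · obtain ⟨t, ht, hlt⟩ := hy l h
      exact absurd (hl t ht) (not_le.2 hlt)
  have hmax : ∀ k, ∃ x, A k x ∧ ∀ y, A k y → r k y ≤ r k x := by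
    intro k
    obtain ⟨y, hy⟩ := hne k
    obtain ⟨x, hx, hx'⟩ := Finset.exists_max_image (Finset.univ.filter (A k)) (r k)
      ⟨y, by simpa using hy⟩
    exact ⟨x, by simpa using hx, fun y hy => hx' y (by simpa using hy)⟩
  choose M hMA hMmax using hmax
  have hC : ∀ k, (∀ t ∈ T, ∃ l, l ≠ k ∧ m l = t) → M k ∉ T ∧ TKDom r (insert (M k) T) := by
    intro k hk
    refine ⟨?_, ?_⟩
    · intro hMT
      obtain ⟨l, hl, hml⟩ := hk _ hMT
      obtain ⟨t, ht, hlt⟩ := hMA k l hl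
      have := hmin l t ht
      rw [hml] at this
      exact absurd this (not_le.2 hlt)
    · intro y
      by_cases hy : A k y
      · refine ⟨k, ?_⟩
        intro x hx
        rcases Finset.mem_insert.1 hx with rfl | hx
        · exact hMmax k y hy
        · exact hAlow k y hy x hx
      · simp only [A] at hy
        push Not at hy
        obtain ⟨l, hl, hy⟩ := hy
        refine ⟨l, ?_⟩
        intro x hx
        rcases Finset.mem_insert.1 hx with rfl | hx
        · obtain ⟨t, ht, hlt⟩ := hMA k l hl
          exact (hy t ht).trans hlt.le
        · exact hy x hx
  have hB : ∀ x, x ∉ T → TKDom r (insert x T) → x = M i ∨ x = M j := by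
    intro x hx hD
    obtain ⟨k, hk⟩ := hD x
    have hk' : ∀ t ∈ T, ∃ l, l ≠ k ∧ m l = t ∧ r l t ≤ r l x := by
      intro t ht
      obtain ⟨l, hl⟩ := hD t
      refine ⟨l, ?_, ?_, hl x (by simp)⟩
      · rintro rfl
        have := hr l (le_antisymm (hl x (by simp)) (hk t (by simp [ht])))
        exact hx (this ▸ ht)
      · exact hr l (le_antisymm (hmin l t ht) (hl _ (by simp [hmT l])))
    have hkinj := hinj k (fun t ht => by
      obtain ⟨l, h1, h2, -⟩ := hk' t ht
      exact ⟨l, h1, h2⟩)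
    have hkij : k = i ∨ k = j := by
      by_contra hcon
      push Not at hcon
      exact hij (hkinj i j (Ne.symm hcon.1) (Ne.symm hcon.2) hmij)
    have hAx : A k x := by
      intro l hl
      obtain ⟨l', h1, h2, h3⟩ := hk' (m l) (hmT l)
      have := hkinj l' l h1 hl h2
      subst this
      refine ⟨m l', hmT l', lt_of_le_of_ne h3 ?_⟩
      intro h
      exact hx (hr _ h ▸ hmT l')
    have hxmax : ∀ y, A k y → r k y ≤ r k x := by
      intro y hy
      obtain ⟨l, hl⟩ := hD y
      by_cases h : l = k
      · subst h; exact hl x (by simp)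
      · obtain ⟨t, ht, hlt⟩ := hy l h
        exact absurd (hl t (by simp [ht])) (not_le.2 hlt)
    have : x = M k := hr k (le_antisymm (hMmax k x hAx) (hxmax _ (hMA k)))
    rcases hkij with rfl | rfl
    · exact Or.inl this
    · exact Or.inr this
  have hne' : M i ≠ M j := by
    intro h
    obtain ⟨t, ht, hlt⟩ := hMA j i hij
    have := hAlow i (M i) (hMA i) t ht
    rw [h] at this
    exact absurd this (not_le.2 hlt)
  have : Finset.univ.filter (fun x => x ∉ T ∧ TKDom r (insert x T)) = {M i, M j} := by
    ext x
    simp only [Finset.mem_filter, Finset.mem_univ, true_and, Finset.mem_insert,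
      Finset.mem_singleton]
    constructor
    · rintro ⟨h1, h2⟩; exact hB x h1 h2
    · rintro (rfl | rfl)
      · exact hC i hsi
      · exact hC j hsj
  rw [this, Finset.card_pair hne']

open Classical in
lemma tk_room {I X : Type*} [Fintype I] [DecidableEq X] (c : X → I) (i0 : I)
    (S : Finset X) (hS : S.card = Fintype.card I) (hcol : S.image c ≠ Finset.univ) :
    Even (S.filter (fun x => (S.erase x).image c = Finset.univ.erase i0)).card := by
  by_cases hex : ∃ x ∈ S, (S.erase x).image c = Finset.univ.erase i0
  · obtain ⟨x, hx, hxi⟩ := hex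
    have hinj : ∀ z ∈ S, (S.erase z).image c = Finset.univ.erase i0 →
        Set.InjOn c (S.erase z : Finset X) := by
      intro z hz h
      rw [← Finset.card_image_iff, h, Finset.card_erase_of_mem (Finset.mem_univ _),
        Finset.card_erase_of_mem hz, hS, Finset.card_univ]
    have hcx : c x ≠ i0 := by
      intro h
      apply hcol
      rw [← Finset.insert_erase hx, Finset.image_insert, hxi, h,
        Finset.insert_erase (Finset.mem_univ _)]
    have : c x ∈ (S.erase x).image c := by rw [hxi]; simp [hcx]
    obtain ⟨x', hx', hcc⟩ := Finset.mem_image.1 this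
    have hx'S := Finset.mem_of_mem_erase hx'
    have hx'x : x' ≠ x := Finset.ne_of_mem_erase hx'
    have : S.filter (fun x => (S.erase x).image c = Finset.univ.erase i0) = {x, x'} := by
      ext z
      simp only [Finset.mem_filter, Finset.mem_insert, Finset.mem_singleton]
      constructor
      · rintro ⟨hz, hzi⟩
        by_contra hcon
        push Not at hcon
        exact hx'x (hinj z hz hzi (by simp [hx'S, Ne.symm hcon.2])
          (by simp [hx, Ne.symm hcon.1]) hcc)
      · rintro (rfl | rfl)
        · exact ⟨hx, hxi⟩
        · refine ⟨hx'S, ?_⟩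
          rw [← hxi]
          ext k
          simp only [Finset.mem_image, Finset.mem_erase]
          constructor
          · rintro ⟨a, ⟨h1, h2⟩, rfl⟩
            by_cases hax : a = x
            · exact ⟨z, ⟨hx'x, hx'S⟩, by rw [hcc, hax]⟩
            · exact ⟨a, ⟨hax, h2⟩, rfl⟩
          · rintro ⟨a, ⟨h1, h2⟩, rfl⟩
            by_cases hax : a = z
            · exact ⟨x, ⟨hx'x.symm, hx⟩, by rw [hax, hcc]⟩
            · exact ⟨a, ⟨hax, h2⟩, rfl⟩
    rw [this, Finset.card_pair hx'x.symm]
    exact even_two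
  · have : S.filter (fun x => (S.erase x).image c = Finset.univ.erase i0) = ∅ := by
      rw [Finset.filter_eq_empty_iff]
      intro x hx h
      exact hex ⟨x, hx, h⟩
    rw [this]; simp

open Classical in
lemma tk_scarf {I X L : Type*} [Fintype I] [Fintype X] [Nonempty X] [LinearOrder L]
    (hI : 2 ≤ Fintype.card I)
    (r : I → I ⊕ X → L) (hr : ∀ i, Function.Injective (r i))
    (hbot : ∀ i y, r i (Sum.inl i) ≤ r i y)
    (htop : ∀ i x k, k ≠ i → r i (Sum.inr x) < r i (Sum.inl k)) (c : X → I) :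
    ∃ S : Finset (I ⊕ X), TKDom r S ∧ ∀ i, ∃ s ∈ S, Sum.elim id c s = i := by
  have hIn : Nonempty I := by
    rw [← Fintype.card_pos_iff]; omega
  obtain ⟨i0⟩ := hIn
  set c' : I ⊕ X → I := Sum.elim id c with hc'
  by_contra hcon
  let R : Finset (Finset (I ⊕ X)) :=
    Finset.univ.filter (fun S => S.card = Fintype.card I ∧ TKDom r S)
  let D : Finset (Finset (I ⊕ X)) :=
    Finset.univ.filter (fun T => T.card + 1 = Fintype.card I ∧ TKDom r T ∧
      T.image c' = Finset.univ.erase i0)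
  have hcount : ∑ T ∈ D, (Finset.univ.filter (fun x => x ∉ T ∧ TKDom r (insert x T))).card
      = ∑ S ∈ R, (S.filter (fun x => (S.erase x).image c' = Finset.univ.erase i0)).card := by
    rw [← Finset.card_sigma, ← Finset.card_sigma]
    refine Finset.card_bij' (fun p _ => ⟨insert p.2 p.1, p.2⟩) (fun p _ => ⟨p.1.erase p.2, p.2⟩)
      ?_ ?_ ?_ ?_
    · rintro ⟨T, x⟩ h
      simp only [Finset.mem_sigma, D, R, Finset.mem_filter, Finset.mem_univ, true_and] at h ⊢
      obtain ⟨⟨h1, h2, h3⟩, h4, h5⟩ := h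
      refine ⟨⟨?_, h5⟩, Finset.mem_insert_self _ _, ?_⟩
      · rw [Finset.card_insert_of_notMem h4, h1]
      · rw [Finset.erase_insert h4, h3]
    · rintro ⟨S, x⟩ h
      simp only [Finset.mem_sigma, D, R, Finset.mem_filter, Finset.mem_univ, true_and] at h ⊢
      obtain ⟨⟨h1, h2⟩, h4, h5⟩ := h
      refine ⟨⟨?_, h2.mono (Finset.erase_subset _ _), h5⟩, Finset.notMem_erase _ _, ?_⟩
      · rw [Finset.card_erase_add_one h4, h1]
      · rwa [Finset.insert_erase h4]
    · rintro ⟨T, x⟩ h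
      simp only [Finset.mem_sigma, D, Finset.mem_filter, Finset.mem_univ, true_and] at h ⊢
      rw [Finset.erase_insert h.2.1]
    · rintro ⟨S, x⟩ h
      simp only [Finset.mem_sigma, D, R, Finset.mem_filter, Finset.mem_univ, true_and] at h ⊢
      rw [Finset.insert_erase h.2.1]
  have hRHS : Even (∑ S ∈ R,
      (S.filter (fun x => (S.erase x).image c' = Finset.univ.erase i0)).card) := by
    apply Finset.even_sum
    intro S hS
    simp only [R, Finset.mem_filter, Finset.mem_univ, true_and] at hS
    apply tk_room c' i0 S hS.1
    intro h
    apply hcon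
    refine ⟨S, hS.2, fun i => ?_⟩
    have : i ∈ S.image c' := by rw [h]; simp
    simpa using this
  let T0 : Finset (I ⊕ X) := (Finset.univ.erase i0).image Sum.inl
  have hT0mem : ∀ k, Sum.inl k ∈ T0 ↔ k ≠ i0 := by intro k; simp [T0]
  have hT0mem' : ∀ x, Sum.inr x ∉ T0 := by intro k; simp [T0]
  have hkey : ∀ x, TKDom r (insert (Sum.inr x) T0) ↔
      ∀ x', r i0 (Sum.inr x') ≤ r i0 (Sum.inr x) := by
    intro x
    constructor
    · intro h x'
      obtain ⟨i, hi⟩ := h (Sum.inr x')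
      by_cases hii : i = i0
      · subst hii; exact hi _ (by simp)
      · have h1 := hi (Sum.inl i) (by simp [hT0mem, hii])
        have := hr i (le_antisymm h1 (hbot _ _))
        simp at this
    · intro h y
      rcases y with k | x'
      · exact ⟨k, fun x _ => hbot k x⟩
      · refine ⟨i0, ?_⟩
        intro z hz
        rcases Finset.mem_insert.1 hz with rfl | hz
        · exact h x'
        · rcases z with k | z
          · exact (htop _ _ _ ((hT0mem k).1 hz)).le
          · exact absurd hz (hT0mem' z)
  obtain ⟨xm, -, hxm⟩ := Finset.exists_max_image (Finset.univ : Finset X)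
    (fun x => r i0 (Sum.inr x)) Finset.univ_nonempty
  have hT0D : T0 ∈ D := by
    simp only [D, Finset.mem_filter, Finset.mem_univ, true_and]
    refine ⟨?_, ?_, ?_⟩
    · rw [Finset.card_image_of_injective _ Sum.inl_injective,
        Finset.card_erase_of_mem (Finset.mem_univ _), Finset.card_univ]
      omega
    · exact ((hkey xm).2 (fun x' => hxm x' (Finset.mem_univ _))).mono (Finset.subset_insert _ _)
    · rw [Finset.image_image]
      ext k; simp [hc']
  have hT0c : (Finset.univ.filter (fun x => x ∉ T0 ∧ TKDom r (insert x T0))).card = 1 := by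
    rw [Finset.card_eq_one]
    refine ⟨Sum.inr xm, ?_⟩
    ext z
    simp only [Finset.mem_filter, Finset.mem_univ, true_and, Finset.mem_singleton]
    constructor
    · rintro ⟨h1, h2⟩
      rcases z with k | z
      · have hk : k = i0 := by
          by_contra h; exact h1 ((hT0mem k).2 h)
        subst hk
        obtain ⟨i, hi⟩ := h2 (Sum.inr xm)
        have h1 := hi (Sum.inl i) (by
          by_cases h : i = k
          · simp [h]
          · simp [hT0mem, h])
        have := hr i (le_antisymm h1 (hbot _ _))
        simp at this
      · exact hr i0 (le_antisymm (hxm z (Finset.mem_univ _)) ((hkey z).1 h2 xm))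
    · rintro rfl
      exact ⟨hT0mem' xm, (hkey xm).2 (fun x' => hxm x' (Finset.mem_univ _))⟩
  have hrest : Even (∑ T ∈ D.erase T0,
      (Finset.univ.filter (fun x => x ∉ T ∧ TKDom r (insert x T))).card) := by
    apply Finset.even_sum
    intro T hT
    rw [Finset.mem_erase] at hT
    obtain ⟨hTT0, hT⟩ := hT
    simp only [D, Finset.mem_filter, Finset.mem_univ, true_and] at hT
    obtain ⟨h1, h2, h3⟩ := hT
    have hx : ∃ x, Sum.inr x ∈ T := by
      by_contra hno
      push Not at hno
      apply hTT0
      have : ∀ k, Sum.inl k ∈ T ↔ k ≠ i0 := by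
        intro k
        have hk : k ∈ T.image c' ↔ k ≠ i0 := by rw [h3]; simp
        rw [← hk, Finset.mem_image]
        constructor
        · intro h; exact ⟨_, h, rfl⟩
        · rintro ⟨a | a, ha, h⟩
          · simp only [hc', Sum.elim_inl, id] at h
            exact h ▸ ha
          · exact absurd ha (hno a)
      ext z
      rcases z with k | z
      · rw [this, hT0mem]
      · simp [hno z, hT0mem' z]
    obtain ⟨x, hx⟩ := hx
    rw [tk_door r hr T h2 ⟨_, hx⟩ h1]
    · exact even_two
    · intro i
      exact ⟨Sum.inl i, fun l hl => ⟨_, hx, htop l x i (Ne.symm hl)⟩⟩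
  rw [← Finset.add_sum_erase _ _ hT0D, hT0c] at hcount
  rw [← hcount] at hRHS
  rw [Nat.even_add] at hRHS
  simp [hrest] at hRHS

lemma tk_kkm_approx (n : ℕ) (hn : 2 ≤ n) (g : Fin n → (Fin n → ℝ) → ℝ)
    (hcov : ∀ x ∈ stdSimplex ℝ (Fin n), ∃ i, g i x ≤ 0) (ε : ℝ) (hε : 0 < ε) :
    ∃ p ∈ stdSimplex ℝ (Fin n), ∀ i, p i ≤ ε ∨
      ∃ x ∈ stdSimplex ℝ (Fin n), dist x p ≤ ε ∧ g i x ≤ 0 := by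
  classical
  have hn0 : (0 : ℝ) < n := by
    have : 0 < n := by omega
    exact_mod_cast this
  set δ : ℝ := ε / (2 * n) with hδ
  have hδ0 : 0 < δ := by positivity
  have hδn : 2 * n * δ = ε := by rw [hδ]; field_simp
  obtain ⟨t0, ht0, ht0f, htcov⟩ := (isCompact_stdSimplex ℝ (Fin n)).finite_cover_balls hδ0
  obtain ⟨t, rfl⟩ := ht0f.exists_finset_coe
  have hdense : ∀ y ∈ stdSimplex ℝ (Fin n), ∃ x ∈ t, dist y x < δ := by
    intro y hy
    have := htcov hy
    simpa using this
  let X := {x // x ∈ t}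
  have hXs : ∀ x : X, x.1 ∈ stdSimplex ℝ (Fin n) := fun x => ht0 x.2
  have hXne : Nonempty X := by
    obtain ⟨x, hx, -⟩ := hdense _ (single_mem_stdSimplex ℝ (⟨0, by omega⟩ : Fin n))
    exact ⟨⟨x, hx⟩⟩
  obtain ⟨e, he⟩ := Countable.exists_injective_nat X
  choose c hc using fun x : X => hcov x.1 (hXs x)
  let r : Fin n → Fin n ⊕ X → Lex (ℕ × Lex (ℝ × ℕ)) := fun i =>
    Sum.elim (fun k => if k = i then toLex (0, toLex ((0 : ℝ), 0)) else
        toLex (2 + k.val, toLex ((0 : ℝ), 0)))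
      (fun x => toLex (1, toLex (x.1 i, e x)))
  have hr : ∀ i, Function.Injective (r i) := by
    rintro i (k | x) (l | y) h
    · simp only [r, Sum.elim_inl] at h
      split_ifs at h with h1 h2 h2
      · rw [h1, h2]
      · simp at h; omega
      · simp at h
      · simp only [EmbeddingLike.apply_eq_iff_eq, Prod.mk.injEq, and_true] at h
        congr 1
        ext; omega
    · simp only [r, Sum.elim_inl, Sum.elim_inr] at h
      split_ifs at h with h1
      · simp at h
      · simp only [EmbeddingLike.apply_eq_iff_eq, Prod.mk.injEq] at h
        omega
    · simp only [r, Sum.elim_inl, Sum.elim_inr] at h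
      split_ifs at h with h1
      · simp at h
      · simp only [EmbeddingLike.apply_eq_iff_eq, Prod.mk.injEq] at h
        omega
    · simp only [r, Sum.elim_inr, EmbeddingLike.apply_eq_iff_eq, Prod.mk.injEq] at h
      rw [he h.2.2]
  have hbot : ∀ i y, r i (Sum.inl i) ≤ r i y := by
    rintro i (k | x)
    · simp only [r, Sum.elim_inl, if_true]
      split_ifs with h
      · exact le_rfl
      · rw [Prod.Lex.toLex_le_toLex]; left; simp
    · simp only [r, Sum.elim_inl, if_true, Sum.elim_inr]
      rw [Prod.Lex.toLex_le_toLex]; left; simp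
  have htop : ∀ i x k, k ≠ i → r i (Sum.inr x) < r i (Sum.inl k) := by
    intro i x k hk
    simp only [r, Sum.elim_inl, Sum.elim_inr, hk, if_false]
    rw [Prod.Lex.toLex_lt_toLex]; left; simp; omega
  have hrle : ∀ i (x y : X), r i (Sum.inr x) ≤ r i (Sum.inr y) → x.1 i ≤ y.1 i := by
    intro i x y h
    simp only [r, Sum.elim_inr] at h
    rw [Prod.Lex.toLex_le_toLex] at h
    simp only [lt_self_iff_false, true_and, false_or] at h
    rw [Prod.Lex.toLex_le_toLex] at h
    rcases h with h | h
    · exact h.le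
    · exact h.1.le
  obtain ⟨S, hS, hcol⟩ := tk_scarf (by simpa using hn) r hr hbot htop c
  have hDx : ∀ x : X, ∃ i, Sum.inl i ∉ S ∧ ∀ y, Sum.inr y ∈ S → x.1 i ≤ y.1 i := by
    intro x
    obtain ⟨i, hi⟩ := hS (Sum.inr x)
    refine ⟨i, ?_, fun y hy => hrle i x y (hi _ hy)⟩
    intro h
    have := hr i (le_antisymm (hi _ h) (hbot _ _))
    simp at this
  have hcS : ∀ i, Sum.inl i ∉ S → ∃ x : X, Sum.inr x ∈ S ∧ c x = i := by
    intro i hi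
    obtain ⟨s, hs, h⟩ := hcol i
    rcases s with k | x
    · simp only [Sum.elim_inl, id] at h
      exact absurd (h ▸ hs) hi
    · exact ⟨x, hs, h⟩
  obtain ⟨i1, hi1, -⟩ := hDx hXne.some
  obtain ⟨p, hp, -⟩ := hcS i1 hi1
  have hmin : ∀ i, ∃ x : X, Sum.inr x ∈ S ∧ ∀ y, Sum.inr y ∈ S → x.1 i ≤ y.1 i := by
    intro i
    obtain ⟨x, hx, h⟩ := Finset.exists_min_image (Finset.univ.filter (fun x : X => Sum.inr x ∈ S))
      (fun x => x.1 i) ⟨p, by simpa using hp⟩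
    exact ⟨x, by simpa using hx, fun y hy => h y (by simpa using hy)⟩
  choose m hmS hm using hmin
  let μ : Fin n → ℝ := fun i => if Sum.inl i ∈ S then 0 else (m i).1 i
  have hμ0 : ∀ i, 0 ≤ μ i := by
    intro i
    simp only [μ]
    split_ifs
    · exact le_rfl
    · exact (hXs (m i)).1 i
  have hμx : ∀ x : X, Sum.inr x ∈ S → ∀ i, μ i ≤ x.1 i := by
    intro x hx i
    simp only [μ]
    split_ifs
    · exact (hXs x).1 i
    · exact hm i x hx
  have hsum : 1 - ε ≤ ∑ i, μ i := by
    by_contra hlt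
    push Not at hlt
    let y : Fin n → ℝ := fun i => μ i + 2 * δ + if i = i1 then 1 - ∑ i, μ i - ε else 0
    have hyμ : ∀ i, μ i + 2 * δ ≤ y i := by
      intro i
      simp only [y]
      split_ifs <;> linarith
    have hy : y ∈ stdSimplex ℝ (Fin n) := by
      refine ⟨fun i => ?_, ?_⟩
      · have := hyμ i; have := hμ0 i; linarith
      · simp only [y, Finset.sum_add_distrib, Finset.sum_const, Finset.card_univ,
          Fintype.card_fin, nsmul_eq_mul, Finset.sum_ite_eq', Finset.mem_univ, if_true]
        linarith
    obtain ⟨x, hx, hxy⟩ := hdense y hy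
    obtain ⟨i, hi, hle⟩ := hDx ⟨x, hx⟩
    have h1 := hle _ (hmS i)
    have h2 : μ i = (m i).1 i := by simp [μ, hi]
    have h3 := (dist_pi_lt_iff hδ0).1 hxy i
    rw [Real.dist_eq] at h3
    have h4 := (abs_lt.1 h3).2
    have h5 := hyμ i
    simp only at h1
    linarith
  have hclose : ∀ x : X, Sum.inr x ∈ S → ∀ i, x.1 i - μ i ≤ ε := by
    intro x hx i
    have h1 : x.1 i - μ i ≤ ∑ j, (x.1 j - μ j) :=
      Finset.single_le_sum (f := fun j => x.1 j - μ j)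
        (fun j _ => sub_nonneg.2 (hμx x hx j)) (Finset.mem_univ i)
    rw [Finset.sum_sub_distrib, (hXs x).2] at h1
    linarith
  refine ⟨p.1, hXs p, fun i => ?_⟩
  by_cases hi : Sum.inl i ∈ S
  · left
    have := hclose p hp i
    simpa [μ, hi] using this
  · right
    obtain ⟨x, hx, hxi⟩ := hcS i hi
    refine ⟨x.1, hXs x, ?_, ?_⟩
    · rw [dist_pi_le_iff hε.le]
      intro j
      rw [Real.dist_eq, abs_le]
      have h1 := hclose x hx j
      have h2 := hclose p hp j
      have h3 := hμx x hx j
      have h4 := hμx p hp j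
      constructor <;> linarith
    · rw [← hxi]; exact hc x

lemma tk_kkm (n : ℕ) (hn : 2 ≤ n) (g : Fin n → (Fin n → ℝ) → ℝ)
    (hg : ∀ i, Continuous (g i))
    (hcov : ∀ x ∈ stdSimplex ℝ (Fin n), ∃ i, g i x ≤ 0)
    (hbd : ∀ x ∈ stdSimplex ℝ (Fin n), ∀ i, x i = 0 → g i x ≤ 0) :
    ∃ p ∈ stdSimplex ℝ (Fin n), ∀ i, g i p ≤ 0 := by
  choose P hP hP' using fun k : ℕ => tk_kkm_approx n hn g hcov (1 / ((k : ℝ) + 1)) (by positivity)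
  obtain ⟨p, hp, φ, hφ, hlim⟩ := (isCompact_stdSimplex ℝ (Fin n)).tendsto_subseq hP
  refine ⟨p, hp, fun i => ?_⟩
  by_contra hcon
  push Not at hcon
  have hpi : 0 < p i := by
    refine lt_of_le_of_ne (hp.1 i) ?_
    intro h
    exact absurd (hbd p hp i h.symm) (not_le.2 hcon)
  obtain ⟨δ, hδ, hball⟩ := Metric.isOpen_iff.1 (isOpen_lt continuous_const (hg i)) p hcon
  have hε : 0 < min (δ / 2) (p i / 2) := by positivity
  have h1 := Metric.tendsto_nhds.1 hlim _ hε
  have h2 : Filter.Tendsto (fun k : ℕ => 1 / ((φ k : ℝ) + 1)) Filter.atTop (nhds 0) :=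
    tendsto_one_div_add_atTop_nhds_zero_nat.comp hφ.tendsto_atTop
  have h3 := (tendsto_order.1 h2).2 _ hε
  obtain ⟨k, hk1, hk2⟩ := (h1.and h3).exists
  simp only [Function.comp] at hk1
  have hk1a := hk1.trans_le (min_le_left _ _)
  have hk1b := hk1.trans_le (min_le_right _ _)
  have hk2a := hk2.trans_le (min_le_left _ _)
  have hk2b := hk2.trans_le (min_le_right _ _)
  rcases hP' (φ k) i with h | ⟨x, -, hxd, hxg⟩
  · have h4 := (dist_le_pi_dist (P (φ k)) p i).trans_lt hk1b
    rw [Real.dist_eq] at h4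
    have := (abs_lt.1 h4).1
    linarith
  · have : x ∈ Metric.ball p δ := by
      rw [Metric.mem_ball]
      have := dist_triangle x (P (φ k)) p
      linarith
    exact absurd (hball this) (not_lt.2 hxg)

lemma tk_move {K : Type*} (s : Finset K) (b c : K → ℝ) (hb : ∀ k ∈ s, 0 ≤ b k)
    (hbc : ∀ k ∈ s, 0 < c k → 0 < b k) (hc : ∃ k ∈ s, 0 < c k) :
    ∃ t : ℝ, 0 < t ∧ (∀ k ∈ s, 0 ≤ b k - t * c k) ∧ ∃ k ∈ s, 0 < c k ∧ b k - t * c k = 0 := by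
  classical
  obtain ⟨k0, hk0, hck0⟩ := hc
  obtain ⟨k, hk, hmin⟩ := Finset.exists_min_image (s.filter (fun k => 0 < c k))
    (fun k => b k / c k) ⟨k0, by simp [hk0, hck0]⟩
  rw [Finset.mem_filter] at hk
  refine ⟨b k / c k, div_pos (hbc k hk.1 hk.2) hk.2, ?_, k, hk.1, hk.2, ?_⟩
  · intro j hj
    by_cases hcj : 0 < c j
    · have := hmin j (by simp [hj, hcj])
      rw [le_div_iff₀ hcj] at this
      linarith
    · have h1 : 0 ≤ b k / c k := div_nonneg (hb k hk.1) hk.2.le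
      have := mul_nonneg h1 (neg_nonneg.2 (not_lt.1 hcj))
      have := hb j hj
      linarith
  · rw [div_mul_cancel₀ _ hk.2.ne']; ring

open Classical in
lemma tk_furedi {α V : Type*} [Fintype V] (d : ℕ) (e : α → Finset V) :
    ∀ (N : ℕ) (E : Finset α) (w : α → ℝ), (∀ a ∈ E, 0 ≤ w a) →
      (∀ a ∈ E, (e a).Nonempty ∧ (e a).card ≤ d) →
      (∀ v, ∑ a ∈ E with v ∈ e a, w a ≤ 1) →
      E.card * (Fintype.card V + 1) +
        (Finset.univ.filter (fun v => ∑ a ∈ E with v ∈ e a, w a ≠ 1)).card < N →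
      ∃ M ⊆ E, (∀ a ∈ M, ∀ b ∈ M, a ≠ b → Disjoint (e a) (e b)) ∧
        ∑ a ∈ E, w a ≤ ((d : ℝ) - 1 + 1 / d) * M.card := by
  intro N
  induction N with
  | zero => intro E w _ _ _ h; omega
  | succ N ih =>
  intro E w hw he hload hN
  have hdrop : ∀ E' : Finset α, ∀ w' : α → ℝ, E' ⊂ E → 
      (E'.card * (Fintype.card V + 1) +
        (Finset.univ.filter (fun v => ∑ a ∈ E' with v ∈ e a, w' a ≠ 1)).card < N) := by
    intro E' w' h
    have h1 := Finset.card_lt_card h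
    have h2 : (Finset.univ.filter (fun v => ∑ a ∈ E' with v ∈ e a, w' a ≠ 1)).card
        ≤ Fintype.card V := Finset.card_le_univ _
    have h3 : (E'.card + 1) * (Fintype.card V + 1) ≤ E.card * (Fintype.card V + 1) :=
      Nat.mul_le_mul_right _ h1
    rw [add_mul] at h3
    omega
  have hzero : ∀ w' : α → ℝ, (∀ a ∈ E, 0 ≤ w' a) → (∀ v, ∑ a ∈ E with v ∈ e a, w' a ≤ 1) →
      (∃ a ∈ E, w' a = 0) → ∃ M ⊆ E, (∀ a ∈ M, ∀ b ∈ M, a ≠ b → Disjoint (e a) (e b)) ∧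
        ∑ a ∈ E, w' a ≤ ((d : ℝ) - 1 + 1 / d) * M.card := by
    rintro w' hw' hl' ⟨a, ha, ha0⟩
    obtain ⟨M, hM, hM1, hM2⟩ := ih (E.erase a) w'
      (fun b hb => hw' b (Finset.mem_of_mem_erase hb))
      (fun b hb => he b (Finset.mem_of_mem_erase hb))
      (fun v => le_trans (Finset.sum_le_sum_of_subset_of_nonneg
        (Finset.filter_subset_filter _ (Finset.erase_subset _ _))
        (fun b hb _ => hw' b (Finset.mem_filter.1 hb).1)) (hl' v))
      (hdrop _ _ (Finset.erase_ssubset ha))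
    refine ⟨M, hM.trans (Finset.erase_subset _ _), hM1, ?_⟩
    rw [← Finset.add_sum_erase _ _ ha, ha0, zero_add]
    exact hM2
  by_cases hz : ∃ a ∈ E, w a = 0
  · exact hzero w hw hload hz
  push Not at hz
  have hpos : ∀ a ∈ E, 0 < w a := fun a ha => lt_of_le_of_ne (hw a ha) (Ne.symm (hz a ha))
  rcases E.eq_empty_or_nonempty with rfl | hEne
  · exact ⟨∅, by simp, by simp, by simp⟩
  -- swap lemma
  have hswap : ∀ (z : α → ℝ) (U : Finset V), ∑ v ∈ U, ∑ a ∈ E with v ∈ e a, z a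
      = ∑ a ∈ E, z a * ((e a ∩ U).card : ℝ) := by
    intro z U
    simp_rw [Finset.sum_filter]
    rw [Finset.sum_comm]
    apply Finset.sum_congr rfl
    intro a _
    rw [← Finset.sum_filter, Finset.sum_const, nsmul_eq_mul, mul_comm, Finset.filter_mem_eq_inter,
      Finset.inter_comm]
  let T : Finset V := Finset.univ.filter (fun v => ∑ a ∈ E with v ∈ e a, w a = 1)
  by_cases hTE : E.card ≤ T.card
  · -- heavy edge
    have hheavy : ∃ a ∈ E, 1 ≤ w a * ((e a).card : ℝ) := by
      by_contra hcon
      push Not at hcon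
      have h1 := hswap w T
      have h2 : ∑ v ∈ T, ∑ a ∈ E with v ∈ e a, w a = T.card := by
        rw [Finset.sum_congr rfl (g := fun _ => (1 : ℝ))]
        · simp
        · intro v hv; simpa [T] using hv
      have h3 : ∑ a ∈ E, w a * ((e a ∩ T).card : ℝ) < ∑ a ∈ E, (1 : ℝ) := by
        apply Finset.sum_lt_sum_of_nonempty hEne
        intro a ha
        refine lt_of_le_of_lt ?_ (hcon a ha)
        apply mul_le_mul_of_nonneg_left _ (hw a ha)
        exact_mod_cast Finset.card_le_card Finset.inter_subset_left
      have h4 : (E.card : ℝ) ≤ T.card := by exact_mod_cast hTE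
      simp at h3
      linarith
    obtain ⟨a, ha, hheavy⟩ := hheavy
    let E' := E.filter (fun b => Disjoint (e b) (e a))
    have haE' : a ∉ E' := by
      simp only [E', Finset.mem_filter, not_and, disjoint_self]
      intro _ h
      exact (he a ha).1.ne_empty h
    have hE'E : E' ⊆ E := Finset.filter_subset _ _
    obtain ⟨M, hM, hM1, hM2⟩ := ih E' w
      (fun b hb => hw b (hE'E hb)) (fun b hb => he b (hE'E hb))
      (fun v => le_trans (Finset.sum_le_sum_of_subset_of_nonneg
        (Finset.filter_subset_filter _ hE'E)
        (fun b hb _ => hw b (Finset.mem_filter.1 hb).1)) (hload v))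
      (hdrop _ _ ((Finset.ssubset_iff_of_subset hE'E).2 ⟨a, ha, haE'⟩))
    have haM : a ∉ M := fun h => haE' (hM h)
    have hMd : ∀ b ∈ M, Disjoint (e b) (e a) := fun b hb => (Finset.mem_filter.1 (hM hb)).2
    refine ⟨insert a M, Finset.insert_subset ha (hM.trans hE'E), ?_, ?_⟩
    · intro x hx y hy hxy
      rcases Finset.mem_insert.1 hx with rfl | hx'
      · rcases Finset.mem_insert.1 hy with rfl | hy
        · exact absurd rfl hxy
        · exact (hMd y hy).symm
      · rcases Finset.mem_insert.1 hy with rfl | hy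
        · exact hMd x (by assumption)
        · exact hM1 x hx' y hy hxy
    · rw [Finset.card_insert_of_notMem haM]
      push_cast
      have h1 := Finset.sum_filter_add_sum_filter_not E (fun b => Disjoint (e b) (e a)) w
      have h2 : ∑ v ∈ e a, ∑ b ∈ E with v ∈ e b, w b ≤ (e a).card := by
        calc _ ≤ ∑ v ∈ e a, (1 : ℝ) := Finset.sum_le_sum (fun v _ => hload v)
          _ = _ := by simp
      rw [hswap] at h2
      have h3 : ∑ b ∈ E with ¬ Disjoint (e b) (e a), w b + w a * ((e a).card - 1)
          ≤ ∑ b ∈ E, w b * ((e b ∩ e a).card : ℝ) := by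
        rw [Finset.sum_filter]
        have : w a * ((e a).card - 1 : ℝ) = ∑ b ∈ E, if b = a then w a * ((e a).card - 1 : ℝ) else 0 := by
          rw [Finset.sum_ite_eq' E a]; simp [ha]
        rw [this, ← Finset.sum_add_distrib]
        apply Finset.sum_le_sum
        intro b hb
        by_cases hba : b = a
        · subst hba
          have : ¬ Disjoint (e b) (e b) := by
            rw [disjoint_self]; exact (he b hb).1.ne_empty
          rw [if_pos this, if_pos rfl, Finset.inter_self]; linarith
        · by_cases hd : Disjoint (e b) (e a)
          · simp [hd, hba]
            exact mul_nonneg (hw b hb) (Nat.cast_nonneg _)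
          · simp only [hd, hba, not_false_eq_true, if_true, if_false, add_zero]
            have : 1 ≤ (e b ∩ e a).card := by
              rw [Nat.one_le_iff_ne_zero, Finset.card_ne_zero]
              exact Finset.not_disjoint_iff_nonempty_inter.1 hd
            have : (1 : ℝ) ≤ (e b ∩ e a).card := by exact_mod_cast this
            nlinarith [hw b hb]
      have hm1 : (1 : ℝ) ≤ ((e a).card : ℝ) := by exact_mod_cast (he a ha).1.card_pos
      have hmd : ((e a).card : ℝ) ≤ d := by exact_mod_cast (he a ha).2
      set m : ℝ := ((e a).card : ℝ) with hm
      have h4 : m - w a * (m - 1) ≤ (d : ℝ) - 1 + 1 / d := by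
        have hwm : 1 / m ≤ w a := by rw [div_le_iff₀ (by linarith)]; exact hheavy
        have h5 : 1 / m * (m - 1) ≤ w a * (m - 1) := mul_le_mul_of_nonneg_right hwm (by linarith)
        have h6 : 1 / m * (m - 1) = 1 - 1 / m := by field_simp
        have hd0 : (0 : ℝ) < d := by linarith
        have h7 : (d : ℝ) + 1 / d - (m + 1 / m) = (d - m) * (d * m - 1) / (d * m) := by
          have : m ≠ 0 := by linarith
          field_simp
          ring
        have h8 : 0 ≤ (d - m) * (d * m - 1) / (d * m) := by
          apply div_nonneg
          · apply mul_nonneg (by linarith); nlinarith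
          · nlinarith
        linarith
      have h9 : ∑ b ∈ E with Disjoint (e b) (e a), w b = ∑ b ∈ E', w b := rfl
      rw [← h1, h9]
      linarith
  · -- perturb
    push Not at hTE
    have hz : ∃ z : α → ℝ, (∃ a ∈ E, z a ≠ 0) ∧ (∀ v ∈ T, ∑ a ∈ E with v ∈ e a, z a = 0) ∧
        0 ≤ ∑ a ∈ E, z a := by
      let φ : (E → ℝ) →ₗ[ℝ] (T → ℝ) :=
        LinearMap.pi (fun v => ∑ a : E, if (v : V) ∈ e a then LinearMap.proj a else 0)
      have hker : LinearMap.ker φ ≠ ⊥ := by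
        apply LinearMap.ker_ne_bot_of_finrank_lt
        simpa using hTE
      obtain ⟨y, hy, hy0⟩ := Submodule.exists_mem_ne_zero_of_ne_bot hker
      let z : α → ℝ := fun a => if h : a ∈ E then y ⟨a, h⟩ else 0
      have hz0 : ∃ a ∈ E, z a ≠ 0 := by
        obtain ⟨a, ha⟩ := Function.ne_iff.1 hy0
        exact ⟨a, a.2, by simpa [z] using ha⟩
      have hzT : ∀ v ∈ T, ∑ a ∈ E with v ∈ e a, z a = 0 := by
        intro v hv
        have h1 := congrFun (LinearMap.mem_ker.1 hy) ⟨v, hv⟩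
        rw [Finset.sum_filter, ← Finset.sum_coe_sort]
        simp only [φ, LinearMap.pi_apply, LinearMap.sum_apply, Pi.zero_apply] at h1
        refine Eq.trans ?_ h1
        apply Finset.sum_congr rfl
        intro a _
        by_cases h : v ∈ e a
        · simp [h, z]
        · simp [h]
      rcases le_total 0 (∑ a ∈ E, z a) with h | h
      · exact ⟨z, hz0, hzT, h⟩
      · refine ⟨fun a => - z a, ?_, ?_, ?_⟩
        · obtain ⟨a, ha, h⟩ := hz0
          exact ⟨a, ha, neg_ne_zero.2 h⟩
        · intro v hv; rw [Finset.sum_neg_distrib, hzT v hv, neg_zero]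
        · rw [Finset.sum_neg_distrib]; linarith
    obtain ⟨z, ⟨a0, ha0, hza0⟩, hzT, hzs⟩ := hz
    obtain ⟨t, ht, hall, k, hk, hck, hkz⟩ := tk_move (E.disjSum (Finset.univ : Finset V))
      (Sum.elim w (fun v => 1 - ∑ a ∈ E with v ∈ e a, w a))
      (Sum.elim (fun a => - z a) (fun v => ∑ a ∈ E with v ∈ e a, z a))
      (by
        rintro (a | v) h
        · exact hw a (by simpa using h)
        · simpa using hload v)
      (by
        rintro (a | v) h
        · intro _; exact hpos a (by simpa using h)
        · simp only [Sum.elim_inr]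
          intro hc
          have : v ∉ T := fun hv => by rw [hzT v hv] at hc; exact lt_irrefl _ hc
          have h2 : ∑ a ∈ E with v ∈ e a, w a ≠ 1 := by simpa [T] using this
          have := lt_of_le_of_ne (hload v) h2
          linarith)
      (by
        by_cases hneg : ∃ a ∈ E, z a < 0
        · obtain ⟨a, ha, h⟩ := hneg
          exact ⟨Sum.inl a, by simpa using ha, by simpa using h⟩
        · push Not at hneg
          obtain ⟨v, hv⟩ := (he a0 ha0).1
          refine ⟨Sum.inr v, by simp, ?_⟩
          simp only [Sum.elim_inr]
          apply Finset.sum_pos'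
          · intro a ha; exact hneg a (Finset.mem_filter.1 ha).1
          · exact ⟨a0, by simp [ha0, hv], lt_of_le_of_ne (hneg a0 ha0) (Ne.symm hza0)⟩)
    let w' : α → ℝ := fun a => w a + t * z a
    have hlw' : ∀ v, ∑ a ∈ E with v ∈ e a, w' a
        = ∑ a ∈ E with v ∈ e a, w a + t * ∑ a ∈ E with v ∈ e a, z a := by
      intro v; simp only [w']; rw [Finset.sum_add_distrib, Finset.mul_sum]
    have hw' : ∀ a ∈ E, 0 ≤ w' a := by
      intro a ha
      have := hall (Sum.inl a) (by simpa using ha)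
      simp only [Sum.elim_inl] at this
      simp only [w']; linarith
    have hl' : ∀ v, ∑ a ∈ E with v ∈ e a, w' a ≤ 1 := by
      intro v
      have := hall (Sum.inr v) (by simp)
      simp only [Sum.elim_inr] at this
      rw [hlw']; linarith
    have hsum : ∑ a ∈ E, w a ≤ ∑ a ∈ E, w' a := by
      simp only [w']
      rw [Finset.sum_add_distrib, ← Finset.mul_sum]
      have := mul_nonneg ht.le hzs
      linarith
    have hfin : ∃ M ⊆ E, (∀ a ∈ M, ∀ b ∈ M, a ≠ b → Disjoint (e a) (e b)) ∧
        ∑ a ∈ E, w' a ≤ ((d : ℝ) - 1 + 1 / d) * M.card := by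
      rcases k with a | v
      · apply hzero w' hw' hl'
        refine ⟨a, by simpa using hk, ?_⟩
        simp only [Sum.elim_inl] at hkz
        simp only [w']; linarith
      · apply ih E w' hw' he hl'
        simp only [Sum.elim_inr] at hkz hck
        have hlt : (Finset.univ.filter (fun v => ∑ a ∈ E with v ∈ e a, w' a ≠ 1)).card
            < (Finset.univ.filter (fun v => ∑ a ∈ E with v ∈ e a, w a ≠ 1)).card := by
          apply Finset.card_lt_card
          rw [Finset.ssubset_iff_of_subset]
          · refine ⟨v, ?_, ?_⟩
            · simp only [Finset.mem_filter, Finset.mem_univ, true_and]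
              intro h
              have hvT : v ∈ T := by simpa [T] using h
              rw [hzT v hvT] at hck
              exact lt_irrefl _ hck
            · simp only [Finset.mem_filter, Finset.mem_univ, true_and, not_not]
              rw [hlw']; linarith
          · intro u
            simp only [Finset.mem_filter, Finset.mem_univ, true_and]
            intro h h'
            apply h
            have huT : u ∈ T := by simpa [T] using h'
            rw [hlw', hzT u huT, h']; ring
        omega
    obtain ⟨M, h1, h2, h3⟩ := hfin
    exact ⟨M, h1, h2, hsum.trans h3⟩

lemma tk_nonempty {d : ℕ} (hd : 0 < d) {h : Set ℝ} (hh : IsDInterval d h) : h.Nonempty := by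
  obtain ⟨a, b, hab, rfl⟩ := hh
  exact ⟨a ⟨0, hd⟩, Set.mem_iUnion.2 ⟨⟨0, hd⟩, le_rfl, hab _⟩⟩

lemma tk_compact {d : ℕ} {h : Set ℝ} (hh : IsDInterval d h) : IsCompact h := by
  obtain ⟨a, b, hab, rfl⟩ := hh
  exact isCompact_iUnion (fun i => isCompact_Icc)

/-- The `j`-th cut point determined by `x`. -/
def tkCut (R : ℝ) {n : ℕ} (j : ℕ) (x : Fin n → ℝ) : ℝ :=
  -R + 2 * R * ∑ i : Fin n, if i.val < j then x i else 0

lemma tkCut_cont (R : ℝ) {n : ℕ} (j : ℕ) : Continuous (fun x : Fin n → ℝ => tkCut R j x) := by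
  unfold tkCut
  refine continuous_const.add (continuous_const.mul (continuous_finsetSum _ ?_))
  intro i _
  split_ifs
  · exact continuous_apply i
  · exact continuous_const

lemma tkCut_zero (R : ℝ) {n : ℕ} (x : Fin n → ℝ) : tkCut R 0 x = -R := by
  simp [tkCut]

lemma tkCut_last (R : ℝ) {n : ℕ} (x : Fin n → ℝ) (hx : x ∈ stdSimplex ℝ (Fin n)) :
    tkCut R n x = R := by
  have : ∑ i : Fin n, (if i.val < n then x i else 0) = 1 := by
    rw [← hx.2]
    exact Finset.sum_congr rfl (fun i _ => by simp [i.2])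
  rw [tkCut, this]; ring

lemma tkCut_succ (R : ℝ) {n : ℕ} (x : Fin n → ℝ) (i : Fin n) :
    tkCut R (i.val + 1) x = tkCut R i.val x + 2 * R * x i := by
  have : ∑ k : Fin n, (if k.val < i.val + 1 then x k else 0)
      = ∑ k : Fin n, (if k.val < i.val then x k else 0) + x i := by
    have h : x i = ∑ k : Fin n, if k = i then x k else 0 := by simp
    rw [h, ← Finset.sum_add_distrib]
    apply Finset.sum_congr rfl
    intro k _
    by_cases h1 : k = i
    · subst h1; simp
    · have : k.val ≠ i.val := fun h => h1 (Fin.ext h)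
      by_cases h2 : k.val < i.val
      · simp [h1, h2, Nat.lt_succ_of_lt h2]
      · have : ¬ k.val < i.val + 1 := by omega
        simp [h1, h2, this]
  rw [tkCut, this, tkCut]; ring

lemma tkCut_mono (R : ℝ) (hR : 0 ≤ R) {n : ℕ} (x : Fin n → ℝ) (hx : ∀ i, 0 ≤ x i) :
    Monotone (fun j => tkCut R j x) := by
  intro j k hjk
  simp only [tkCut]
  have : ∑ i : Fin n, (if i.val < j then x i else 0) ≤
      ∑ i : Fin n, (if i.val < k then x i else 0) := by
    apply Finset.sum_le_sum
    intro i _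
    have := hx i
    split_ifs <;> first | omega | linarith
  have := mul_le_mul_of_nonneg_left this (by linarith : 0 ≤ 2 * R)
  linarith

/-- distance of `h` to the cut points -/
noncomputable def tkQ (R : ℝ) {n : ℕ} (h : Set ℝ) (x : Fin n → ℝ) : ℝ :=
  (Finset.range (n + 1)).inf' Finset.nonempty_range_add_one
    (fun j => Metric.infDist (tkCut R j x) h)

/-- depth of `h` in the `i`-th gap -/
noncomputable def tkU (R : ℝ) {n : ℕ} (h : Set ℝ) (i : Fin n) (x : Fin n → ℝ) : ℝ :=
  (tkCut R (i.val + 1) x - tkCut R i.val x) / 2 -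
    Metric.infDist ((tkCut R (i.val + 1) x + tkCut R i.val x) / 2) h

/-- weight of `h` at vertex `i` -/
noncomputable def tkW (R : ℝ) {n : ℕ} (h : Set ℝ) (i : Fin n) (x : Fin n → ℝ) : ℝ :=
  max 0 (min (tkQ R h x) (tkU R h i x))

lemma tkW_cont (R : ℝ) {n : ℕ} (h : Set ℝ) (i : Fin n) : Continuous (tkW R h i) := by
  unfold tkW
  refine continuous_const.max (Continuous.min ?_ ?_)
  · unfold tkQ
    exact Continuous.finset_inf'_apply _ (fun j _ =>
      (Metric.continuous_infDist_pt h).comp (tkCut_cont R j))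
  · unfold tkU
    refine Continuous.sub (((tkCut_cont R _).sub (tkCut_cont R _)).div_const 2) ?_
    exact (Metric.continuous_infDist_pt h).comp
      (((tkCut_cont R _).add (tkCut_cont R _)).div_const 2)

lemma tkQ_nonneg (R : ℝ) {n : ℕ} (h : Set ℝ) (x : Fin n → ℝ) : 0 ≤ tkQ R h x := by
  unfold tkQ
  rw [Finset.le_inf'_iff]
  intro j _
  exact Metric.infDist_nonneg

lemma tkQ_pos (R : ℝ) {n : ℕ} (h : Set ℝ) (x : Fin n → ℝ) (hc : IsClosed h) (hn : h.Nonempty) :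
    0 < tkQ R h x ↔ ∀ j ≤ n, tkCut R j x ∉ h := by
  unfold tkQ
  rw [Finset.lt_inf'_iff]
  constructor
  · intro H j hj
    exact (hc.notMem_iff_infDist_pos hn).2 (H j (by simp; omega))
  · intro H j hj
    exact (hc.notMem_iff_infDist_pos hn).1 (H j (by simp at hj; omega))

/-- `h` meets the `i`-th open gap -/
def tkMeets (R : ℝ) {n : ℕ} (h : Set ℝ) (x : Fin n → ℝ) (i : Fin n) : Prop :=
  ∃ t ∈ h, tkCut R i.val x < t ∧ t < tkCut R (i.val + 1) x

lemma tkW_meets (R : ℝ) {n : ℕ} (h : Set ℝ) (x : Fin n → ℝ) (i : Fin n)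
    (hm : tkMeets R h x i) : tkW R h i x = tkQ R h x := by
  obtain ⟨t, ht, h1, h2⟩ := hm
  unfold tkW
  set s := tkCut R i.val x with hs
  set s' := tkCut R (i.val + 1) x with hs'
  have hq1 : tkQ R h x ≤ t - s := by
    have : tkQ R h x ≤ Metric.infDist (tkCut R i.val x) h :=
      Finset.inf'_le _ (by rw [Finset.mem_range]; omega)
    have h3 := Metric.infDist_le_dist_of_mem (x := tkCut R i.val x) ht
    rw [dist_comm, Real.dist_eq, ← hs, abs_of_pos (by linarith)] at h3
    linarith
  have hq2 : tkQ R h x ≤ s' - t := by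
    have : tkQ R h x ≤ Metric.infDist (tkCut R (i.val + 1) x) h :=
      Finset.inf'_le _ (by simp)
    have h3 := Metric.infDist_le_dist_of_mem (x := tkCut R (i.val + 1) x) ht
    rw [Real.dist_eq, ← hs', abs_of_pos (by linarith)] at h3
    linarith
  have hu : tkQ R h x ≤ tkU R h i x := by
    unfold tkU
    rw [← hs, ← hs']
    have h3 := Metric.infDist_le_dist_of_mem (x := (s' + s) / 2) ht
    rw [Real.dist_eq] at h3
    have h4 : |(s' + s) / 2 - t| ≤ (s' - s) / 2 - tkQ R h x := by
      rw [abs_le]; constructor <;> linarith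
    linarith
  rw [min_eq_left hu, max_eq_right (tkQ_nonneg R h x)]

lemma tkW_not_meets (R : ℝ) {n : ℕ} (h : Set ℝ) (hn : h.Nonempty) (x : Fin n → ℝ) (i : Fin n)
    (hm : ¬ tkMeets R h x i) : tkW R h i x = 0 := by
  unfold tkW
  apply max_eq_left
  apply (min_le_right _ _).trans
  unfold tkU
  set s := tkCut R i.val x with hs
  set s' := tkCut R (i.val + 1) x with hs'
  rw [sub_nonpos, Metric.le_infDist hn]
  intro t ht
  rw [Real.dist_eq]
  by_contra hcon
  push Not at hcon
  rw [abs_lt] at hcon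
  exact hm ⟨t, ht, by rw [← hs]; linarith, by rw [← hs']; linarith⟩

/-- The Tardos–Kaiser theorem: for a finite hypergraph `F` of `d`-intervals,
`τ(F) ≤ (d² - d + 1) ν(F)`. -/
theorem tardos_kaiser (d : ℕ) (hd : 0 < d) (F : Finset (Set ℝ))
    (hF : ∀ h ∈ F, IsDInterval d h) (ν : ℕ)
    (hν : ∀ M : Finset (Set ℝ), M ⊆ F →
      (↑M : Set (Set ℝ)).Pairwise (fun a b => Disjoint a b) → M.card ≤ ν) :
    ∃ C : Finset ℝ, (∀ h ∈ F, ∃ x ∈ C, x ∈ h) ∧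
      C.card ≤ (d ^ 2 - d + 1) * ν := by
  classical
  rcases F.eq_empty_or_nonempty with rfl | ⟨h0, hh0⟩
  · exact ⟨∅, by simp, by simp⟩
  have hν1 : 1 ≤ ν := by
    have := hν {h0} (by simpa using hh0) (by simp)
    simpa using this
  by_contra hno
  push Not at hno
  have hne : ∀ h ∈ F, h.Nonempty := fun h hh => tk_nonempty hd (hF h hh)
  have hcl : ∀ h ∈ F, IsClosed h := fun h hh => (tk_compact (hF h hh)).isClosed
  -- bounding box
  obtain ⟨R, hR, hbox⟩ : ∃ R : ℝ, 0 < R ∧ ∀ h ∈ F, ∀ t ∈ h, -R < t ∧ t < R := by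
    have hb : Bornology.IsBounded (⋃ h ∈ F, h) :=
      (Bornology.isBounded_biUnion_finset F).2 (fun h hh => (tk_compact (hF h hh)).isBounded)
    obtain ⟨R, hR, hsub⟩ := hb.exists_pos_norm_lt
    refine ⟨R, hR, fun h hh t ht => ?_⟩
    have := hsub t (Set.mem_biUnion hh ht)
    rw [Real.norm_eq_abs, abs_lt] at this
    exact this
  set k := (d ^ 2 - d + 1) * ν with hk
  have hk1 : 1 ≤ k := Nat.mul_pos (Nat.succ_pos _) hν1
  set n := k + 1 with hn
  let D : Fin n → (Fin n → ℝ) → ℝ := fun i x => ∑ h ∈ F, tkW R h i x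
  have hDc : ∀ i, Continuous (D i) := fun i =>
    continuous_finsetSum _ (fun h _ => tkW_cont R h i)
  have hn0 : (0 : ℝ) < n := by
    have : 0 < n := by omega
    exact_mod_cast this
  have hD0 : ∀ i x, 0 ≤ D i x := fun i x => Finset.sum_nonneg (fun h _ => le_max_left _ _)
  obtain ⟨p, hp, hgp⟩ := tk_kkm n (by omega) (fun i x => n * D i x - ∑ j, D j x)
    (fun i => (continuous_const.mul (hDc i)).sub (continuous_finsetSum _ (fun j _ => hDc j)))
    (by
      intro x _
      by_contra hcon
      push Not at hcon
      have : ∑ i : Fin n, (∑ j, D j x) < ∑ i : Fin n, n * D i x := by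
        apply Finset.sum_lt_sum_of_nonempty
        · exact ⟨⟨0, by omega⟩, Finset.mem_univ _⟩
        · intro i _
          have := hcon i
          linarith
      rw [← Finset.mul_sum, Finset.sum_const, Finset.card_univ, Fintype.card_fin,
        nsmul_eq_mul] at this
      exact lt_irrefl _ this)
    (by
      intro x hx i hi
      have : D i x = 0 := by
        apply Finset.sum_eq_zero
        intro h hh
        apply tkW_not_meets R h (hne h hh)
        rintro ⟨t, ht, h1, h2⟩
        rw [tkCut_succ, hi] at h2
        linarith
      rw [this, mul_zero, zero_sub, neg_nonpos]
      exact Finset.sum_nonneg (fun j _ => hD0 j x))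
  -- all degrees agree
  have hDeq : ∀ i, n * D i p = ∑ j, D j p := by
    intro i
    have h1 : ∑ i : Fin n, (∑ j, D j p - n * D i p) = 0 := by
      rw [Finset.sum_sub_distrib, ← Finset.mul_sum, Finset.sum_const, Finset.card_univ,
        Fintype.card_fin, nsmul_eq_mul]
      ring
    have h2 := (Finset.sum_eq_zero_iff_of_nonneg (fun j _ => by
      have := hgp j; linarith)).1 h1 i (Finset.mem_univ _)
    linarith
  have hmono := tkCut_mono R hR.le p hp.1
  have hloc : ∀ h ∈ F, 0 < tkQ R h p → ∀ t ∈ h, ∃ i : Fin n,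
      tkCut R i.val p < t ∧ t < tkCut R (i.val + 1) p := by
    intro h hh hq t ht
    have hav := (tkQ_pos R h p (hcl h hh) (hne h hh)).1 hq
    have hex : ∃ j, t < tkCut R j p := ⟨n, by
      rw [tkCut_last R p hp]; exact (hbox h hh t ht).2⟩
    have hfle : Nat.find hex ≤ n := Nat.find_min' hex (by
      rw [tkCut_last R p hp]; exact (hbox h hh t ht).2)
    have hfpos : Nat.find hex ≠ 0 := by
      intro h0
      have := Nat.find_spec hex
      rw [h0, tkCut_zero] at this
      have := (hbox h hh t ht).1
      linarith
    obtain ⟨j, hj⟩ := Nat.exists_eq_succ_of_ne_zero hfpos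
    refine ⟨⟨j, by omega⟩, ?_, ?_⟩
    · have h1 : ¬ t < tkCut R j p := Nat.find_min hex (by omega)
      refine lt_of_le_of_ne (not_lt.1 h1) ?_
      intro he
      exact hav j (by omega) (he ▸ ht)
    · have := Nat.find_spec hex
      rw [hj] at this
      exact this
  -- some edge avoids all the cuts
  obtain ⟨h1, hh1, hq1⟩ : ∃ h ∈ F, 0 < tkQ R h p := by
    by_contra hcon
    push Not at hcon
    have hcard := hno ((Finset.Ico 1 n).image (fun j => tkCut R j p)) (by
      intro h hh
      have h2 : ¬ ∀ j ≤ n, tkCut R j p ∉ h := by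
        rw [← tkQ_pos R h p (hcl h hh) (hne h hh)]
        exact not_lt.2 (hcon h hh)
      push Not at h2
      obtain ⟨j, hj, hjh⟩ := h2
      refine ⟨tkCut R j p, Finset.mem_image.2 ⟨j, ?_, rfl⟩, hjh⟩
      rw [Finset.mem_Ico]
      have hb := hbox h hh _ hjh
      constructor
      · by_contra h0
        have : j = 0 := by omega
        rw [this, tkCut_zero] at hb
        exact lt_irrefl _ hb.1
      · by_contra h0
        have : j = n := by omega
        rw [this, tkCut_last R p hp] at hb
        exact lt_irrefl _ hb.2)
    have := Finset.card_image_le (s := Finset.Ico 1 n) (f := fun j => tkCut R j p)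
    rw [Nat.card_Ico] at this
    omega
  have hSpos : 0 < ∑ j, D j p := by
    obtain ⟨t, ht⟩ := hne h1 hh1
    obtain ⟨i, hi⟩ := hloc h1 hh1 hq1 t ht
    have h2 : tkW R h1 i p = tkQ R h1 p := tkW_meets R h1 p i ⟨t, ht, hi⟩
    have h3 : tkW R h1 i p ≤ D i p :=
      Finset.single_le_sum (f := fun h => tkW R h i p) (fun h _ => le_max_left _ _) hh1
    have h4 : D i p ≤ ∑ j, D j p :=
      Finset.single_le_sum (f := fun j => D j p) (fun j _ => hD0 j p) (Finset.mem_univ i)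
    linarith
  set A : ℝ := (∑ j, D j p) / n with hA
  have hApos : 0 < A := div_pos hSpos hn0
  have hDA : ∀ i, D i p = A := by
    intro i
    rw [hA, eq_div_iff hn0.ne', ← hDeq i]; ring
  -- the auxiliary hypergraph
  let e : Set ℝ → Finset (Fin n) := fun h => Finset.univ.filter (fun i => tkMeets R h p i)
  let E : Finset (Set ℝ) := F.filter (fun h => 0 < tkQ R h p)
  let w : Set ℝ → ℝ := fun h => tkQ R h p / A
  have hEF : E ⊆ F := Finset.filter_subset _ _
  have hload : ∀ v, ∑ a ∈ E with v ∈ e a, w a = 1 := by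
    intro v
    have h2 : ∑ a ∈ E with v ∈ e a, tkQ R a p = D v p := by
      simp only [E, Finset.filter_filter, D]
      rw [Finset.sum_filter]
      apply Finset.sum_congr rfl
      intro h hh
      by_cases hm : tkMeets R h p v
      · rw [tkW_meets R h p v hm]
        by_cases hq : 0 < tkQ R h p
        · simp [hq, e, hm]
        · have : tkQ R h p = 0 := le_antisymm (not_lt.1 hq) (tkQ_nonneg R h p)
          simp [this]
      · rw [tkW_not_meets R h (hne h hh) p v hm]
        simp [e, hm]
    simp only [w]
    rw [← Finset.sum_div, h2, hDA, div_self hApos.ne']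
  have hecard : ∀ h ∈ E, (e h).Nonempty ∧ (e h).card ≤ d := by
    intro h hh
    rw [Finset.mem_filter] at hh
    obtain ⟨hhF, hq⟩ := hh
    constructor
    · obtain ⟨t, ht⟩ := hne h hhF
      obtain ⟨i, hi⟩ := hloc h hhF hq t ht
      exact ⟨i, Finset.mem_filter.2 ⟨Finset.mem_univ _, ⟨t, ht, hi⟩⟩⟩
    · have hav := (tkQ_pos R h p (hcl h hhF) (hne h hhF)).1 hq
      obtain ⟨a, b, hab, hU⟩ := hF h hhF
      have hch : ∀ i : Fin n, ∃ cc : Fin d, tkMeets R h p i →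
          tkCut R i.val p < a cc ∧ a cc < tkCut R (i.val + 1) p := by
        intro i
        by_cases hm : tkMeets R h p i
        · obtain ⟨t, ht, h2, h3⟩ := hm
          have ht' := ht
          rw [hU, Set.mem_iUnion] at ht'
          obtain ⟨cc, hcc⟩ := ht'
          refine ⟨cc, fun _ => ⟨?_, lt_of_le_of_lt hcc.1 h3⟩⟩
          by_contra hle
          push Not at hle
          apply hav i.val (by omega)
          rw [hU]
          exact Set.mem_iUnion.2 ⟨cc, hle, h2.le.trans hcc.2⟩
        · exact ⟨⟨0, hd⟩, fun h => absurd h hm⟩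
      choose f hf using hch
      have hinj : Set.InjOn f (e h) := by
        intro i hi j hj hij
        have hi' := hf i (by simpa [e] using hi)
        have hj' := hf j (by simpa [e] using hj)
        rw [← hij] at hj'
        ext
        by_contra hne'
        rcases lt_or_gt_of_ne hne' with hlt | hlt
        · have : tkCut R (i.val + 1) p ≤ tkCut R j.val p := hmono (by omega)
          linarith [hi'.2, hj'.1]
        · have : tkCut R (j.val + 1) p ≤ tkCut R i.val p := hmono (by omega)
          linarith [hi'.1, hj'.2]
      have := Finset.card_le_card_of_injOn (t := (Finset.univ : Finset (Fin d))) f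
        (fun _ _ => Finset.mem_univ _) hinj
      simpa using this
  have hw0 : ∀ a ∈ E, 0 ≤ w a := fun a _ => div_nonneg (tkQ_nonneg R a p) hApos.le
  obtain ⟨M, hME, hMd, hMw⟩ := tk_furedi d e _ E w hw0 hecard (fun v => by
    exact le_of_eq (by convert hload v)) (Nat.lt_succ_self _)
  have hMcard : M.card ≤ ν := by
    apply hν M (hME.trans hEF)
    intro a ha b hb hab
    have hdis := hMd a ha b hb hab
    rw [Set.disjoint_left]
    intro t hta htb
    obtain ⟨haF, hqa⟩ := Finset.mem_filter.1 (hME ha)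
    obtain ⟨i, hi⟩ := hloc a haF hqa t hta
    exact Finset.disjoint_left.1 hdis (Finset.mem_filter.2 ⟨Finset.mem_univ _, ⟨t, hta, hi⟩⟩)
      (Finset.mem_filter.2 ⟨Finset.mem_univ _, ⟨t, htb, hi⟩⟩)
  have hnle : (n : ℝ) ≤ d * ∑ a ∈ E, w a := by
    have h2 : ∑ v : Fin n, ∑ a ∈ E with v ∈ e a, w a = n := by
      rw [Finset.sum_congr rfl (fun v _ => hload v)]; simp
    rw [← h2]
    simp_rw [Finset.sum_filter]
    rw [Finset.sum_comm, Finset.mul_sum]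
    apply Finset.sum_le_sum
    intro a ha
    rw [← Finset.sum_filter, Finset.sum_const, nsmul_eq_mul]
    apply mul_le_mul_of_nonneg_right _ (hw0 a ha)
    have := (hecard a ha).2
    have h3 : (Finset.univ.filter (fun v => v ∈ e a)) = e a := by ext; simp
    rw [h3]
    exact_mod_cast this
  have hd1 : (1 : ℝ) ≤ d := by exact_mod_cast hd
  have hkey : (n : ℝ) ≤ (d ^ 2 - d + 1) * M.card := by
    refine hnle.trans ((mul_le_mul_of_nonneg_left hMw (by linarith)).trans (le_of_eq ?_))
    have hdd : (d : ℝ) * (1 / d) = 1 := mul_one_div_cancel (by linarith)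
    linear_combination (M.card : ℝ) * hdd
  have hk' : (k : ℝ) = ((d : ℝ) ^ 2 - d + 1) * ν := by
    rw [hk]
    have : d ≤ d ^ 2 := by nlinarith
    push_cast [Nat.cast_sub this]
    ring
  have hMν : (M.card : ℝ) ≤ ν := by exact_mod_cast hMcard
  have h5 : ((d : ℝ) ^ 2 - d + 1) * M.card ≤ ((d : ℝ) ^ 2 - d + 1) * ν :=
    mul_le_mul_of_nonneg_left hMν (by nlinarith)
  have h6 : (n : ℝ) = k + 1 := by rw [hn]; push_cast; ring
  linarith
end
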